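/- There exist constants λ > 0 depending only on n and C > 0 depending only on n and B such that for all δ ≥ 2ε: ∫_{B_δ(0) ∩ ℝ^n_+} [ (1/4) u_ε² Σ_{i,k,l=1}^n ∂_l H_{ik} ∂_l H_{ik} − (1/2) u_ε² Σ_{i,k,l=1}^n ∂_k H_{ik} ∂_l H_{il} − 2 u_ε Σ_{i,k,l=1}^n ∂_k u_ε H_{ik} ∂_l H_{il} − (2(n−1)/(n−2)) Σ_{i,k,l=1}^n ∂_k u_ε ∂_l u_ε H_{ik} H_{il} − 2 u_ε w Σ_{i,k=1}^n ∂_i ∂_k H_{ik} + (8(n−1)/(n−2)) Σ_{i,k=1}^n ∂_i u_ε ∂_k w H_{ik} − (4(n−1)/(n−2)) |dw|² + (4(n−1)/(n−2)) n(n+2) u_ε^{4/(n−2)} w² ] dx ≥ 2λ Σ_{2 ≤ |α| ≤ d} Σ_{i,k=1}^n |h_{ik,α}|² ε^{n−2} ∫_{B_δ(0) ∩ ℝ^n_+} (ε + |x|)^{2|α|+2−2n} dx − C Σ_{2 ≤ |α| ≤ d} Σ_{i,k=1}^n |h_{ik,α}|² δ^{2|α|+2−n} ε^{n−2}. -/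

import Mathlib

noncomputable section

open MeasureTheory Metric

/-- Euclidean space `ℝ^n`. -/
abbrev Euc (n : ℕ) := EuclideanSpace ℝ (Fin n)

/-- Partial derivative in the `i`-th coordinate direction. -/
def pd {n : ℕ} (i : Fin n) (f : Euc n → ℝ) : Euc n → ℝ :=
  fun x => fderiv ℝ f x (EuclideanSpace.single i 1)

/-- Kronecker delta. -/
def kd {n : ℕ} (i k : Fin n) : ℝ := if i = k then 1 else 0

/-- The finite set of multi-indices `α` with `2 ≤ |α| ≤ d`. -/
def MIdx (n d : ℕ) : Finset (Fin n → ℕ) :=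
  (Fintype.piFinset fun _ : Fin n => Finset.range (d + 1)).filter
    fun α => 2 ≤ ∑ i, α i ∧ ∑ i, α i ≤ d

/-- The standard bubble `u_ε(x) = (ε/(ε² + |x|²))^{(n-2)/2}`. -/
def uE (n : ℕ) (ε : ℝ) : Euc n → ℝ :=
  fun x => (ε / (ε ^ 2 + ‖x‖ ^ 2)) ^ (((n : ℝ) - 2) / 2)

/-- `S_{ik} = ∂_i V_k + ∂_k V_i - (2/n) (div V) δ_{ik}`. -/
def Sop {n : ℕ} (V : Fin n → Euc n → ℝ) (i k : Fin n) : Euc n → ℝ :=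
  fun x => pd i (V k) x + pd k (V i) x - (2 / (n : ℝ)) * (∑ m, pd m (V m) x) * kd i k

/-- `T_{ik} = H_{ik} - S_{ik}`. -/
def Tten {n : ℕ} (H : Fin n → Fin n → Euc n → ℝ) (V : Fin n → Euc n → ℝ) (i k : Fin n) :
    Euc n → ℝ :=
  fun x => H i k x - Sop V i k x

/-- The tensor `Q_{ik,l}`. -/
def Qop {n : ℕ} (ε : ℝ) (H : Fin n → Fin n → Euc n → ℝ) (V : Fin n → Euc n → ℝ)
    (i k l : Fin n) : Euc n → ℝ :=
  fun x =>
    uE n ε x * pd l (Tten H V i k) x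
      - (2 / ((n : ℝ) - 2)) * pd i (uE n ε) x * Tten H V k l x
      - (2 / ((n : ℝ) - 2)) * pd k (uE n ε) x * Tten H V i l x
      + (2 / ((n : ℝ) - 2)) * (∑ p, pd p (uE n ε) x * Tten H V i p x) * kd k l
      + (2 / ((n : ℝ) - 2)) * (∑ p, pd p (uE n ε) x * Tten H V k p x) * kd i l

/-- The function `w = Σ_l ∂_l u_ε V_l + ((n-2)/(2n)) u_ε div V`. -/
def wop {n : ℕ} (ε : ℝ) (V : Fin n → Euc n → ℝ) : Euc n → ℝ :=
  fun x => (∑ l, pd l (uE n ε) x * V l x)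
    + (((n : ℝ) - 2) / (2 * (n : ℝ))) * uE n ε x * (∑ l, pd l (V l) x)

/-- Iterated partial derivative along a list of coordinate directions. -/
def pdIter {n : ℕ} : List (Fin n) → (Euc n → ℝ) → (Euc n → ℝ)
  | [], f => f
  | i :: t, f => pd i (pdIter t f)

set_option linter.unusedSimpArgs false
set_option linter.unusedSectionVars false
open Finset (sum_congr mul_sum sum_add_distrib sum_sub_distrib sum_comm sum_mul mem_univ sum_nonneg sum_eq_zero sum_le_sum sum_ite_eq sum_ite_eq' sum_const_zero single_le_sum)


structure Bg (n : ℕ) (A : Type*) [CommRing A] [Algebra ℝ A] where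
  D : Fin n → Derivation ℝ A A
  comm : ∀ i j f, D i (D j f) = D j (D i f)
  s : A
  U : A
  κ : A
  ν : A
  N : A
  p : Fin n → A
  Dκ : ∀ i, D i κ = 0
  Dν : ∀ i, D i ν = 0
  DN : ∀ i, D i N = 0
  Ds : ∀ i, D i s = - (s * p i)
  Dp : ∀ j i, D j (p i) = (if i = j then κ * s else 0) - p i * p j
  DU : ∀ i, D i U = - (2 * N * p i * U)
  pp : ∑ i, p i * p i = 2 * κ * s - 4 * s ^ 2
  hν : (n : A) * ν = 1
  hN : (n : A) = 2 * N + 2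

namespace Bg
variable {n : ℕ} {A : Type*} [CommRing A] [Algebra ℝ A] (b : Bg n A) (V : Fin n → A)

def th : A := ∑ m, b.D m (V m)
def S (i k : Fin n) : A := b.D i (V k) + b.D k (V i) - if i = k then 2 * b.ν * b.th V else 0
def pV : A := ∑ l, b.p l * V l
def ph : A := b.ν * b.th V - b.pV V
def div (G : Fin n → Fin n → A) (i : Fin n) : A := ∑ k, b.D k (G i k)
def dot (G : Fin n → Fin n → A) (i : Fin n) : A := ∑ k, b.p k * G i k
def lap (f : A) : A := ∑ l, b.D l (b.D l f)
def pd1 (f : A) : A := ∑ l, b.p l * b.D l f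
def g (k : Fin n) : A := ∑ l, b.p l * b.D k (V l)

lemma D2 (i : Fin n) : b.D i 2 = 0 := by
  have := (b.D i).map_natCast 2; simpa using this

lemma Dn (i : Fin n) : b.D i (n : A) = 0 := (b.D i).map_natCast n

lemma D_mul (i : Fin n) (f h : A) : b.D i (f * h) = f * b.D i h + h * b.D i f := by
  rw [Derivation.leibniz]; simp

lemma D_S (j i k : Fin n) : b.D j (b.S V i k) = b.D j (b.D i (V k)) + b.D j (b.D k (V i))
    - if i = k then 2 * b.ν * b.D j (b.th V) else 0 := by
  unfold S
  split_ifs <;> simp [D_mul, b.Dν, b.D2]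

lemma S_symm (i k : Fin n) : b.S V i k = b.S V k i := by
  unfold S; simp only [eq_comm (a := i)]; ring

lemma D_pV (k : Fin n) : b.D k (b.pV V) = b.κ * b.s * V k - b.p k * b.pV V + b.g V k := by
  unfold pV g
  simp only [map_sum, D_mul, b.Dp, sum_add_distrib, mul_sub, sum_sub_distrib,
    mul_sum]
  simp only [mul_ite, mul_zero, sum_ite_eq', mem_univ, if_true]
  have : ∑ i, V i * (b.p i * b.p k) = ∑ i, b.p k * (b.p i * V i) :=
    sum_congr rfl fun i _ => by ring
  rw [this]; ring

lemma D_g (i k : Fin n) : b.D i (b.g V k) = b.κ * b.s * b.D k (V i) - b.p i * b.g V k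
    + ∑ l, b.p l * b.D i (b.D k (V l)) := by
  unfold g
  simp only [map_sum, D_mul, b.Dp, sum_add_distrib, mul_sub, sum_sub_distrib,
    mul_sum]
  simp only [mul_ite, mul_zero, sum_ite_eq', mem_univ, if_true]
  have : ∑ l, b.D k (V l) * (b.p l * b.p i) = ∑ l, b.p i * (b.p l * b.D k (V l)) :=
    sum_congr rfl fun i _ => by ring
  rw [this]; ring

lemma D_ph (k : Fin n) : b.D k (b.ph V) = b.ν * b.D k (b.th V)
    - (b.κ * b.s * V k - b.p k * b.pV V + b.g V k) := by
  unfold ph; rw [map_sub, D_pV, D_mul, b.Dν]; ring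

lemma D_D_ph (i k : Fin n) : b.D i (b.D k (b.ph V)) = b.ν * b.D i (b.D k (b.th V))
    - (b.κ * b.s * b.D i (V k) - b.κ * b.s * b.p i * V k
      - ((if k = i then b.κ * b.s else 0) - b.p k * b.p i) * b.pV V
      - b.p k * (b.κ * b.s * V i - b.p i * b.pV V + b.g V i)
      + (b.κ * b.s * b.D k (V i) - b.p i * b.g V k + ∑ l, b.p l * b.D i (b.D k (V l)))) := by
  rw [D_ph]
  simp only [map_sub, map_add, D_mul, D_pV, D_g, b.Dp, b.Dν, b.Dκ, b.Ds]
  ring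

lemma div_S (i : Fin n) : b.div (b.S V) i = b.lap (V i) + (1 - 2 * b.ν) * b.D i (b.th V) := by
  unfold div lap
  simp only [D_S, sum_add_distrib, sum_sub_distrib, sum_ite_eq,
    mem_univ, if_true]
  have : ∑ k, b.D k (b.D i (V k)) = b.D i (b.th V) := by
    unfold th; rw [map_sum]; exact sum_congr rfl fun k _ => b.comm _ _ _
  rw [this]; ring

lemma lap_comm (i : Fin n) (f : A) : b.D i (b.lap f) = b.lap (b.D i f) := by
  unfold lap; rw [map_sum]
  exact sum_congr rfl fun k _ => by rw [b.comm i k, b.comm i k]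

lemma lap_S (i k : Fin n) : b.lap (b.S V i k) = b.D i (b.lap (V k)) + b.D k (b.lap (V i))
    - if i = k then 2 * b.ν * b.lap (b.th V) else 0 := by
  rw [lap_comm, lap_comm]
  unfold lap
  simp only [D_S, map_add, map_sub, sum_add_distrib, sum_sub_distrib]
  congr 1
  split_ifs <;> simp [D_mul, b.Dν, b.D2, mul_sum]

lemma pd1_S (i k : Fin n) : b.pd1 (b.S V i k) = b.pd1 (b.D i (V k)) + b.pd1 (b.D k (V i))
    - if i = k then 2 * b.ν * b.pd1 (b.th V) else 0 := by
  unfold pd1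
  simp only [D_S, mul_add, mul_sub, sum_add_distrib, sum_sub_distrib]
  congr 1
  split_ifs
  · rw [mul_sum]; exact sum_congr rfl fun k _ => by ring
  · simp

lemma p_D_S (i k : Fin n) : ∑ l, b.p l * b.D k (b.S V i l) =
    ∑ l, b.p l * b.D i (b.D k (V l)) + b.pd1 (b.D k (V i)) - 2 * b.ν * b.p i * b.D k (b.th V) := by
  unfold pd1
  simp only [D_S, mul_add, mul_sub, sum_add_distrib, sum_sub_distrib]
  simp only [mul_ite, mul_zero, sum_ite_eq, mem_univ, if_true]
  congr 1
  · congr 1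
    · exact sum_congr rfl fun l _ => by rw [b.comm]
    · exact sum_congr rfl fun l _ => by rw [b.comm k l]
  · ring

def K (i k : Fin n) : A := - b.lap (b.S V i k) + 2 * b.N * b.pd1 (b.S V i k)
  + 2 * b.D k (b.div (b.S V) i)
  - 4 * b.N * (∑ l, b.p l * b.D k (b.S V i l) + b.κ * b.s * b.S V i k + b.D i (b.D k (b.ph V))
    + 2 * b.p i * b.D k (b.ph V))

lemma K_symm (i k : Fin n) : b.K V i k + b.K V k i = if i = k then
    4 * b.ν * b.lap (b.th V) - 8 * b.N * b.ν * b.pd1 (b.th V) + 16 * b.N * b.ν * b.κ * b.s * b.th V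
      - 8 * b.N * b.κ * b.s * b.pV V else 0 := by
  have hs : ∑ l, b.p l * b.D k (b.D i (V l)) = ∑ l, b.p l * b.D i (b.D k (V l)) :=
    sum_congr rfl fun l _ => by rw [b.comm]
  have h1 := b.hν
  rw [b.hN] at h1
  have e1 : b.D k (1 - 2 * b.ν) = 0 := by simp [D_mul, b.Dν, b.D2]
  have e2 : b.D i (1 - 2 * b.ν) = 0 := by simp [D_mul, b.Dν, b.D2]
  have hc := b.comm k i (b.th V)
  unfold K
  rw [b.S_symm V k i]
  simp only [D_D_ph]
  simp only [lap_S, pd1_S, p_D_S, div_S, hs, map_add, D_mul, e1, e2, D_ph, hc]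
  unfold S
  by_cases h : i = k
  · subst h
    simp only [if_true]
    linear_combination (-4 * b.D i (b.D i (b.th V)) ) * h1
  · simp only [h, Ne.symm h, if_false]
    linear_combination (-4 * b.D i (b.D k (b.th V)) ) * h1


/-- first flux -/
def X1 (G : Fin n → Fin n → A) (l : Fin n) : A :=
  b.U * (∑ i, ∑ k, G i k * b.D l (b.S V i k)) - 2 * b.U * (∑ i, b.div (b.S V) i * G i l)
   + 4 * b.N * b.U * (∑ i, b.dot (b.S V) i * G i l) - 4 * b.N * b.U * b.ph V * b.div G l
   + 4 * b.N * ∑ k, b.D k (b.U * b.ph V) * G l k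

lemma I1 (G : Fin n → Fin n → A) (hG : ∀ i k, G i k = G k i) (hT : ∑ i, G i i = 0) :
    2 * (b.U * ((∑ i, ∑ k, ∑ l, b.D l (b.S V i k) * b.D l (G i k))
      - 2 * ∑ i, b.div (b.S V) i * b.div G i
      + 4 * b.N * (∑ i, (b.dot (b.S V) i * b.div G i + b.dot G i * b.div (b.S V) i))
      - 4 * (2 * b.N + 1) * b.N * (∑ i, b.dot (b.S V) i * b.dot G i)
      - 4 * b.N * b.ph V * (∑ i, b.D i (b.div G i))
      - 8 * (2 * b.N + 1) * b.N * (∑ i, ∑ k, b.p i * (b.D k (b.ph V) - b.N * b.p k * b.ph V) * G i k)))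
    = 2 * ∑ l, b.D l (b.X1 V G l) := by
  have hK : ∑ i, ∑ k, G i k * (b.K V i k + b.K V k i) = 0 := by
    simp only [K_symm, mul_ite, mul_zero, sum_ite_eq, mem_univ, if_true,
      ← sum_mul, hT, zero_mul]
  have hK2 : 2 * ∑ i, ∑ k, G i k * b.K V i k = 0 := by
    rw [← hK]
    simp only [mul_add, sum_add_distrib]
    rw [two_mul]; congr 1
    rw [sum_comm]
    exact sum_congr rfl fun i _ => sum_congr rfl fun k _ => by rw [hG]
  -- pieces of the divergence of the flux
  have c1 : ∑ l, b.D l (b.U * (∑ i, ∑ k, G i k * b.D l (b.S V i k))) =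
      ∑ i, ∑ k, (b.U * (∑ l, b.D l (b.S V i k) * b.D l (G i k))
        + b.U * G i k * (b.lap (b.S V i k) - 2 * b.N * b.pd1 (b.S V i k))) := by
    simp only [mul_sum, map_sum, lap, pd1, ← sum_sub_distrib,
      ← sum_add_distrib]
    rw [sum_comm]
    refine sum_congr rfl fun i _ => ?_
    rw [sum_comm]
    refine sum_congr rfl fun k _ => sum_congr rfl fun l _ => ?_
    simp only [D_mul, b.DU]; ring
  have c2 : ∑ l, b.D l (2 * b.U * (∑ i, b.div (b.S V) i * G i l)) =
      ∑ i, ∑ k, (2 * b.U * b.div (b.S V) i * b.D k (G i k) + 2 * b.U * G i k *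
        (b.D k (b.div (b.S V) i) - 2 * b.N * b.p k * b.div (b.S V) i)) := by
    simp only [mul_sum, map_sum]
    rw [sum_comm]
    refine sum_congr rfl fun i _ => sum_congr rfl fun k _ => ?_
    simp only [D_mul, b.DU, b.D2]; ring
  have D4 : ∀ i, b.D i 4 = 0 := fun i => by have := (b.D i).map_natCast 4; simpa using this
  have c3 : ∑ l, b.D l (4 * b.N * b.U * (∑ i, b.dot (b.S V) i * G i l)) =
      ∑ i, ∑ k, (4 * b.N * b.U * b.dot (b.S V) i * b.D k (G i k) + 4 * b.N * b.U * G i k *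
        (∑ l, b.p l * b.D k (b.S V i l) + b.κ * b.s * b.S V i k - b.p k * b.dot (b.S V) i
          - 2 * b.N * b.p k * b.dot (b.S V) i)) := by
    simp only [mul_sum, map_sum]
    rw [sum_comm]
    refine sum_congr rfl fun i _ => sum_congr rfl fun k _ => ?_
    have : b.D k (b.dot (b.S V) i) = ∑ l, b.p l * b.D k (b.S V i l) + b.κ * b.s * b.S V i k
        - b.p k * b.dot (b.S V) i := by
      unfold dot
      simp only [map_sum, D_mul, b.Dp, sum_add_distrib, mul_sub, sum_sub_distrib,
        mul_sum]
      simp only [mul_ite, mul_zero, sum_ite_eq', mem_univ, if_true]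
      have : ∑ l, b.S V i l * (b.p l * b.p k) = ∑ l, b.p k * (b.p l * b.S V i l) :=
        sum_congr rfl fun i _ => by ring
      rw [this]; ring
    simp only [D_mul, b.DU, D4, b.DN, this]; ring
  have c4 : ∑ l, b.D l (4 * b.N * b.U * b.ph V * b.div G l) = 4 * b.N * b.U * b.ph V *
      (∑ i, b.D i (b.div G i)) + ∑ i, ∑ k, 4 * b.N * b.D i (b.U * b.ph V) * b.D k (G i k) := by
    have : ∀ i, ∑ k, 4 * b.N * b.D i (b.U * b.ph V) * b.D k (G i k) =
      4 * b.N * b.D i (b.U * b.ph V) * b.div G i := fun i => by rw [div, mul_sum]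
    simp only [this, mul_sum, ← sum_add_distrib]
    refine sum_congr rfl fun i _ => ?_
    simp only [D_mul, b.DU, D4, b.DN]; ring
  have c5 : ∑ l, b.D l (4 * b.N * ∑ k, b.D k (b.U * b.ph V) * G l k) =
      ∑ i, ∑ k, (4 * b.N * b.D i (b.U * b.ph V) * b.D k (G i k) + 4 * b.N * b.U * G i k *
        (b.D i (b.D k (b.ph V)) - 4 * b.N * b.p i * b.D k (b.ph V)
        + (4 * b.N ^ 2 + 2 * b.N) * b.p i * b.p k * b.ph V)
        - if i = k then 4 * b.N * b.U * G i k * (2 * b.N * b.κ * b.s * b.ph V) else 0) := by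
    have a1 : ∀ i k, b.D i (b.D k (b.U * b.ph V)) = b.U * (b.D i (b.D k (b.ph V))
        - 2 * b.N * b.p i * b.D k (b.ph V) - 2 * b.N * b.p k * b.D i (b.ph V) +
        4 * b.N ^ 2 * b.p i * b.p k * b.ph V + 2 * b.N * b.p i * b.p k * b.ph V)
        - if i = k then 2 * b.N * b.U * b.κ * b.s * b.ph V else 0 := by
      intro i k
      simp only [D_mul, b.DU, map_add, map_neg, b.DN, b.D2, b.Dp, eq_comm (a := k)]
      split_ifs <;> ring
    have a2 : ∀ q : Fin n → Fin n → A, ∑ i, ∑ k, (4 * b.N * b.U * G i k * (q i k))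
       = ∑ i, ∑ k, (4 * b.N * b.U * G i k * (q k i)) := by
      intro q
      rw [sum_comm]
      exact sum_congr rfl fun i _ => sum_congr rfl fun k _ => by rw [hG]
    have a3 := a2 fun i k => 2 * b.N * b.p i * b.D k (b.ph V)
    have a5 : ∑ i, ∑ k, b.D i (4 * b.N * (b.D k (b.U * b.ph V) * G i k)) =
      ∑ i, ∑ k, 4 * b.N * b.D i (b.U * b.ph V) * b.D k (G i k) +
       ∑ i, ∑ k, 4 * b.N * G i k * b.D i (b.D k (b.U * b.ph V)) := by
      have : ∑ i, ∑ k, 4 * b.N * b.D i (b.U * b.ph V) * b.D k (G i k) =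
        ∑ i, ∑ k, 4 * b.N * b.D k (b.U * b.ph V) * b.D i (G i k) := by
        rw [sum_comm]
        exact sum_congr rfl fun i _ => sum_congr rfl fun k _ => by rw [hG]
      rw [this]
      simp only [← sum_add_distrib]
      refine sum_congr rfl fun i _ => sum_congr rfl fun k _ => ?_
      simp only [D_mul, D4, b.DN]; ring
    simp only [mul_sum, map_sum]
    rw [a5]
    rw [← sub_eq_zero] at a3
    refine sub_eq_zero.mp (Eq.trans ?_ a3)
    simp only [← sum_add_distrib, ← sum_sub_distrib]
    refine sum_congr rfl fun i _ => sum_congr rfl fun k _ => ?_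
    rw [a1]
    split_ifs <;> ring
  have c6 : ∑ i, ∑ k, (if i = k then 4 * b.N * b.U * G i k * (2 * b.N * b.κ * b.s * b.ph V) else 0)
      = 0 := by
    simp only [sum_ite_eq, mem_univ, if_true, ← sum_mul, ← mul_sum, hT]
    ring
  have hX : ∑ l, b.D l (b.X1 V G l) = ∑ l, b.D l (b.U * (∑ i, ∑ k, G i k * b.D l (b.S V i k)))
      - ∑ l, b.D l (2 * b.U * (∑ i, b.div (b.S V) i * G i l))
      + ∑ l, b.D l (4 * b.N * b.U * (∑ i, b.dot (b.S V) i * G i l))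
      - ∑ l, b.D l (4 * b.N * b.U * b.ph V * b.div G l)
      + ∑ l, b.D l (4 * b.N * ∑ k, b.D k (b.U * b.ph V) * G l k) := by
    simp only [X1, map_add, map_sub, sum_add_distrib, sum_sub_distrib]
  rw [hX, c1, c2, c3, c4, c5]
  have e1 : ∑ i, b.div (b.S V) i * b.div G i = ∑ i, ∑ k, b.div (b.S V) i * b.D k (G i k) :=
    sum_congr rfl fun i _ => by rw [div.eq_1 b G, mul_sum]
  have e2 : ∑ i, (b.dot (b.S V) i * b.div G i + b.dot G i * b.div (b.S V) i) =
     ∑ i, ∑ k, (b.dot (b.S V) i * b.D k (G i k) + b.p k * G i k * b.div (b.S V) i) :=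
    sum_congr rfl fun i _ => by
      rw [div.eq_1 b G, dot.eq_1 b G, mul_sum, sum_mul, sum_add_distrib]
  have e3 : ∑ i, b.dot (b.S V) i * b.dot G i = ∑ i, ∑ k, b.dot (b.S V) i * (b.p k * G i k) :=
    sum_congr rfl fun i _ => by rw [dot.eq_1 b G, mul_sum]
  rw [e1, e2, e3]
  obtain ⟨W, hW⟩ : ∃ W : Fin n → Fin n → A, ∀ i k, ∑ l, b.D l (b.S V i k) * b.D l (G i k) = W i k :=
    ⟨_, fun _ _ => rfl⟩
  obtain ⟨W2, hW2⟩ : ∃ W : Fin n → Fin n → A, ∀ i k, ∑ l, b.p l * b.D k (b.S V i l) = W i k :=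
    ⟨_, fun _ _ => rfl⟩
  simp only [K, hW2] at hK2
  simp only [hW, hW2]
  generalize ∑ i, b.D i (b.div G i) = Z
  have hZ : ∀ P1 P2 P3 P4 P5 Q1 Q2 Q3 Q4 Q5 R c : A, 2 * R = 0 → c = 0 →
    b.U * P1 - 2 * b.U * P2 + 4 * b.N * b.U * P3 - 4 * (2 * b.N + 1) * b.N * b.U * P4
     - 8 * (2 * b.N + 1) * b.N * b.U * P5 - (Q1 - Q2 + Q3 - Q4 + Q5) - b.U * R - c = 0 →
    2 * (b.U * (P1 - 2 * P2 + 4 * b.N * P3 - 4 * (2 * b.N + 1) * b.N * P4 - 4 * b.N * b.ph V * Z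
      - 8 * (2 * b.N + 1) * b.N * P5)) = 2 * (Q1 - Q2 + Q3 - (4 * b.N * b.U * b.ph V * Z + Q4) + Q5)
      := by
    intro P1 P2 P3 P4 P5 Q1 Q2 Q3 Q4 Q5 R c h1 h2 h3
    linear_combination 2 * h3 + b.U * h1 + 2 * h2
  refine hZ _ _ _ _ _ _ _ _ _ _ _ _ hK2 c6 ?_
  simp only [mul_sum, ← sum_sub_distrib, ← sum_add_distrib]
  refine sum_eq_zero fun i _ => sum_eq_zero fun k _ => ?_
  split_ifs <;> ring

end Bg

namespace Bg
variable {n : ℕ} {A : Type*} [CommRing A] [Algebra ℝ A] (b : Bg n A) (V : Fin n → A)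

lemma sum_Dp (i : Fin n) : ∑ k, b.D k (b.D k (b.p i)) =
    b.p i * (- (b.κ * b.s * (n + 2)) + 2 * ∑ k, b.p k * b.p k) := by
  have : ∀ k, b.D k (b.D k (b.p i)) = (if i = k then - 2 * b.κ * b.s * b.p k else 0)
      - b.κ * b.s * b.p i + 2 * b.p i * (b.p k * b.p k) := by
    intro k
    simp only [b.Dp, map_sub, D_mul, if_true]
    split_ifs with h
    · subst h; simp only [D_mul, b.Ds, b.Dκ]; ring
    · simp only [map_zero]; ring
  simp only [this, sum_add_distrib, sum_sub_distrib, sum_ite_eq,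
    mem_univ, if_true, ← mul_sum, Finset.sum_const, Finset.card_univ, Fintype.card_fin,
    nsmul_eq_mul]
  ring

lemma lap_pV : b.lap (b.pV V) = b.pV V * (- (b.κ * b.s * (n + 2)) + 2 * ∑ k, b.p k * b.p k)
    + 2 * b.κ * b.s * b.th V - 2 * (∑ k, b.p k * b.g V k) + ∑ i, b.p i * b.lap (V i) := by
  have h1 : ∀ l k, b.D l (b.D l (b.p k * V k)) = (b.D l (b.D l (b.p k))) * V k +
      ((if k = l then 2 * b.κ * b.s * b.D k (V k) else 0) - 2 * (b.p l * (b.p k * b.D l (V k))))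
      + b.p k * b.D l (b.D l (V k)) := by
    intro l k
    have : b.D l (b.D l (b.p k * V k)) = (b.D l (b.D l (b.p k))) * V k +
      2 * b.D l (b.p k) * b.D l (V k) + b.p k * b.D l (b.D l (V k)) := by
      simp only [D_mul, map_add]; ring
    rw [this, b.Dp]
    split_ifs with h
    · subst h; ring
    · ring
  unfold lap pV
  simp only [map_sum, h1, sum_add_distrib, sum_sub_distrib, sum_ite_eq',
    mem_univ, if_true, ← mul_sum]
  have h2 : ∑ l, ∑ k, (b.D l (b.D l (b.p k))) * V k = (∑ k, b.p k * V k) *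
      (- (b.κ * b.s * (n + 2)) + 2 * ∑ k, b.p k * b.p k) := by
    rw [sum_comm, sum_mul]
    refine sum_congr rfl fun k _ => ?_
    rw [← sum_mul, sum_Dp]; ring
  have h3 : ∑ l, ∑ k, b.p k * b.D l (b.D l (V k)) = ∑ i, b.p i * ∑ l, b.D l (b.D l (V i)) := by
    rw [sum_comm]; simp only [mul_sum]
  rw [h2, h3]
  unfold th g
  ring

lemma tr_S : ∑ i, b.S V i i = 0 := by
  simp only [S, if_true, sum_sub_distrib, sum_add_distrib, Finset.sum_const,
    Finset.card_univ, Fintype.card_fin, nsmul_eq_mul]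
  have h := b.hν
  change b.th V + b.th V - _ = 0
  linear_combination (-2 * b.th V) * h

def Spp : A := ∑ i, b.p i * b.dot (b.S V) i

lemma Spp_eq : b.Spp V = 2 * (∑ k, b.p k * b.g V k) - 2 * b.ν * b.th V * ∑ k, b.p k * b.p k := by
  unfold Spp dot S g
  simp only [mul_add, mul_sub, mul_ite, mul_zero, sum_sub_distrib, sum_add_distrib,
    sum_ite_eq, mem_univ, if_true, mul_sum]
  have h1 : ∑ i, ∑ k, b.p i * (b.p k * b.D k (V i)) = ∑ i, ∑ k, b.p i * (b.p k * b.D i (V k)) := by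
    rw [sum_comm]
    exact sum_congr rfl fun i _ => sum_congr rfl fun k _ => by ring
  rw [h1]
  have h2 : ∀ x y z w : A, 2 * x = y → z = w → x + x - z = y - w := by
    intro x y z w h1 h2; linear_combination h1 - h2
  apply h2
  · simp only [mul_sum]
  · exact sum_congr rfl fun i _ => by ring

lemma pde : b.lap (b.ph V) - 2 * b.N * b.pd1 (b.ph V) + 4 * n * b.s ^ 2 * b.ph V =
    b.ν * b.lap (b.th V) + (b.N + 1) * b.Spp V - ∑ i, b.p i * b.div (b.S V) i := by
  have h1 : b.lap (b.ph V) = b.ν * b.lap (b.th V) - b.lap (b.pV V) := by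
    unfold ph lap
    simp only [map_sub, D_mul, b.Dν, sum_sub_distrib, mul_sum, mul_zero, add_zero]
  have h2 : b.pd1 (b.ph V) = b.ν * b.pd1 (b.th V) - (b.κ * b.s * b.pV V
      - (∑ k, b.p k * b.p k) * b.pV V + ∑ k, b.p k * b.g V k) := by
    unfold pd1
    simp only [D_ph, mul_add, mul_sub, sum_sub_distrib, sum_add_distrib,
      mul_sum, sum_mul]
    congr 1
    · exact sum_congr rfl fun i _ => by ring
    · congr 1; congr 1
      · rw [pV, mul_sum]; exact sum_congr rfl fun i _ => by ring
      · exact sum_congr rfl fun i _ => by ring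
  have h3 : ∑ i, b.p i * b.div (b.S V) i = ∑ i, b.p i * b.lap (V i) + (1 - 2 * b.ν) * b.pd1 (b.th V)
      := by
    unfold pd1
    simp only [div_S, mul_add, sum_add_distrib, mul_sum]
    congr 1
    exact sum_congr rfl fun i _ => by ring
  have hν := b.hν
  have hN := b.hN
  rw [h1, h2, h3, lap_pV, Spp_eq, b.pp]
  unfold ph
  rw [hN] at hν
  rw [hN]
  generalize ∑ k, b.p k * b.g V k = q
  generalize ∑ i, b.p i * b.lap (V i) = r
  linear_combination (4 * b.s^2 * b.th V - b.pd1 (b.th V) + (2 * b.κ * b.s - 4 * b.s ^ 2) * b.th V) * hν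

def X2 (k : Fin n) : A := - 2 * (2 * b.N + 1) * b.N * b.U * b.ph V *
  (b.dot (b.S V) k + b.D k (b.ph V) - b.N * b.p k * b.ph V)

lemma I2 : b.U * (- b.N * b.ph V * (∑ i, b.D i (b.div (b.S V) i))
     - 2 * (2 * b.N + 1) * b.N * (∑ i, ∑ k, b.p i * (b.D k (b.ph V) - b.N * b.p k * b.ph V) * b.S V i k)
     - 2 * (2 * b.N + 1) * b.N * (∑ k, (b.D k (b.ph V) - b.N * b.p k * b.ph V) ^ 2)
     + 2 * (2 * b.N + 1) * b.N * n * (n + 2) * b.s ^ 2 * b.ph V ^ 2)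
    = ∑ k, b.D k (b.X2 V k) := by
  have hν := b.hν
  have hN := b.hN
  have hd : ∑ i, b.D i (b.div (b.S V) i) = (2 - 2 * b.ν) * b.lap (b.th V) := by
    have e1 : ∀ k, b.D k (1 - 2 * b.ν) = 0 := fun k => by simp [D_mul, b.Dν, b.D2]
    simp only [div_S, map_add, D_mul, e1, sum_add_distrib, lap_comm]
    have : ∑ i, b.lap (b.D i (V i)) = b.lap (b.th V) := by
      unfold th lap; simp only [map_sum]; rw [sum_comm]
    rw [this]
    simp only [mul_zero, add_zero, ← mul_sum, sum_const_zero]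
    unfold lap; ring
  have hJ1 : ∑ k, b.D k (b.dot (b.S V) k) = (∑ i, b.p i * b.div (b.S V) i) - b.Spp V := by
    have : ∀ k, b.D k (b.dot (b.S V) k) = b.κ * b.s * b.S V k k - b.p k * b.dot (b.S V) k
        + ∑ l, b.p l * b.D k (b.S V k l) := by
      intro k
      unfold dot
      simp only [map_sum, D_mul, b.Dp, sum_add_distrib, mul_sub, sum_sub_distrib,
        mul_sum]
      simp only [mul_ite, mul_zero, sum_ite_eq', mem_univ, if_true]
      have : ∑ l, b.S V k l * (b.p l * b.p k) = ∑ l, b.p k * (b.p l * b.S V k l) :=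
        sum_congr rfl fun i _ => by ring
      rw [this]; ring
    simp only [this, sum_add_distrib, sum_sub_distrib, ← mul_sum, tr_S]
    rw [sum_comm (f := fun k l => b.p l * b.D k (b.S V k l))]
    have : ∀ i, ∑ k, b.p i * b.D k (b.S V k i) = b.p i * b.div (b.S V) i := by
      intro i; rw [div, mul_sum]
      exact sum_congr rfl fun k _ => by rw [S_symm]
    simp only [this, Spp]; ring
  have hJ2 : ∑ k, b.D k (b.N * b.p k * b.ph V) = b.N * (n * b.κ * b.s - ∑ k, b.p k * b.p k) * b.ph V
      + b.N * b.pd1 (b.ph V) := by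
    have : ∀ k, b.D k (b.N * b.p k * b.ph V) = b.N * b.κ * b.s * b.ph V
        - b.N * b.ph V * (b.p k * b.p k) + b.N * (b.p k * b.D k (b.ph V)) := by
      intro k; simp only [D_mul, b.DN, b.Dp, if_true]; ring
    simp only [this, sum_add_distrib, sum_sub_distrib, ← mul_sum, pd1,
      Finset.sum_const, Finset.card_univ, Fintype.card_fin, nsmul_eq_mul]
    ring
  have hD : ∀ k, b.D k (b.X2 V k) = - 2 * (2 * b.N + 1) * b.N * b.U * (
      (b.D k (b.ph V) - 2 * b.N * b.p k * b.ph V) *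
        (b.dot (b.S V) k + b.D k (b.ph V) - b.N * b.p k * b.ph V)
      + b.ph V * (b.D k (b.dot (b.S V) k) + b.D k (b.D k (b.ph V)) - b.D k (b.N * b.p k * b.ph V))) := by
    intro k
    unfold X2
    have c : b.D k (-2 * (2 * b.N + 1) * b.N) = 0 := by
      simp only [D_mul, b.DN, map_add, b.D2, map_neg, Derivation.map_one_eq_zero]; ring
    rw [D_mul, D_mul, D_mul, c, b.DU]
    simp only [map_add, map_sub]; ring
  have hE : ∑ k, b.D k (b.X2 V k) = - 2 * (2 * b.N + 1) * b.N * b.U * (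
      (∑ k, (b.D k (b.ph V) - 2 * b.N * b.p k * b.ph V) *
        (b.dot (b.S V) k + b.D k (b.ph V) - b.N * b.p k * b.ph V))
      + b.ph V * (∑ k, b.D k (b.dot (b.S V) k) + b.lap (b.ph V)
        - ∑ k, b.D k (b.N * b.p k * b.ph V))) := by
    simp only [hD, ← mul_sum, sum_add_distrib, sum_sub_distrib, lap]
  have hF : ∑ i, ∑ k, b.p i * (b.D k (b.ph V) - b.N * b.p k * b.ph V) * b.S V i k =
     ∑ k, (b.D k (b.ph V) - b.N * b.p k * b.ph V) * b.dot (b.S V) k := by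
    rw [sum_comm]
    refine sum_congr rfl fun k _ => ?_
    rw [dot, mul_sum]
    exact sum_congr rfl fun i _ => by rw [S_symm]; ring
  have hG : (∑ k, (b.D k (b.ph V) - 2 * b.N * b.p k * b.ph V) *
        (b.dot (b.S V) k + b.D k (b.ph V) - b.N * b.p k * b.ph V)) =
      ∑ k, (b.D k (b.ph V) - b.N * b.p k * b.ph V) * b.dot (b.S V) k
      + (∑ k, (b.D k (b.ph V) - b.N * b.p k * b.ph V) ^ 2)
      - b.N * b.ph V * b.Spp V - b.N * b.ph V * b.pd1 (b.ph V)
      + b.N ^ 2 * b.ph V ^ 2 * ∑ k, b.p k * b.p k := by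
    unfold Spp pd1
    simp only [mul_sum, ← sum_sub_distrib, ← sum_add_distrib]
    exact sum_congr rfl fun i _ => by ring
  have hp := b.pde V
  rw [hE, hJ1, hJ2, hd, hF, hG, b.pp]
  rw [hN] at hν hp
  rw [hN]
  generalize ∑ k, (b.D k (b.ph V) - b.N * b.p k * b.ph V) * b.dot (b.S V) k = q
  generalize ∑ k, (b.D k (b.ph V) - b.N * b.p k * b.ph V) ^ 2 = r
  generalize ∑ i, b.p i * b.div (b.S V) i = t at *
  linear_combination (2 * (2 * b.N + 1) * b.N * b.U * b.ph V) * hp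
    + (2 * b.N * b.U * b.ph V * b.lap (b.th V)) * hν

end Bg

namespace Bg
variable {n : ℕ} {A : Type*} [CommRing A] [Algebra ℝ A] (b : Bg n A) (V : Fin n → A)

def Qt (T : Fin n → Fin n → A) (i k l : Fin n) : A :=
  b.D l (T i k) + b.p i * T k l + b.p k * T i l - (if k = l then b.dot T i else 0)
    - (if i = l then b.dot T k else 0)

def X3 (T : Fin n → Fin n → A) (l : Fin n) : A := b.U * ∑ i, ∑ k, b.p i * T k l * T i k

lemma sum_Qt (T : Fin n → Fin n → A) (hT : ∀ i k, T i k = T k i) (h0 : ∑ i, T i i = 0) :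
    ∑ i, ∑ k, ∑ l, (b.Qt T i k l) ^ 2 = (∑ i, ∑ k, ∑ l, b.D l (T i k) * b.D l (T i k))
      + 4 * (∑ i, ∑ k, ∑ l, b.p i * T k l * b.D l (T i k))
      - 4 * (∑ i, b.dot T i * b.div T i)
      + 2 * (∑ i, b.p i * b.p i) * (∑ i, ∑ k, T i k * T i k)
      + 2 * n * ∑ i, b.dot T i * b.dot T i := by
  have e : ∀ i k l, (b.Qt T i k l) ^ 2 = b.D l (T i k) * b.D l (T i k)
     + 2 * (b.p i * T k l * b.D l (T i k)) + 2 * (b.p k * T i l * b.D l (T i k))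
     + (b.p i * b.p i) * (T k l * T k l) + (b.p k * b.p k) * (T i l * T i l)
     + 2 * (b.p i * T l i * (b.p k * T l k))
     + (if k = l then b.dot T i * b.dot T i - 2 * (b.dot T i * b.D l (T i k)) - 2 * (b.p i * b.dot T i * T k l)
        - 2 * (b.p k * T i l * b.dot T i)  else 0)
     + (if i = l then b.dot T k * b.dot T k - 2 * (b.dot T k * b.D l (T i k)) - 2 * (b.p k * b.dot T k * T i l)
        - 2 * (b.p i * T k l * b.dot T k) + (if k = l then 2 * (b.dot T i * b.dot T k) else 0) else 0) := by
    intro i k l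
    unfold Qt
    rw [hT l i, hT l k]
    split_ifs <;> ring
  have d1 : ∀ i, ∑ k, b.D k (T i k) = b.div T i := fun i => rfl
  have d1' : ∀ i, ∑ k, b.D k (T k i) = b.div T i := fun i => by
    rw [div]; exact sum_congr rfl fun k _ => by rw [hT]
  have d2 : ∀ i, ∑ k, b.p k * T i k = b.dot T i := fun i => rfl
  have d2' : ∀ i, ∑ k, b.p k * T k i = b.dot T i := fun i => by
    rw [dot]; exact sum_congr rfl fun k _ => by rw [hT]
  simp only [e, sum_add_distrib]
  have f1 : ∑ i, ∑ k, ∑ l, 2 * (b.p k * T i l * b.D l (T i k)) =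
      2 * ∑ i, ∑ k, ∑ l, b.p i * T k l * b.D l (T i k) := by
    simp only [mul_sum]
    rw [sum_comm]
    exact sum_congr rfl fun i _ => sum_congr rfl fun k _ =>
      sum_congr rfl fun l _ => by rw [hT i k]
  have f2 : ∑ i, ∑ k, ∑ l, (b.p i * b.p i) * (T k l * T k l) =
      (∑ i, b.p i * b.p i) * (∑ i, ∑ k, T i k * T i k) := by
    simp only [mul_sum, sum_mul]
    rw [sum_comm]; refine sum_congr rfl fun k _ => ?_
    rw [sum_comm]
  have f3 : ∑ i, ∑ k, ∑ l, (b.p k * b.p k) * (T i l * T i l) =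
      (∑ i, b.p i * b.p i) * (∑ i, ∑ k, T i k * T i k) := by
    rw [← f2, sum_comm]
  have f4 : ∑ i, ∑ k, ∑ l, 2 * (b.p i * T l i * (b.p k * T l k)) = 2 * ∑ i, b.dot T i * b.dot T i := by
    have : ∀ i, ∑ k, ∑ l, 2 * (b.p i * T l i * (b.p k * T l k)) =
       ∑ l, 2 * (b.p i * T l i * b.dot T l) := by
      intro i; rw [sum_comm]
      refine sum_congr rfl fun l _ => ?_
      rw [← mul_sum, ← mul_sum, d2]
    simp only [this]
    rw [sum_comm, mul_sum]
    refine sum_congr rfl fun l _ => ?_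
    rw [← mul_sum, ← sum_mul, d2]
  rw [f1, f2, f3, f4]
  have f5 : ∑ i, ∑ k, ∑ l, (if k = l then b.dot T i * b.dot T i - 2 * (b.dot T i * b.D l (T i k)) - 2 * (b.p i * b.dot T i * T k l)
        - 2 * (b.p k * T i l * b.dot T i)  else 0) =
      (n - 2) * (∑ i, b.dot T i * b.dot T i) - 2 * ∑ i, b.dot T i * b.div T i := by
    simp only [sum_ite_eq, mem_univ, if_true, sum_sub_distrib, ← mul_sum,
      h0, d1, d2, ← sum_mul, Finset.sum_const, Finset.card_univ, Fintype.card_fin, nsmul_eq_mul]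
    simp only [mul_zero, sub_zero, mul_sum, ← sum_sub_distrib, ← sum_add_distrib]
    exact sum_congr rfl fun i _ => by ring
  have f6 : ∑ i, ∑ k, ∑ l, (if i = l then b.dot T k * b.dot T k - 2 * (b.dot T k * b.D l (T i k)) - 2 * (b.p k * b.dot T k * T i l)
        - 2 * (b.p i * T k l * b.dot T k) + (if k = l then 2 * (b.dot T i * b.dot T k) else 0) else 0) =
      n * (∑ i, b.dot T i * b.dot T i) - 2 * ∑ i, b.dot T i * b.div T i := by
    rw [sum_comm]
    simp only [sum_ite_eq, mem_univ, if_true, sum_sub_distrib, sum_add_distrib,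
      ← mul_sum,
      h0, d1', d2, ← sum_mul, Finset.sum_const, Finset.card_univ, Fintype.card_fin, nsmul_eq_mul]
    simp only [mul_zero, sub_zero, mul_sum, ← sum_sub_distrib, ← sum_add_distrib]
    exact sum_congr rfl fun i _ => by ring
  rw [f5, f6]
  simp only [← mul_sum]
  ring

lemma sum_X3 (T : Fin n → Fin n → A) (hT : ∀ i k, T i k = T k i) :
    ∑ l, b.D l (b.X3 T l) = b.U * ((∑ i, ∑ k, ∑ l, b.p i * T k l * b.D l (T i k))
      - (2 * b.N + 1) * (∑ i, b.dot T i * b.dot T i) + b.κ * b.s * (∑ i, ∑ k, T i k * T i k)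
      + ∑ i, b.dot T i * b.div T i) := by
  have e : ∀ i k l, b.D l (b.U * (b.p i * T k l * T i k)) = b.U * (b.p i * T k l * b.D l (T i k))
    - (2 * b.N + 1) * b.U * ((b.p i * T k i) * (b.p l * T k l))
    + (if i = l then b.κ * b.s * b.U * (T i k * T i k) else 0)
    + b.U * ((b.p i * T k i) * b.D l (T k l)) := by
    intro i k l
    rw [hT k i, D_mul, D_mul, D_mul, b.DU, b.Dp]
    split_ifs with h
    · subst h; rw [hT k i]; ring
    · ring
  unfold X3
  simp only [mul_sum, map_sum]
  rw [sum_comm]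
  simp only [sum_comm (s := (Finset.univ : Finset (Fin n))) (f := fun l k => b.D l (b.U * (b.p _ * T k l * T _ k)))]
  have g1 : ∑ i, ∑ k, ∑ l, (2 * b.N + 1) * b.U * ((b.p i * T k i) * (b.p l * T k l)) =
      (2 * b.N + 1) * b.U * ∑ i, b.dot T i * b.dot T i := by
    rw [sum_comm]
    simp only [← mul_sum, ← sum_mul]
    rfl
  have g2 : ∑ i, ∑ k, ∑ l, b.U * ((b.p i * T k i) * b.D l (T k l)) =
      b.U * ∑ i, b.dot T i * b.div T i := by
    rw [sum_comm]
    simp only [← mul_sum, ← sum_mul]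
    rfl
  have g3 : ∀ i, ∑ l, ∑ k, b.D l (b.U * (b.p i * T k l * T i k)) =
     ∑ k, ∑ l, b.D l (b.U * (b.p i * T k l * T i k)) := fun i => sum_comm
  simp only [g3, e, sum_add_distrib, sum_sub_distrib, g1, g2]
  simp only [sum_ite_eq, mem_univ, if_true, ← mul_sum]
  ring

lemma I3 (T : Fin n → Fin n → A) (hT : ∀ i k, T i k = T k i) (h0 : ∑ i, T i i = 0) :
    b.U * ((∑ i, ∑ k, ∑ l, b.D l (T i k) * b.D l (T i k)) - 2 * (∑ i, b.div T i * b.div T i)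
      + 8 * b.N * (∑ i, b.dot T i * b.div T i) - 4 * (2 * b.N + 1) * b.N * (∑ i, b.dot T i * b.dot T i))
    = b.U * (∑ i, ∑ k, ∑ l, (b.Qt T i k l) ^ 2) + 8 * b.U * b.s ^ 2 * (∑ i, ∑ k, T i k * T i k)
      - 2 * b.U * (∑ i, (b.div T i - n * b.dot T i) ^ 2) - 4 * ∑ l, b.D l (b.X3 T l) := by
  rw [b.sum_Qt T hT h0, b.sum_X3 T hT, b.pp]
  have : ∑ i, (b.div T i - n * b.dot T i) ^ 2 = (∑ i, b.div T i * b.div T i)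
      - 2 * n * (∑ i, b.dot T i * b.div T i) + n ^ 2 * ∑ i, b.dot T i * b.dot T i := by
    simp only [mul_sum, ← sum_sub_distrib, ← sum_add_distrib]
    exact sum_congr rfl fun i _ => by ring
  rw [this, b.hN]
  ring

def Xi (H : Fin n → Fin n → A) (l : Fin n) : A :=
  b.X1 V (fun i k => 2 * H i k - b.S V i k) l + 4 * b.X2 V l - 4 * b.X3 (fun i k => H i k - b.S V i k) l

def E4 (H : Fin n → Fin n → A) : A := b.U * ((∑ i, ∑ k, ∑ l, b.D l (H i k) * b.D l (H i k))
   - 2 * (∑ i, b.div H i * b.div H i) + 8 * b.N * (∑ i, b.dot H i * b.div H i)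
   - 4 * (2 * b.N + 1) * b.N * (∑ i, b.dot H i * b.dot H i)
   - 8 * b.N * b.ph V * (∑ i, b.D i (b.div H i))
   - 16 * (2 * b.N + 1) * b.N * (∑ i, ∑ k, b.p i * (b.D k (b.ph V) - b.N * b.p k * b.ph V) * H i k)
   - 8 * (2 * b.N + 1) * b.N * (∑ k, (b.D k (b.ph V) - b.N * b.p k * b.ph V) ^ 2)
   + 8 * (2 * b.N + 1) * b.N * n * (n + 2) * b.s ^ 2 * b.ph V ^ 2)

lemma D_of4 (i : Fin n) : b.D i 4 = 0 := by have := (b.D i).map_natCast 4; simpa using this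

theorem total (H : Fin n → Fin n → A) (hH : ∀ i k, H i k = H k i) (h0 : ∑ i, H i i = 0) :
    2 * b.E4 V H = 2 * (b.U * (∑ i, ∑ k, ∑ l, (b.Qt (fun i k => H i k - b.S V i k) i k l) ^ 2)
      + 8 * b.U * b.s ^ 2 * (∑ i, ∑ k, (H i k - b.S V i k) * (H i k - b.S V i k))
      - 2 * b.U * (∑ i, (b.div (fun i k => H i k - b.S V i k) i - n * b.dot (fun i k => H i k - b.S V i k) i) ^ 2)
      + ∑ l, b.D l (b.Xi V H l)) := by
  have hS := b.tr_S V
  have i3 := b.I3 (fun i k => H i k - b.S V i k) (fun i k => by rw [hH i k, b.S_symm V i k])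
    (by rw [sum_sub_distrib, hS, h0, sub_zero])
  have i1 := b.I1 V (fun i k => 2 * H i k - b.S V i k) (fun i k => by rw [hH i k, b.S_symm V i k])
    (by rw [sum_sub_distrib, hS, ← mul_sum, h0]; ring)
  have i2 := b.I2 V
  have v1 : ∀ i, b.div (fun i k => H i k - b.S V i k) i = b.div H i - b.div (b.S V) i := by
    intro i; simp only [div, map_sub, sum_sub_distrib]
  have v2 : ∀ i, b.div (fun i k => 2 * H i k - b.S V i k) i = 2 * b.div H i - b.div (b.S V) i := by
    intro i; simp only [div, map_sub, D_mul, b.D2, sum_sub_distrib, mul_sum, mul_zero, add_zero]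
  have v3 : ∀ i, b.dot (fun i k => H i k - b.S V i k) i = b.dot H i - b.dot (b.S V) i := by
    intro i; simp only [dot, mul_sub, sum_sub_distrib]
  have v4 : ∀ i, b.dot (fun i k => 2 * H i k - b.S V i k) i = 2 * b.dot H i - b.dot (b.S V) i := by
    intro i; simp only [dot, mul_sub, sum_sub_distrib, mul_sum]
    congr 1; exact sum_congr rfl fun k _ => by ring
  have hX : ∑ l, b.D l (b.Xi V H l) = (∑ l, b.D l (b.X1 V (fun i k => 2 * H i k - b.S V i k) l))
     + 4 * (∑ l, b.D l (b.X2 V l)) - 4 * ∑ l, b.D l (b.X3 (fun i k => H i k - b.S V i k) l) := by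
    simp only [Xi, map_add, map_sub, D_mul, D_of4, mul_zero, add_zero, sum_add_distrib,
      sum_sub_distrib, mul_sum]
  rw [hX]
  have key : b.E4 V H = b.U * ((∑ i, ∑ k, ∑ l, b.D l (H i k - b.S V i k) * b.D l (H i k - b.S V i k))
      - 2 * (∑ i, b.div (fun i k => H i k - b.S V i k) i * b.div (fun i k => H i k - b.S V i k) i)
      + 8 * b.N * (∑ i, b.dot (fun i k => H i k - b.S V i k) i * b.div (fun i k => H i k - b.S V i k) i)
      - 4 * (2 * b.N + 1) * b.N * (∑ i, b.dot (fun i k => H i k - b.S V i k) i * b.dot (fun i k => H i k - b.S V i k) i))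
    + (b.U * ((∑ i, ∑ k, ∑ l, b.D l (b.S V i k) * b.D l (2 * H i k - b.S V i k))
      - 2 * ∑ i, b.div (b.S V) i * b.div (fun i k => 2 * H i k - b.S V i k) i
      + 4 * b.N * (∑ i, (b.dot (b.S V) i * b.div (fun i k => 2 * H i k - b.S V i k) i
         + b.dot (fun i k => 2 * H i k - b.S V i k) i * b.div (b.S V) i))
      - 4 * (2 * b.N + 1) * b.N * (∑ i, b.dot (b.S V) i * b.dot (fun i k => 2 * H i k - b.S V i k) i)
      - 4 * b.N * b.ph V * (∑ i, b.D i (b.div (fun i k => 2 * H i k - b.S V i k) i))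
      - 8 * (2 * b.N + 1) * b.N * (∑ i, ∑ k, b.p i * (b.D k (b.ph V) - b.N * b.p k * b.ph V) * (2 * H i k - b.S V i k))))
    + 4 * (b.U * (- b.N * b.ph V * (∑ i, b.D i (b.div (b.S V) i))
     - 2 * (2 * b.N + 1) * b.N * (∑ i, ∑ k, b.p i * (b.D k (b.ph V) - b.N * b.p k * b.ph V) * b.S V i k)
     - 2 * (2 * b.N + 1) * b.N * (∑ k, (b.D k (b.ph V) - b.N * b.p k * b.ph V) ^ 2)
     + 2 * (2 * b.N + 1) * b.N * n * (n + 2) * b.s ^ 2 * b.ph V ^ 2)) := by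
    unfold E4
    simp only [v1, v2, v3, v4, map_sub, D_mul, b.D2]
    have z1 : ∑ i, ∑ k, ∑ l, b.D l (H i k) * b.D l (H i k) =
      (∑ i, ∑ k, ∑ l, (b.D l (H i k) - b.D l (b.S V i k)) * (b.D l (H i k) - b.D l (b.S V i k)))
      + ∑ i, ∑ k, ∑ l, b.D l (b.S V i k) * (2 * b.D l (H i k) + H i k * 0 - b.D l (b.S V i k)) := by
      simp only [← sum_add_distrib]
      exact sum_congr rfl fun i _ => sum_congr rfl fun k _ =>
        sum_congr rfl fun l _ => by ring
    have z2 : ∑ i, ∑ k, b.p i * (b.D k (b.ph V) - b.N * b.p k * b.ph V) * (2 * H i k - b.S V i k) =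
      2 * (∑ i, ∑ k, b.p i * (b.D k (b.ph V) - b.N * b.p k * b.ph V) * H i k) -
      ∑ i, ∑ k, b.p i * (b.D k (b.ph V) - b.N * b.p k * b.ph V) * b.S V i k := by
      simp only [mul_sum, ← sum_sub_distrib]
      exact sum_congr rfl fun i _ => sum_congr rfl fun k _ => by ring
    have z3 : - 2 * (∑ i, b.div H i * b.div H i) + 8 * b.N * (∑ i, b.dot H i * b.div H i)
      - 4 * (2 * b.N + 1) * b.N * (∑ i, b.dot H i * b.dot H i) =
      - 2 * (∑ i, (b.div H i - b.div (b.S V) i) * (b.div H i - b.div (b.S V) i))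
      + 8 * b.N * (∑ i, (b.dot H i - b.dot (b.S V) i) * (b.div H i - b.div (b.S V) i))
      - 4 * (2 * b.N + 1) * b.N * (∑ i, (b.dot H i - b.dot (b.S V) i) * (b.dot H i - b.dot (b.S V) i))
      - 2 * (∑ i, b.div (b.S V) i * (2 * b.div H i - b.div (b.S V) i))
      + 4 * b.N * (∑ i, (b.dot (b.S V) i * (2 * b.div H i - b.div (b.S V) i)
         + (2 * b.dot H i - b.dot (b.S V) i) * b.div (b.S V) i))
      - 4 * (2 * b.N + 1) * b.N * (∑ i, b.dot (b.S V) i * (2 * b.dot H i - b.dot (b.S V) i)) := by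
      simp only [mul_sum, ← sum_sub_distrib, ← sum_add_distrib]
      exact sum_congr rfl fun i _ => by ring
    rw [z2]
    simp only [mul_zero, add_zero, sum_sub_distrib, ← mul_sum] at z1 z3 ⊢
    linear_combination b.U * z1 + b.U * z3
  rw [key]
  linear_combination 2 * i3 + i1 + 8 * i2
end Bg


/-- algebra of smooth functions -/
def SF (n : ℕ) : Subalgebra ℝ (Euc n → ℝ) where
  carrier := {f | ContDiff ℝ (⊤ : ℕ∞) f}
  mul_mem' := fun {a b} ha hb => ContDiff.mul (𝕜 := ℝ) (f := a) (g := b) (n := (⊤ : ℕ∞)) ha hb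
  add_mem' := fun {a b} ha hb => ContDiff.add (𝕜 := ℝ) (f := a) (g := b) (n := (⊤ : ℕ∞)) ha hb
  algebraMap_mem' := fun r => (contDiff_const : ContDiff ℝ (⊤ : ℕ∞) (fun _ : Euc n => r))

namespace SF
variable {n : ℕ}

lemma sm (f : SF n) : ContDiff ℝ (⊤ : ℕ∞) (f : Euc n → ℝ) := f.2
lemma da (f : SF n) (x : Euc n) : DifferentiableAt ℝ (f : Euc n → ℝ) x :=
  ((sm f).differentiable (by simp)) x

lemma pd_smooth {f : Euc n → ℝ} (hf : ContDiff ℝ (⊤ : ℕ∞) f) (i : Fin n) :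
    ContDiff ℝ (⊤ : ℕ∞) (pd i f) := by
  unfold pd
  exact (hf.fderiv_right (m := (⊤ : ℕ∞)) (by simp)).clm_apply contDiff_const

/-- derivation -/
def De (i : Fin n) : Derivation ℝ (SF n) (SF n) :=
  Derivation.mk'
    { toFun := fun f => ⟨pd i f, pd_smooth (sm f) i⟩
      map_add' := fun f g => by
        ext x
        change fderiv ℝ ((f : Euc n → ℝ) + (g : Euc n → ℝ)) x _ = fderiv ℝ (f : Euc n → ℝ) x _ + fderiv ℝ (g : Euc n → ℝ) x _
        rw [fderiv_add (da f x) (da g x)]; rfl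
      map_smul' := fun c f => by
        ext x
        change fderiv ℝ (c • (f : Euc n → ℝ)) x _ = c * fderiv ℝ (f : Euc n → ℝ) x _
        rw [fderiv_const_smul (da f x)]; rfl }
    (fun f g => by
      ext x
      change fderiv ℝ ((f : Euc n → ℝ) * (g : Euc n → ℝ)) x _ = (f : Euc n → ℝ) x * fderiv ℝ (g : Euc n → ℝ) x _ +
        (g : Euc n → ℝ) x * fderiv ℝ (f : Euc n → ℝ) x _
      rw [fderiv_mul (da f x) (da g x)]; rfl)

lemma De_coe (i : Fin n) (f : SF n) : ((De i f : SF n) : Euc n → ℝ) = pd i f := rfl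

lemma De_comm (i j : Fin n) (f : SF n) : De i (De j f) = De j (De i f) := by
  ext x
  change pd i (pd j f) x = pd j (pd i f) x
  have h : ContDiffAt ℝ (⊤ : ℕ∞) (f : Euc n → ℝ) x := (sm f).contDiffAt
  have hs := h.isSymmSndFDerivAt (by simp only [minSmoothness_of_isRCLikeNormedField]; exact WithTop.coe_le_coe.mpr le_top)
  have hd : DifferentiableAt ℝ (fderiv ℝ (f : Euc n → ℝ)) x :=
    (((sm f).fderiv_right (m := (⊤ : ℕ∞)) (by simp)).differentiable (by simp)) x
  have e : ∀ a c : Fin n, pd a (pd c f) x = fderiv ℝ (fderiv ℝ (f : Euc n → ℝ)) x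
      (EuclideanSpace.single a 1) (EuclideanSpace.single c 1) := by
    intro a c
    unfold pd
    rw [fderiv_clm_apply hd (by fun_prop)]
    simp
  rw [e, e]
  exact hs _ _

/-- constant -/
def cst (c : ℝ) : SF n := algebraMap ℝ (SF n) c

lemma De_cst (i : Fin n) (c : ℝ) : De i (cst c : SF n) = 0 := Derivation.map_algebraMap _ _

/-- coordinate -/
def X (i : Fin n) : SF n := ⟨fun x => x i, by
  change ContDiff ℝ (⊤ : ℕ∞) (fun x : Euc n => x i); fun_prop⟩

lemma De_X (i j : Fin n) : De i (X j : SF n) = if j = i then 1 else 0 := by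
  ext x
  change fderiv ℝ (fun x : Euc n => x j) x _ = _
  have : (fun x : Euc n => x j) = (EuclideanSpace.proj j : Euc n →L[ℝ] ℝ) := rfl
  rw [this, ContinuousLinearMap.fderiv]
  by_cases h : j = i
  · subst h; simp
  · simp [h]

variable (n) in
/-- the reciprocal -/
def rec (ε : ℝ) (hε : 0 < ε) : SF n := ⟨fun x => 1 / (ε ^ 2 + ‖x‖ ^ 2), by
  change ContDiff ℝ (⊤ : ℕ∞) (fun x : Euc n => 1 / (ε ^ 2 + ‖x‖ ^ 2))
  refine ContDiff.div contDiff_const (contDiff_const.add (contDiff_norm_sq ℝ)) fun x => ?_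
  positivity⟩

lemma rec_mul (ε : ℝ) (hε : 0 < ε) : rec n ε hε * (cst (ε ^ 2) + ∑ i, X i * X i) = 1 := by
  ext x
  have : ((rec n ε hε * (cst (ε ^ 2) + ∑ i, X i * X i) : SF n) : Euc n → ℝ) x =
    1 / (ε ^ 2 + ‖x‖ ^ 2) * (ε ^ 2 + ∑ i, x i * x i) := by
    rw [Subalgebra.coe_mul, Subalgebra.coe_add, AddSubmonoidClass.coe_finsetSum]
    simp only [Pi.mul_apply, Pi.add_apply, Finset.sum_apply, Subalgebra.coe_mul]
    rfl
  rw [this, EuclideanSpace.norm_sq_eq]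
  have h2 : ∑ i, x i * x i = ∑ i, ‖x i‖ ^ 2 := sum_congr rfl fun i _ => by
    rw [Real.norm_eq_abs, sq_abs]; ring
  rw [h2]
  have : (ε ^ 2 + ∑ i, ‖x i‖ ^ 2) ≠ 0 := by positivity
  change _ = (1:ℝ)
  field_simp

lemma De_rec (ε : ℝ) (hε : 0 < ε) (i : Fin n) :
    De i (rec n ε hε) = - (2 * X i * rec n ε hε ^ 2) := by
  have h := rec_mul (n := n) ε hε
  have h1 := congrArg (De i) h
  rw [Derivation.leibniz, Derivation.map_one_eq_zero, map_add, De_cst, map_sum] at h1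
  have h2 : ∑ j, De i (X j * X j : SF n) = 2 * X i := by
    simp only [Derivation.leibniz, De_X, smul_eq_mul, mul_ite, mul_one, mul_zero,
      sum_add_distrib, sum_ite_eq', mem_univ, if_true]
    ring
  rw [h2, smul_eq_mul, smul_eq_mul] at h1
  linear_combination (rec n ε hε) * h1 - De i (rec n ε hε) * h

end SF

/-- the bubble background -/
def bub (n : ℕ) (hn : 6 ≤ n) (ε : ℝ) (hε : 0 < ε) : Bg n (SF n) where
  D := SF.De
  comm := SF.De_comm
  s := SF.cst ε * SF.rec n ε hε
  U := (SF.cst ε * SF.rec n ε hε) ^ (n - 2)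
  κ := SF.cst (2 / ε)
  ν := SF.cst (1 / n)
  N := SF.cst (((n : ℝ) - 2) / 2)
  p := fun i => 2 * SF.X i * SF.rec n ε hε
  Dκ := fun i => SF.De_cst i _
  Dν := fun i => SF.De_cst i _
  DN := fun i => SF.De_cst i _
  Ds := fun i => by
    rw [Derivation.leibniz, SF.De_cst, SF.De_rec, smul_eq_mul, smul_zero]; ring
  Dp := fun j i => by
    have h2 : SF.De j (2 : SF n) = 0 := by have := (SF.De j).map_natCast 2; simpa using this
    have hc : (SF.cst (2 / ε) : SF n) * SF.cst ε = 2 := by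
      rw [SF.cst, SF.cst, ← map_mul, div_mul_cancel₀ _ hε.ne', map_ofNat]
    rw [Derivation.leibniz, Derivation.leibniz, h2, SF.De_rec, SF.De_X]
    simp only [smul_eq_mul]
    split_ifs
    · linear_combination - (SF.rec n ε hε) * hc
    · ring
  DU := fun i => by
    have hN : ((n - 2 : ℕ) : SF n) = 2 * SF.cst (((n : ℝ) - 2) / 2) := by
      have : (2 : SF n) = algebraMap ℝ (SF n) 2 := (map_ofNat _ 2).symm
      rw [SF.cst, this, ← map_mul, mul_div_cancel₀ _ (two_ne_zero)]
      rw [show ((n : ℝ) - 2) = ((n - 2 : ℕ) : ℝ) by push_cast [show 2 ≤ n by omega]; ring, map_natCast]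
    obtain ⟨m, rfl⟩ : ∃ m, n = m + 3 := ⟨n - 3, by omega⟩
    rw [show m + 3 - 2 = m + 1 by omega] at *
    rw [Derivation.leibniz_pow, Derivation.leibniz, SF.De_cst, SF.De_rec]
    simp only [smul_eq_mul, nsmul_eq_mul, hN, add_tsub_cancel_right]
    ring
  pp := by
    have hc : (SF.cst (2 / ε) : SF n) * SF.cst ε = 2 := by
      rw [SF.cst, SF.cst, ← map_mul, div_mul_cancel₀ _ hε.ne', map_ofNat]
    have h := SF.rec_mul (n := n) ε hε
    have : ∑ i, (2 * SF.X i * SF.rec n ε hε) * (2 * SF.X i * SF.rec n ε hε) =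
      4 * SF.rec n ε hε ^ 2 * ∑ i, SF.X i * SF.X i := by
      rw [mul_sum]; exact sum_congr rfl fun i _ => by ring
    have h3 : (SF.cst (ε ^ 2) : SF n) = SF.cst ε ^ 2 := by rw [SF.cst, SF.cst, map_pow]
    rw [h3] at h
    rw [this]
    linear_combination 4 * SF.rec n ε hε * h - 2 * SF.rec n ε hε * hc
  hν := by
    have : (n : ℝ) ≠ 0 := by positivity
    rw [SF.cst, ← map_natCast (algebraMap ℝ (SF n)), ← map_mul, mul_one_div_cancel this, map_one]
  hN := by
    have : (2 : SF n) = algebraMap ℝ (SF n) 2 := (map_ofNat _ 2).symm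
    rw [SF.cst, this, ← map_mul, mul_div_cancel₀ _ (two_ne_zero), ← map_add, sub_add_cancel, map_natCast]


namespace SF
variable {n : ℕ}
/-- evaluation -/
def ev (x : Euc n) : SF n →+* ℝ := (Pi.evalRingHom _ x).comp (SF n).val.toRingHom
lemma ev_eq (x : Euc n) (f : SF n) : ev x f = (f : Euc n → ℝ) x := rfl
lemma ev_De (x : Euc n) (i : Fin n) (f : SF n) : ev x (De i f) = pd i f x := rfl
lemma ev_cst (x : Euc n) (c : ℝ) : ev x (cst c) = c := rfl
end SF

namespace Bub
open SF
variable {n : ℕ} (hn : 6 ≤ n) (ε : ℝ) (hε : 0 < ε)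

lemma ev_s (x : Euc n) : ev x (bub n hn ε hε).s = ε / (ε ^ 2 + ‖x‖ ^ 2) := by
  change ev x (cst ε * rec n ε hε) = _
  rw [map_mul, ev_cst]
  change ε * (1 / _) = _
  ring

lemma s_pos (x : Euc n) : 0 < ev x (bub n hn ε hε).s := by rw [ev_s]; positivity

lemma ev_U (x : Euc n) : ev x (bub n hn ε hε).U = (ε / (ε ^ 2 + ‖x‖ ^ 2)) ^ (n - 2) := by
  rw [← ev_s hn ε hε, ← map_pow]; rfl

lemma ev_p (x : Euc n) (i : Fin n) : ev x ((bub n hn ε hε).p i) = 2 * x i / (ε ^ 2 + ‖x‖ ^ 2) := by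
  change ev x (2 * X i * rec n ε hε) = _
  rw [map_mul, map_mul, map_ofNat]
  change 2 * x i * (1 / _) = _
  ring

lemma ev_N (x : Euc n) : ev x (bub n hn ε hε).N = ((n : ℝ) - 2) / 2 := rfl
lemma ev_ν (x : Euc n) : ev x (bub n hn ε hε).ν = 1 / n := rfl
lemma ev_D (x : Euc n) (i : Fin n) (f : SF n) : ev x ((bub n hn ε hε).D i f) = pd i f x := rfl

variable (n) in
/-- bubble as element -/
def uS : SF n := ⟨uE n ε, by
  change ContDiff ℝ (⊤ : ℕ∞) (fun x : Euc n => (ε / (ε ^ 2 + ‖x‖ ^ 2)) ^ (((n : ℝ) - 2) / 2))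
  refine ContDiff.rpow_const_of_ne ?_ fun x => (by positivity)
  exact ContDiff.div contDiff_const (contDiff_const.add (contDiff_norm_sq ℝ)) fun x => (by positivity)⟩

lemma uS_coe : (uS n ε hε : Euc n → ℝ) = uE n ε := rfl

lemma uE_eq (x : Euc n) : uE n ε x = (ev x (bub n hn ε hε).s) ^ (((n : ℝ) - 2) / 2) := by
  rw [ev_s]; rfl

lemma D_u (i : Fin n) : De i (uS n ε hε) = - ((bub n hn ε hε).N * (bub n hn ε hε).p i * uS n ε hε) := by
  ext x
  set b := bub n hn ε hε
  have h1 : HasFDerivAt (uE n ε) _ x := HasFDerivAt.rpow_const (f := fun y => ev y b.s)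
    (p := ((n : ℝ) - 2) / 2) ((da b.s x).hasFDerivAt) (Or.inl (s_pos hn ε hε x).ne') |>.congr_of_eventuallyEq
      (Filter.Eventually.of_forall fun y => uE_eq hn ε hε y)
  change fderiv ℝ (uE n ε) x _ = - (ev x b.N * ev x (b.p i) * uE n ε x)
  rw [h1.fderiv]
  have h2 : pd i b.s x = - (ev x b.s * ev x (b.p i)) := by
    have := congrArg (ev x) (b.Ds i)
    rw [map_neg, map_mul] at this
    exact this
  simp only [_root_.smul_apply, smul_eq_mul]
  change _ * pd i b.s x = _
  rw [h2, uE_eq hn ε hε, ev_N, Real.rpow_sub_one (s_pos hn ε hε x).ne']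
  have := (s_pos hn ε hε x).ne'
  change ev x b.s ≠ 0 at this
  change _ * (ev x b.s ^ _ / ev x b.s) * _ = -(_ * _ * ev x b.s ^ _)
  field_simp

lemma U_eq (x : Euc n) : uE n ε x ^ 2 = ev x (bub n hn ε hε).U := by
  rw [uE_eq hn ε hε, ev_U, ← ev_s hn ε hε, ← Real.rpow_natCast, ← Real.rpow_mul (s_pos hn ε hε x).le,
    ← Real.rpow_natCast]
  congr 1
  push_cast [show 2 ≤ n by omega]; ring

lemma u_pow4 (x : Euc n) : uE n ε x ^ (4 / ((n : ℝ) - 2)) = ev x (bub n hn ε hε).s ^ 2 := by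
  have : (6 : ℝ) ≤ n := by exact_mod_cast hn
  rw [uE_eq hn ε hε, ← Real.rpow_mul (s_pos hn ε hε x).le, ← Real.rpow_natCast]
  congr 1
  have : (n : ℝ) - 2 ≠ 0 := by linarith
  field_simp; norm_num

lemma u_pow2 (x : Euc n) : uE n ε x ^ (2 * (n : ℝ) / ((n : ℝ) - 2)) = ev x (bub n hn ε hε).s ^ n := by
  have : (6 : ℝ) ≤ n := by exact_mod_cast hn
  rw [uE_eq hn ε hε, ← Real.rpow_mul (s_pos hn ε hε x).le, ← Real.rpow_natCast]
  congr 1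
  have : (n : ℝ) - 2 ≠ 0 := by linarith
  field_simp

lemma w_eq (V : Fin n → SF n) : wop ε (fun i => (V i : Euc n → ℝ)) =
    ((bub n hn ε hε).N * uS n ε hε * (bub n hn ε hε).ph V : SF n) := by
  ext x
  set b := bub n hn ε hε
  change _ = ev x (b.N * uS n ε hε * b.ph V)
  have e : ∀ l, pd l (uE n ε) x = - (ev x b.N * ev x (b.p l) * uE n ε x) := fun l => by
    have := congrArg (ev x) (D_u hn ε hε l)
    rw [map_neg, map_mul, map_mul] at this
    exact this
  unfold wop
  simp only [e, Bg.ph, Bg.th, Bg.pV, map_mul, map_sub, map_sum]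
  change _ = ev x b.N * uE n ε x * (1 / n * (∑ l, pd l (V l) x) - ∑ l, ev x (b.p l) * (V l : Euc n → ℝ) x)
  have : ∑ l, -(ev x b.N * ev x (b.p l) * uE n ε x) * (V l : Euc n → ℝ) x = - (ev x b.N * uE n ε x *
     ∑ l, ev x (b.p l) * (V l : Euc n → ℝ) x) := by
    rw [mul_sum, ← Finset.sum_neg_distrib]; exact sum_congr rfl fun i _ => by ring
  rw [this, ev_N]
  ring

theorem integrand_eq (V : Fin n → SF n) (H : Fin n → Fin n → SF n) (x : Euc n) :
   ((1 / 4) * uE n ε x ^ 2 * (∑ i, ∑ k, ∑ l, pd l (H i k) x * pd l (H i k) x)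
              - (1 / 2) * uE n ε x ^ 2 * (∑ i, ∑ k, ∑ l, pd k (H i k) x * pd l (H i l) x)
              - 2 * uE n ε x * (∑ i, ∑ k, ∑ l, pd k (uE n ε) x * (H i k : Euc n → ℝ) x * pd l (H i l) x)
              - (2 * ((n : ℝ) - 1) / ((n : ℝ) - 2))
                * (∑ i, ∑ k, ∑ l, pd k (uE n ε) x * pd l (uE n ε) x * (H i k : Euc n → ℝ) x * (H i l : Euc n → ℝ) x)
              - 2 * uE n ε x * wop ε (fun i => (V i : Euc n → ℝ)) x * (∑ i, ∑ k, pd i (pd k (H i k)) x)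
              + (8 * ((n : ℝ) - 1) / ((n : ℝ) - 2))
                * (∑ i, ∑ k, pd i (uE n ε) x * pd k (wop ε (fun i => (V i : Euc n → ℝ))) x * (H i k : Euc n → ℝ) x)
              - (4 * ((n : ℝ) - 1) / ((n : ℝ) - 2)) * (∑ i, (pd i (wop ε (fun i => (V i : Euc n → ℝ))) x) ^ 2)
              + (4 * ((n : ℝ) - 1) / ((n : ℝ) - 2)) * (n : ℝ) * ((n : ℝ) + 2)
                * uE n ε x ^ (4 / ((n : ℝ) - 2)) * (wop ε (fun i => (V i : Euc n → ℝ)) x) ^ 2)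
   = (1 / 4) * ev x ((bub n hn ε hε).E4 V H) := by
  set b := bub n hn ε hε
  have e : ∀ l, pd l (uE n ε) x = - (ev x b.N * ev x (b.p l) * uE n ε x) := fun l => by
    have := congrArg (ev x) (D_u hn ε hε l)
    rw [map_neg, map_mul, map_mul] at this
    exact this
  have hw0 : wop ε (fun i => (V i : Euc n → ℝ)) x = ev x b.N * uE n ε x * ev x (b.ph V) := by
    rw [w_eq hn ε hε]
    change ev x (b.N * uS n ε hε * b.ph V) = _
    rw [map_mul, map_mul]; rfl
  have hw1 : ∀ k, pd k (wop ε (fun i => (V i : Euc n → ℝ))) x = ev x b.N * uE n ε x *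
      (ev x (b.D k (b.ph V)) - ev x b.N * ev x (b.p k) * ev x (b.ph V)) := by
    intro k
    rw [w_eq hn ε hε]
    change ev x (b.D k (b.N * uS n ε hε * b.ph V)) = _
    have : b.D k (uS n ε hε) = - (b.N * b.p k * uS n ε hε) := D_u hn ε hε k
    rw [b.D_mul, b.D_mul, b.DN, this]
    simp only [map_mul, map_add, map_neg, map_zero]
    change _ * uE n ε x * _ + _ * (_ * -(_ * _ * uE n ε x) + uE n ε x * 0) = _
    ring
  rw [u_pow4 hn ε hε]
  have hN := ev_N hn ε hε x
  change ev x b.N = _ at hN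
  have hn2 : (n : ℝ) - 2 = 2 * ev x b.N := by rw [hN]; ring
  have hn1 : (n : ℝ) = 2 * ev x b.N + 2 := by rw [hN]; ring
  have hN0 : ev x b.N ≠ 0 := by
    rw [hN]; have : (6 : ℝ) ≤ n := by exact_mod_cast hn
    linarith
  rw [hw0]
  have hU : uE n ε x * uE n ε x = ev x b.U := by rw [← sq, U_eq hn ε hε]
  have hU2 : uE n ε x ^ 2 = ev x b.U := U_eq hn ε hε x
  have hD : ∀ k (f : SF n), ev x (b.D k f) = pd k f x := fun _ _ => rfl
  have hD2 : ∀ k (f : SF n), ((b.D k f : SF n) : Euc n → ℝ) = pd k f := fun _ _ => rfl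
  change _ = _ * ev x (b.U * _)
  unfold Bg.div Bg.dot
  simp only [map_mul, map_add, map_sub, map_sum, map_pow, map_ofNat, map_natCast, e, hw1, hD, hD2, map_one]
  have v2 : ∑ i, ∑ k, ∑ l, pd k (H i k) x * pd l (H i l) x =
     ∑ i, (∑ k, pd k (H i k) x) * (∑ k, pd k (H i k) x) :=
    sum_congr rfl fun i _ => by rw [Finset.sum_mul_sum]
  have v3 : ∑ i, ∑ k, ∑ l, -(ev x b.N * ev x (b.p k) * uE n ε x) * (H i k : Euc n → ℝ) x * pd l (H i l) x =
     - (ev x b.N * uE n ε x) * ∑ i, (∑ k, ev x (b.p k) * ev x (H i k)) * ∑ k, pd k (H i k) x := by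
    rw [mul_sum]
    refine sum_congr rfl fun i _ => ?_
    rw [Finset.sum_mul_sum, mul_sum]
    refine sum_congr rfl fun k _ => ?_
    rw [mul_sum]
    refine sum_congr rfl fun l _ => ?_
    rw [ev_eq x (H i k)]; ring
  have v4 : ∑ i, ∑ k, ∑ l, -(ev x b.N * ev x (b.p k) * uE n ε x) * -(ev x b.N * ev x (b.p l) * uE n ε x) *
      (H i k : Euc n → ℝ) x * (H i l : Euc n → ℝ) x =
     (ev x b.N ^ 2 * ev x b.U) * ∑ i, (∑ k, ev x (b.p k) * ev x (H i k)) * ∑ k, ev x (b.p k) * ev x (H i k) := by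
    rw [mul_sum]
    refine sum_congr rfl fun i _ => ?_
    rw [Finset.sum_mul_sum, mul_sum]
    refine sum_congr rfl fun k _ => ?_
    rw [mul_sum]
    refine sum_congr rfl fun l _ => ?_
    rw [ev_eq x (H i k), ev_eq x (H i l), ← hU2]; ring
  have v6 : ∑ i, ∑ k, -(ev x b.N * ev x (b.p i) * uE n ε x) * (ev x b.N * uE n ε x *
      (pd k (b.ph V) x - ev x b.N * ev x (b.p k) * ev x (b.ph V))) * (H i k : Euc n → ℝ) x =
      - (ev x b.N ^ 2 * ev x b.U) * ∑ i, ∑ k, ev x (b.p i) *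
      (pd k (b.ph V) x - ev x b.N * ev x (b.p k) * ev x (b.ph V)) * ev x (H i k) := by
    rw [mul_sum]
    refine sum_congr rfl fun i _ => ?_
    rw [mul_sum]
    refine sum_congr rfl fun k _ => ?_
    rw [ev_eq x (H i k), ← hU2]; ring
  have v7 : ∑ k, (ev x b.N * uE n ε x *
      (pd k (b.ph V) x - ev x b.N * ev x (b.p k) * ev x (b.ph V))) ^ 2 =
      (ev x b.N ^ 2 * ev x b.U) * ∑ k, (pd k (b.ph V) x - ev x b.N * ev x (b.p k) * ev x (b.ph V)) ^ 2 := by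
    rw [mul_sum]
    refine sum_congr rfl fun i _ => ?_
    rw [← hU2]; ring
  rw [v2, v3, v4, v6, v7, hn2, hU2]
  generalize ∑ i, (∑ k, pd k (H i k) x) * (∑ k, pd k (H i k) x) = q1
  generalize ∑ i, (∑ k, ev x (b.p k) * ev x (H i k)) * ∑ k, ev x (b.p k) * ev x (H i k) = q2
  generalize ∑ i, ∑ k, pd i (pd k (H i k)) x = q3
  generalize ∑ i, ∑ k, ev x (b.p i) *
      (pd k (b.ph V) x - ev x b.N * ev x (b.p k) * ev x (b.ph V)) * ev x (H i k) = q4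
  generalize ∑ k, (pd k (b.ph V) x - ev x b.N * ev x (b.p k) * ev x (b.ph V)) ^ 2 = q5
  generalize ∑ i, ∑ k, ∑ l, pd l (H i k) x * pd l (H i k) x = q6
  generalize ∑ i, (∑ k, ev x (b.p k) * ev x (H i k)) * ∑ k, pd k (H i k) x = q7
  generalize ev x (b.ph V) = f at *
  rw [hn1, ← hU2]
  change _ + _ * ev x b.s ^ 2 * _ = _
  generalize ev x b.N = N at *
  field_simp
  ring

lemma T_coe (V : Fin n → SF n) (H : Fin n → Fin n → SF n) (i k : Fin n) :
    Tten (fun i k => (H i k : Euc n → ℝ)) (fun i => (V i : Euc n → ℝ)) i k =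
      (H i k - (bub n hn ε hε).S V i k : SF n) := by
  ext x
  set b := bub n hn ε hε
  change _ = ev x (H i k - b.S V i k)
  rw [map_sub, Bg.S, map_sub, map_add]
  unfold Tten Sop kd
  rw [apply_ite (ev x), map_zero, map_mul, map_mul, Bg.th, map_sum, map_ofNat]
  change _ = (H i k : Euc n → ℝ) x - (pd i (V k) x + pd k (V i) x - if i = k then 2 * (1 / (n : ℝ)) *
    (∑ m, pd m (V m) x) else 0)
  split_ifs <;> ring

lemma div_hyp (V : Fin n → SF n) (H : Fin n → Fin n → SF n) (i : Fin n) (x : Euc n)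
   (h : ∑ k, pd k (fun y => uE n ε y ^ (2 * (n : ℝ) / ((n : ℝ) - 2)) *
      Tten (fun i k => (H i k : Euc n → ℝ)) (fun i => (V i : Euc n → ℝ)) i k y) x = 0) :
    ev x ((bub n hn ε hε).div (fun i k => H i k - (bub n hn ε hε).S V i k) i -
      n * (bub n hn ε hε).dot (fun i k => H i k - (bub n hn ε hε).S V i k) i) = 0 := by
  set b := bub n hn ε hε
  have e : ∀ k, (fun y => uE n ε y ^ (2 * (n : ℝ) / ((n : ℝ) - 2)) *
      Tten (fun i k => (H i k : Euc n → ℝ)) (fun i => (V i : Euc n → ℝ)) i k y) =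
      (b.s ^ n * (H i k - b.S V i k) : SF n) := by
    intro k
    ext y
    rw [u_pow2 hn ε hε, T_coe hn ε hε]
    rw [← map_pow]; rfl
  simp only [e] at h
  have h2 : ev x (∑ k, b.D k (b.s ^ n * (H i k - b.S V i k))) = 0 := by
    rw [map_sum]; exact h
  have h3 : ∑ k, b.D k (b.s ^ n * (H i k - b.S V i k)) = b.s ^ n * (b.div (fun i k => H i k - b.S V i k) i -
      n * b.dot (fun i k => H i k - b.S V i k) i) := by
    unfold Bg.div Bg.dot
    rw [mul_sum, ← sum_sub_distrib, mul_sum]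
    refine sum_congr rfl fun k _ => ?_
    obtain ⟨m, rfl⟩ : ∃ m, n = m + 1 := ⟨n - 1, by omega⟩
    rw [b.D_mul, Derivation.leibniz_pow, b.Ds]
    simp only [smul_eq_mul, nsmul_eq_mul, add_tsub_cancel_right]
    ring
  rw [h3, map_mul, map_pow] at h2
  exact (mul_eq_zero.mp h2).resolve_left (pow_ne_zero _ (s_pos hn ε hε x).ne')
end Bub


namespace Bg
variable {n : ℕ} {A : Type*} [CommRing A] [Algebra ℝ A] (b : Bg n A) (V : Fin n → A)

theorem bdry (hn : 2 ≤ n) (e : A →+* ℝ) (z : Fin n) (H : Fin n → Fin n → A) (hp : e (b.p z) = 0)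
    (hV : e (V z) = 0)
    (h1 : ∀ i, i ≠ z → e (b.D z (V i)) = 0) (h2 : ∀ k, k ≠ z → e (b.D k (V z)) = 0)
    (h3 : ∀ i k, i ≠ z → k ≠ z → e (b.D k (b.D z (V i))) = 0)
    (h4 : ∀ k, k ≠ z → e (b.D k (b.D k (V z))) = 0)
    (h5 : ∀ k, e (H z k) = 0) (h5' : ∀ k, e (H k z) = 0) (h6 : ∀ j k, e (b.D j (H z k)) = 0)
    (hd : e (b.div (fun i k => H i k - b.S V i k) z - n * b.dot (fun i k => H i k - b.S V i k) z) = 0) :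
    e (b.Xi V H z) = 0 := by
  have hν : (n : ℝ) * e b.ν = 1 := by have := congrArg e b.hν; simpa using this
  have hn' : (2 : ℝ) ≤ n := by exact_mod_cast hn
  have a1 : ∀ k, k ≠ z → e (b.S V z k) = 0 := by
    intro k hk
    simp [S, h1 k hk, h2 k hk, hk.symm]
  have a1' : ∀ k, k ≠ z → e (b.S V k z) = 0 := fun k hk => by rw [S_symm, a1 k hk]
  have a2 : ∀ k, k ≠ z → e (b.D k (b.S V z k)) = 0 := by
    intro k hk
    rw [D_S, if_neg hk.symm, sub_zero, map_add, h3 k k hk hk, h4 k hk, add_zero]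
  have a3 : e (b.dot (b.S V) z) = 0 := by
    rw [dot, map_sum]
    refine sum_eq_zero fun k _ => ?_
    rw [map_mul]
    by_cases hk : k = z
    · subst hk; rw [hp, zero_mul]
    · rw [a1 k hk, mul_zero]
  have a4 : e (b.D z (b.th V)) = e (b.D z (b.D z (V z))) := by
    rw [th, map_sum, map_sum, Finset.sum_eq_single z]
    · intro m _ hm; rw [b.comm, h3 m m hm hm]
    · simp
  have a5 : e (b.div H z) = 0 := by rw [div, map_sum]; exact sum_eq_zero fun k _ => h6 k k
  have a6 : e (b.dot H z) = 0 := by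
    rw [dot, map_sum]; exact sum_eq_zero fun k _ => by rw [map_mul, h5, mul_zero]
  have a7 : e (b.div (b.S V) z) = e (b.D z (b.S V z z)) := by
    rw [div, map_sum, Finset.sum_eq_single z]
    · intro m _ hm; rw [a2 m hm]
    · simp
  have v1 : b.div (fun i k => H i k - b.S V i k) z = b.div H z - b.div (b.S V) z := by
    simp only [div, map_sub, sum_sub_distrib]
  have v3 : b.dot (fun i k => H i k - b.S V i k) z = b.dot H z - b.dot (b.S V) z := by
    simp only [dot, mul_sub, sum_sub_distrib]
  rw [v1, v3] at hd
  have a8 : e (b.div (b.S V) z) = 0 := by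
    simp only [map_sub, map_mul, a5, a6, a3] at hd
    linarith
  have a9 : e (b.D z (b.S V z z)) = 0 := by rw [← a7, a8]
  have a10 : e (b.D z (b.D z (V z))) = 0 := by
    rw [D_S, if_pos rfl] at a9
    simp only [map_sub, map_add, map_mul, map_ofNat, a4] at a9
    have : 2 * e (b.D z (b.D z (V z))) * ((n : ℝ) - 1) = 0 := by linear_combination n * a9 + (2 * e (b.D z (b.D z (V z)))) * hν
    rcases mul_eq_zero.mp this with h | h
    · linarith
    · linarith
  have a11 : e (b.D z (b.th V)) = 0 := by rw [a4, a10]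
  have a12 : e (b.g V z) = 0 := by
    rw [g, map_sum]
    refine sum_eq_zero fun k _ => ?_
    rw [map_mul]
    by_cases hk : k = z
    · subst hk; rw [hp, zero_mul]
    · rw [h1 k hk, mul_zero]
  have a13 : e (b.D z (b.ph V)) = 0 := by
    rw [D_ph]; simp only [map_sub, map_add, map_mul, a11, hV, hp, a12]; ring
  have a14 : ∀ i k, i ≠ z → k ≠ z → e (b.D z (b.S V i k)) = 0 := by
    intro i k hi hk
    rw [D_S, b.comm z i, b.comm z k]
    simp only [map_sub, map_add, h3 k i hk hi, h3 i k hi hk]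
    split_ifs
    · simp [a11]
    · simp
  unfold Xi
  simp only [map_add, map_sub, map_mul]
  have b1 : e (b.X1 V (fun i k => 2 * H i k - b.S V i k) z) = 0 := by
    unfold X1
    have c1 : ∑ x, ∑ k, (2 * e (H x k) - e (b.S V x k)) * e (b.D z (b.S V x k)) = 0 := by
      refine sum_eq_zero fun i _ => sum_eq_zero fun k _ => ?_
      by_cases hi : i = z
      · subst hi
        by_cases hk : k = i
        · subst hk; rw [a9, mul_zero]
        · rw [h5, a1 k hk]; ring
      · by_cases hk : k = z
        · subst hk; rw [h5', a1' i hi]; ring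
        · rw [a14 i k hi hk, mul_zero]
    have c2 : ∀ q : Fin n → ℝ, q z = 0 → ∑ x, q x * (2 * e (H x z) - e (b.S V x z)) = 0 := by
      intro q hq
      refine sum_eq_zero fun i _ => ?_
      by_cases hi : i = z
      · subst hi; rw [hq, zero_mul]
      · rw [h5', a1' i hi]; ring
    have c2' : ∀ q : Fin n → ℝ, q z = 0 → ∑ x, q x * (2 * e (H z x) - e (b.S V z x)) = 0 := by
      intro q hq
      refine sum_eq_zero fun i _ => ?_
      by_cases hi : i = z
      · subst hi; rw [hq, zero_mul]
      · rw [h5, a1 i hi]; ring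
    have c3 : e (b.div (fun i k => 2 * H i k - b.S V i k) z) = 0 := by
      have : b.div (fun i k => 2 * H i k - b.S V i k) z = 2 * b.div H z - b.div (b.S V) z := by
        simp only [div, map_sub, D_mul, b.D2, sum_sub_distrib, mul_sum, mul_zero, add_zero]
      rw [this, map_sub, map_mul, a5, a8]; ring
    have c4 : e (b.D z (b.U * b.ph V)) = 0 := by
      rw [D_mul, b.DU]; simp [a13, hp]
    simp only [map_add, map_sub, map_mul, map_sum, map_ofNat, c1, c3, c2 (fun i => e (b.div (b.S V) i)) a8, c2 (fun i => e (b.dot (b.S V) i)) a3, c2' (fun k => e (b.D k (b.U * b.ph V))) c4]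
    ring
  have b2 : e (b.X2 V z) = 0 := by
    unfold X2
    rw [map_mul, map_sub, map_add, a3, a13, map_mul (f := e) (b.N * b.p z), map_mul (f := e) b.N, hp]; ring
  have b3 : e (b.X3 (fun i k => H i k - b.S V i k) z) = 0 := by
    unfold X3
    rw [map_mul, map_sum]
    simp only [map_sum, map_mul, map_sub]
    refine mul_eq_zero_of_right _ (sum_eq_zero fun i _ => sum_eq_zero fun k _ => ?_)
    by_cases hk : k = z
    · subst hk
      by_cases hi : i = k
      · subst hi; rw [hp]; ring
      · rw [h5' i, a1' i hi]; ring
    · rw [h5', a1' k hk]; ring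
  rw [b1, b2, b3]; ring
end Bg

namespace SF
variable {n : ℕ}

lemma tang (z : Fin n) (f : SF n) (h : ∀ x : Euc n, x z = 0 → (f : Euc n → ℝ) x = 0) (i : Fin n)
    (hi : i ≠ z) (x : Euc n) (hx : x z = 0) : ev x (De i f) = 0 := by
  rw [ev_De, pd]
  have h1 : HasDerivAt (fun t : ℝ => x + t • (EuclideanSpace.single i (1 : ℝ) : Euc n)) (EuclideanSpace.single i 1) 0 := by
    simpa using ((hasDerivAt_id (0 : ℝ)).smul_const (EuclideanSpace.single i (1 : ℝ) : Euc n)).const_add x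
  have h2 : HasFDerivAt (f : Euc n → ℝ) (fderiv ℝ (f : Euc n → ℝ) x) (x + (0 : ℝ) • (EuclideanSpace.single i (1 : ℝ) : Euc n)) := by
    simpa using (da f x).hasFDerivAt
  have h3 := h2.comp_hasDerivAt (0 : ℝ) h1
  have h4 : ((f : Euc n → ℝ) ∘ fun t : ℝ => x + t • (EuclideanSpace.single i (1 : ℝ) : Euc n)) = fun _ => 0 := by
    funext t
    apply h
    simp [hx, hi.symm]
  rw [h4] at h3
  exact h3.unique (hasDerivAt_const _ _)

lemma half_zero (z : Fin n) (f : SF n) (h : ∀ x : Euc n, 0 ≤ x z → (f : Euc n → ℝ) x = 0) (i : Fin n)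
    (x : Euc n) (hx : 0 ≤ x z) : ev x (De i f) = 0 := by
  have h0 : ∀ y : Euc n, 0 < y z → (De i f : Euc n → ℝ) y = 0 := by
    intro y hy
    have ho : IsOpen {y : Euc n | 0 < y z} := isOpen_lt continuous_const (by fun_prop)
    have : (f : Euc n → ℝ) =ᶠ[nhds y] fun _ => 0 :=
      Filter.eventuallyEq_of_mem (ho.mem_nhds hy) fun w hw => h w (le_of_lt hw)
    change fderiv ℝ (f : Euc n → ℝ) y _ = 0
    rw [this.fderiv_eq]; simp
  have hc : Continuous (De i f : Euc n → ℝ) := (sm (De i f)).continuous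
  have h2 : Filter.Tendsto (fun t : ℝ => (De i f : Euc n → ℝ) (x + t • (EuclideanSpace.single z (1 : ℝ) : Euc n)))
      (nhdsWithin 0 (Set.Ioi 0)) (nhds ((De i f : Euc n → ℝ) x)) := by
    have : Continuous (fun t : ℝ => (De i f : Euc n → ℝ) (x + t • (EuclideanSpace.single z (1 : ℝ) : Euc n))) := by
      fun_prop
    simpa using (this.tendsto 0).mono_left nhdsWithin_le_nhds
  refine tendsto_nhds_unique h2 (Filter.Tendsto.congr' ?_ tendsto_const_nhds)
  filter_upwards [self_mem_nhdsWithin] with t ht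
  rw [h0]
  have : (0:ℝ) < t := ht
  simp; linarith
end SF

theorem Bub.flux_bdry {n : ℕ} (hn : 6 ≤ n) (ε : ℝ) (hε : 0 < ε) (z : Fin n) (V : Fin n → SF n)
    (H : Fin n → Fin n → SF n) (hH : ∀ i k, H i k = H k i)
    (hHz : ∀ x : Euc n, 0 ≤ x z → ∀ i, (H i z : Euc n → ℝ) x = 0)
    (hV : ∀ x : Euc n, x z = 0 → (V z : Euc n → ℝ) x = 0)
    (hV2 : ∀ x : Euc n, x z = 0 → ∀ i, i ≠ z → pd z (V i) x = 0) (x : Euc n) (hx : x z = 0)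
    (hd : SF.ev x ((bub n hn ε hε).div (fun i k => H i k - (bub n hn ε hε).S V i k) z -
      n * (bub n hn ε hε).dot (fun i k => H i k - (bub n hn ε hε).S V i k) z) = 0) :
    SF.ev x ((bub n hn ε hε).Xi V H z) = 0 := by
  refine (bub n hn ε hε).bdry V (by omega) (SF.ev x) z H ?_ (hV x hx) (fun i hi => hV2 x hx i hi) ?_ ?_ ?_ ?_ ?_ ?_ hd
  · rw [ev_p, hx]; simp
  · intro k hk; exact SF.tang z (V z) hV k hk x hx
  · intro i k hi hk
    exact SF.tang z (SF.De z (V i)) (fun y hy => hV2 y hy i hi) k hk x hx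
  · intro k hk
    exact SF.tang z (SF.De k (V z)) (fun y hy => SF.tang z (V z) hV k hk y hy) k hk x hx
  · intro k; rw [hH]; exact hHz x hx.ge k
  · intro k; exact hHz x hx.ge k
  · intro j k; rw [hH]; exact SF.half_zero z (H k z) (fun y hy => hHz y hy k) j x hx.ge


theorem divThm_aux {m : ℕ} (z : Fin (m+1)) (F : Fin (m+1) → SF (m+1)) (R : ℝ) (hR0 : 0 < R)
    (hR : ∀ i x, R ≤ ‖x‖ → (F i : Euc (m+1) → ℝ) x = 0)
    (hz : ∀ x : Euc (m+1), x z = 0 → (F z : Euc (m+1) → ℝ) x = 0) :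
    ∫ x in {x : Euc (m+1) | 0 ≤ x z}, ∑ i, pd i (F i) x = 0 := by
  set a : Fin (m+1) → ℝ := fun i => if i = z then 0 else -(R+1) with ha
  set b : Fin (m+1) → ℝ := fun i => R+1 with hb
  have hab : a ≤ b := by
    intro i; simp only [ha, hb]; split_ifs <;> linarith
  have hco : ∀ (x : Euc (m+1)) (i : Fin (m+1)), |x i| ≤ ‖x‖ := fun x i => PiLp.norm_apply_le x i
  have hgz : ∀ x : Euc (m+1), R < ‖x‖ → ∀ i, pd i (F i) x = 0 := by
    intro x hx i
    have : (F i : Euc (m+1) → ℝ) =ᶠ[nhds x] fun _ => 0 := by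
      have : ∀ᶠ y : Euc (m+1) in nhds x, R < ‖y‖ := (continuous_norm.isOpen_preimage _ isOpen_Ioi).mem_nhds hx
      filter_upwards [this] with y hy using hR i y hy.le
    unfold pd
    rw [this.fderiv_eq]; simp
  have hmp := PiLp.volume_preserving_toLp (Fin (m+1))
  have hgc : Continuous (fun x : Euc (m+1) => ∑ i, pd i (F i) x) :=
    continuous_finsetSum _ fun i _ => (SF.pd_smooth (SF.sm (F i)) i).continuous
  set L : (Fin (m+1) → ℝ) →L[ℝ] Euc (m+1) := ((EuclideanSpace.equiv (Fin (m+1)) ℝ).symm : (Fin (m+1) → ℝ) →L[ℝ] Euc (m+1)) with hL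
  have hLe : ∀ y, L y = WithLp.toLp 2 y := fun y => rfl
  have key := integral_divergence_of_hasFDerivAt_off_countable' a b hab (fun i y => (F i : Euc (m+1) → ℝ) (L y))
    (fun i y => (fderiv ℝ (F i : Euc (m+1) → ℝ) (L y)).comp L) ∅ (by simp)
    (fun i => ((SF.sm (F i)).continuous.comp L.continuous).continuousOn)
    (fun x _ i => ((SF.da (F i) (L x)).hasFDerivAt).comp x L.hasFDerivAt)
    (by
      refine ContinuousOn.integrableOn_compact isCompact_Icc (Continuous.continuousOn ?_)
      have := hgc.comp L.continuous
      exact this)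
  have e1 : ∀ y : Fin (m+1) → ℝ, ∑ i, ((fderiv ℝ (F i : Euc (m+1) → ℝ) (L y)).comp L) (Pi.single i 1)
      = ∑ i, pd i (F i) (WithLp.toLp 2 y) := fun y => rfl
  simp only [e1] at key
  have hrhs : ∀ i : Fin (m+1), ∀ c : ℝ, (R+1 ≤ |c| ∨ (i = z ∧ c = 0)) → ∀ y : Fin m → ℝ,
      (F i : Euc (m+1) → ℝ) (L (i.insertNth c y)) = 0 := by
    intro i c hc y
    have hc' : (L (i.insertNth c y)) i = c := by simp [hLe]
    rcases hc with hc | ⟨rfl, rfl⟩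
    · apply hR
      have := hco (L (i.insertNth c y)) i
      rw [hc'] at this; linarith
    · exact hz _ hc'
  rw [sum_eq_zero] at key
  · have h2 := hmp.setIntegral_preimage_emb (MeasurableEquiv.toLp 2 (Fin (m+1) → ℝ)).measurableEmbedding
      (fun x : Euc (m+1) => ∑ i, pd i (F i) x) ((WithLp.ofLp) ⁻¹' (Set.Icc a b))
    have h3 : (WithLp.toLp 2) ⁻¹' ((WithLp.ofLp : Euc (m+1) → _) ⁻¹' (Set.Icc a b)) = Set.Icc a b := rfl
    rw [h3, key] at h2
    refine Eq.trans ?_ h2.symm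
    refine (setIntegral_eq_of_subset_of_forall_sdiff_eq_zero ?_ ?_ ?_)
    · exact measurableSet_le measurable_const (by fun_prop)
    · intro x hx
      have := hx.1 z
      simpa [ha] using this
    · intro x hx
      refine sum_eq_zero fun i _ => hgz x ?_ i
      by_contra hcon
      push Not at hcon
      refine hx.2 ⟨fun j => ?_, fun j => ?_⟩
      · have := (abs_le.mp (hco x j)).1
        simp only [ha]; split_ifs with h
        · rw [h]; exact hx.1
        · linarith
      · have := (abs_le.mp (hco x j)).2
        simp only [hb]; linarith
  · intro i _
    have hR1 : R + 1 ≤ |b i| := by simp only [hb]; exact le_abs_self _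
    have hR2 : R + 1 ≤ |a i| ∨ (i = z ∧ a i = 0) := by
      simp only [ha]; split_ifs with h
      · right; exact ⟨h, rfl⟩
      · left; rw [abs_neg]; exact le_abs_self _
    simp [hrhs i _ (Or.inl hR1), hrhs i _ hR2]

theorem divThm {n : ℕ} (z : Fin n) (F : Fin n → SF n) (R : ℝ) (hR0 : 0 < R)
    (hR : ∀ i x, R ≤ ‖x‖ → (F i : Euc n → ℝ) x = 0)
    (hz : ∀ x : Euc n, x z = 0 → (F z : Euc n → ℝ) x = 0) :
    ∫ x in {x : Euc n | 0 ≤ x z}, ∑ i, pd i (F i) x = 0 := by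
  obtain ⟨m, rfl⟩ : ∃ m, n = m + 1 := ⟨n - 1, by have := z.2; omega⟩
  exact divThm_aux z F R hR0 hR hz


/-- data for pointwise bounds -/
structure Par (n : ℕ) where
  ε : ℝ
  hε : 0 < ε
  δ : ℝ
  hδ : 0 < δ
  hεδ : 2 * ε ≤ δ
  M : ℝ
  x : Euc n
  hx : δ / 2 ≤ ‖x‖
  V : Fin n → SF n
  H : Fin n → Fin n → SF n
  H0 : ∀ i k, |SF.ev x (H i k)| ≤ M
  H1 : ∀ i k l, |SF.ev x (SF.De l (H i k))| ≤ M * δ ^ (-1 : ℤ)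
  H2 : ∀ i k l m, |SF.ev x (SF.De m (SF.De l (H i k)))| ≤ M * δ ^ (-2 : ℤ)
  V0 : ∀ i, |SF.ev x (V i)| ≤ M * δ
  V1 : ∀ i l, |SF.ev x (SF.De l (V i))| ≤ M
  V2 : ∀ i l m, |SF.ev x (SF.De m (SF.De l (V i)))| ≤ M * δ ^ (-1 : ℤ)

namespace Par
variable {n : ℕ} (hn : 6 ≤ n)

def b (P : Par n) : Bg n (SF n) := bub n hn P.ε P.hε

def bo (a : ℕ) (k : ℤ) (c : ℕ) (f : Par n → SF n) : Prop :=
  (fun P : Par n => SF.ev P.x (f P)) =O[⊤] fun P => P.M ^ a * P.δ ^ k * (SF.ev P.x (P.b hn).U) ^ c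

variable {hn}
variable {a a' a'' : ℕ} {k k' k'' : ℤ} {c c' c'' : ℕ} {f g : Par n → SF n}

lemma bo.mul (hf : bo hn a k c f) (hg : bo hn a' k' c' g) (ha : a + a' = a'' := by rfl)
    (hk : k + k' = k'' := by rfl) (hc : c + c' = c'' := by rfl) :
    bo hn a'' k'' c'' (fun P => f P * g P) := by
  subst ha hk hc
  have := Asymptotics.IsBigO.mul hf hg
  unfold bo
  simp only [map_mul]
  refine this.congr_right fun P => ?_
  rw [zpow_add₀ P.hδ.ne', pow_add, pow_add]; ring

lemma bo.add (hf : bo hn a k c f) (hg : bo hn a k c g) : bo hn a k c (fun P => f P + g P) := by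
  unfold bo
  simp only [map_add]
  exact Asymptotics.IsBigO.add hf hg

lemma bo.sub (hf : bo hn a k c f) (hg : bo hn a k c g) : bo hn a k c (fun P => f P - g P) := by
  unfold bo
  simp only [map_sub]
  exact Asymptotics.IsBigO.sub hf hg

lemma bo.neg (hf : bo hn a k c f) : bo hn a k c (fun P => - f P) := by
  unfold bo
  simp only [map_neg]
  exact Asymptotics.IsBigO.neg_left hf

lemma bo.sum {F : Fin n → Par n → SF n} (hf : ∀ i, bo hn a k c (F i)) : bo hn a k c (fun P => ∑ i, F i P) := by
  unfold bo
  simp only [map_sum]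
  exact Asymptotics.IsBigO.fun_sum fun i _ => hf i

lemma bo.zero : bo hn a k c (fun _ => 0) := by
  unfold bo
  simp only [map_zero]
  exact Asymptotics.isBigO_zero _ _

lemma bo.ite {p : Prop} [Decidable p] (hf : bo hn a k c f) : bo hn a k c (fun P => if p then f P else 0) := by
  split_ifs
  · exact hf
  · exact bo.zero

lemma bo.sq (hf : bo hn a k c f) (ha : a + a = a'' := by rfl)
    (hk : k + k = k'' := by rfl) (hc : c + c = c'' := by rfl) : bo hn a'' k'' c'' (fun P => f P ^ 2) := by
  simp only [pow_two]
  exact hf.mul hf ha hk hc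

lemma bo.const (r : ℝ) (hf : ∀ P, SF.ev P.x (f P) = r) : bo hn 0 0 0 f := by
  unfold bo
  simp only [hf, pow_zero, zpow_zero, mul_one]
  exact Asymptotics.isBigO_const_const _ one_ne_zero _

lemma bo.of_le (C : ℝ) (h : ∀ P : Par n, |SF.ev P.x (f P)| ≤ C * (P.M ^ a * P.δ ^ k * (SF.ev P.x (P.b hn).U) ^ c)) :
    bo hn a k c f := by
  unfold bo
  rw [Asymptotics.isBigO_top]
  refine ⟨|C|, fun P => (h P).trans ?_⟩
  rw [Real.norm_eq_abs, ← abs_mul]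
  exact le_abs_self _

lemma bo.num (m : ℕ) [m.AtLeastTwo] : bo hn 0 0 0 (fun _ => (OfNat.ofNat m : SF n)) :=
  bo.const (OfNat.ofNat m) fun _ => map_ofNat _ m
lemma bo.one : bo hn 0 0 0 (fun _ => (1 : SF n)) := bo.const 1 fun _ => map_one _
lemma bo.nat (m : ℕ) : bo hn 0 0 0 (fun _ => (m : SF n)) := bo.const m fun _ => map_natCast _ m
lemma bo.N : bo hn 0 0 0 (fun P => (P.b hn).N) := bo.const (((n : ℝ) - 2) / 2) fun _ => rfl
lemma bo.ν : bo hn 0 0 0 (fun P => (P.b hn).ν) := bo.const (1 / n) fun _ => rfl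
lemma bo.U : bo hn 0 0 1 (fun P => (P.b hn).U) := by
  unfold bo; simp only [pow_zero, zpow_zero, one_mul, pow_one]; exact Asymptotics.isBigO_refl _ _

lemma rb (P : Par n) : 1 / (P.ε ^ 2 + ‖P.x‖ ^ 2) ≤ 4 * P.δ ^ (-2 : ℤ) := by
  have h := P.hδ
  have hx := P.hx
  rw [zpow_neg, ← div_eq_mul_inv, div_le_div_iff₀ (by have := P.hε; positivity) (by positivity)]
  have := P.hε
  have e : P.δ ^ (2:ℤ) = P.δ ^ 2 := by norm_cast
  rw [e]
  nlinarith [sq_nonneg P.ε]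

lemma bo.κs : bo hn 0 (-2) 0 (fun P => (P.b hn).κ * (P.b hn).s) := by
  refine bo.of_le 8 fun P => ?_
  have hε := P.hε
  have : SF.ev P.x ((P.b hn).κ * (P.b hn).s) = 2 * (1 / (P.ε ^ 2 + ‖P.x‖ ^ 2)) := by
    rw [map_mul, b, Bub.ev_s]
    change 2 / P.ε * _ = _
    field_simp
  rw [this, abs_of_nonneg (by positivity)]
  have := P.rb
  simp only [pow_zero, one_mul, mul_one]
  linarith

lemma bo.s : bo hn 0 (-1) 0 (fun P => (P.b hn).s) := by
  refine bo.of_le 4 fun P => ?_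
  have hε := P.hε
  have hδ := P.hδ
  have : SF.ev P.x ((P.b hn).s) = P.ε * (1 / (P.ε ^ 2 + ‖P.x‖ ^ 2)) := by
    rw [b, Bub.ev_s]; ring
  rw [this, abs_of_nonneg (by positivity)]
  have := P.rb
  simp only [pow_zero, one_mul, mul_one]
  have h2 : P.δ * P.δ ^ (-2 : ℤ) = P.δ ^ (-1 : ℤ) := by
    rw [← zpow_one_add₀ hδ.ne']; norm_num
  rw [← h2]
  have := P.hεδ
  calc _ ≤ P.δ * (4 * P.δ ^ (-2 : ℤ)) := by gcongr; linarith
    _ = _ := by ring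

lemma bo.p (i : Fin n) : bo hn 0 (-1) 0 (fun P => (P.b hn).p i) := by
  refine bo.of_le 4 fun P => ?_
  have hε := P.hε
  have hδ := P.hδ
  have hx := P.hx
  have : SF.ev P.x ((P.b hn).p i) = 2 * P.x i * (1 / (P.ε ^ 2 + ‖P.x‖ ^ 2)) := by
    rw [b, Bub.ev_p]; ring
  have hxp : 0 < ‖P.x‖ := by linarith
  rw [this, abs_mul, abs_mul, abs_two, abs_of_nonneg (a := 1 / (P.ε ^ 2 + ‖P.x‖ ^ 2)) (by positivity)]
  simp only [pow_zero, one_mul, mul_one]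
  have h1 : |P.x i| ≤ ‖P.x‖ := PiLp.norm_apply_le P.x i
  calc 2 * |P.x i| * (1 / (P.ε ^ 2 + ‖P.x‖ ^ 2)) ≤ 2 * ‖P.x‖ * (1 / (0 + ‖P.x‖ ^ 2)) := by gcongr; positivity
    _ = 2 * (1 / ‖P.x‖) := by field_simp; simp
    _ ≤ 2 * (1 / (P.δ / 2)) := by gcongr
    _ = _ := by rw [zpow_neg_one]; field_simp; norm_num

variable (i j l m : Fin n)
lemma bo.H : bo hn 1 0 0 (fun P => P.H i j) := bo.of_le 1 fun P => by simpa using P.H0 i j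
lemma bo.DH : bo hn 1 (-1) 0 (fun P => (P.b hn).D l (P.H i j)) := bo.of_le 1 fun P => by simpa [b, bub] using P.H1 i j l
lemma bo.DDH : bo hn 1 (-2) 0 (fun P => (P.b hn).D m ((P.b hn).D l (P.H i j))) := bo.of_le 1 fun P => by
  simpa [b, bub] using P.H2 i j l m
lemma bo.V : bo hn 1 1 0 (fun P => P.V i) := bo.of_le 1 fun P => by simpa using P.V0 i
lemma bo.DV : bo hn 1 0 0 (fun P => (P.b hn).D l (P.V i)) := bo.of_le 1 fun P => by simpa [b, bub] using P.V1 i l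
lemma bo.DDV : bo hn 1 (-1) 0 (fun P => (P.b hn).D m ((P.b hn).D l (P.V i))) := bo.of_le 1 fun P => by
  simpa [b, bub] using P.V2 i l m

lemma bo.th : bo hn 1 0 0 (fun P => (P.b hn).th P.V) := bo.sum fun i => bo.DV i i
lemma bo.Dth : bo hn 1 (-1) 0 (fun P => (P.b hn).D l ((P.b hn).th P.V)) := by
  simp only [Bg.th, map_sum]
  exact bo.sum fun i => bo.DDV i i l
lemma bo.S : bo hn 1 0 0 (fun P => (P.b hn).S P.V i j) :=
  ((bo.DV j i).add (bo.DV i j)).sub (bo.ite (((bo.num 2).mul bo.ν).mul bo.th))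
lemma bo.DS : bo hn 1 (-1) 0 (fun P => (P.b hn).D l ((P.b hn).S P.V i j)) := by
  simp only [Bg.D_S]
  exact ((bo.DDV j i l).add (bo.DDV i j l)).sub (bo.ite (((bo.num 2).mul bo.ν).mul (bo.Dth l)))
lemma bo.pV : bo hn 1 0 0 (fun P => (P.b hn).pV P.V) := bo.sum fun i => (bo.p i).mul (bo.V i)
lemma bo.gg : bo hn 1 (-1) 0 (fun P => (P.b hn).g P.V i) := bo.sum fun l => (bo.p l).mul (bo.DV l i)
lemma bo.ph : bo hn 1 0 0 (fun P => (P.b hn).ph P.V) := (bo.ν.mul bo.th).sub bo.pV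
lemma bo.Dph : bo hn 1 (-1) 0 (fun P => (P.b hn).D l ((P.b hn).ph P.V)) := by
  simp only [Bg.D_ph]
  exact (bo.ν.mul (bo.Dth l)).sub (((bo.κs.mul (bo.V l)).sub ((bo.p l).mul bo.pV)).add (bo.gg l))
lemma bo.DUph : bo hn 1 (-1) 1 (fun P => (P.b hn).D l ((P.b hn).U * (P.b hn).ph P.V)) := by
  simp only [Bg.D_mul, Bg.DU]
  exact (bo.U.mul (bo.Dph l)).add (bo.ph.mul ((((bo.num 2).mul bo.N).mul (bo.p l)).mul bo.U).neg)

lemma bo.div {G : Par n → Fin n → Fin n → SF n} (h : ∀ i j l, bo hn a k c (fun P => (P.b hn).D l (G P i j))) :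
    bo hn a k c (fun P => (P.b hn).div (G P) i) := bo.sum fun l => h i l l
lemma bo.dot {G : Par n → Fin n → Fin n → SF n} (h : ∀ i j, bo hn a k c (fun P => G P i j))
    (hk : -1 + k = k' := by rfl) :
    bo hn a k' c (fun P => (P.b hn).dot (G P) i) := bo.sum fun l => (bo.p l).mul (h i l) (by simp) hk (by simp)

lemma bo.q : bo hn 1 (-1) 0 (fun P => (P.b hn).D i ((P.b hn).ph P.V) - (P.b hn).N * (P.b hn).p i * (P.b hn).ph P.V) :=
  (bo.Dph i).sub ((bo.N.mul (bo.p i)).mul bo.ph)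

lemma bo.DdivH : bo hn 1 (-2) 0 (fun P => (P.b hn).D l ((P.b hn).div P.H i)) := by
  simp only [Bg.div, map_sum]
  exact bo.sum fun j => bo.DDH i j j l

lemma bo.c2N : bo hn 0 0 0 (fun P => 2 * (P.b hn).N + 1) := ((bo.num 2).mul bo.N).add bo.one

theorem bo.E4 : bo hn 2 (-2) 1 (fun P => (P.b hn).E4 P.V P.H) := by
  unfold Bg.E4
  have dv : ∀ i, bo hn 1 (-1) 0 (fun P => (P.b hn).div P.H i) := fun i => bo.div i (fun i j l => bo.DH i j l)
  have dt : ∀ i, bo hn 1 (-1) 0 (fun P => (P.b hn).dot P.H i) := fun i => bo.dot i (fun i j => bo.H i j)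
  refine bo.U.mul (a' := 2) (k' := -2) (c' := 0) ?_
  refine bo.add (bo.sub (bo.sub (bo.sub (bo.sub (bo.add (bo.sub ?_ ?_) ?_) ?_) ?_) ?_) ?_) ?_
  · exact bo.sum fun i => bo.sum fun j => bo.sum fun l => (bo.DH i j l).mul (bo.DH i j l)
  · exact (bo.num 2).mul (bo.sum fun i => (dv i).mul (dv i) (a'' := 2) (k'' := -2) (c'' := 0))
  · exact ((bo.num 8).mul bo.N).mul (bo.sum fun i => (dt i).mul (dv i) (a'' := 2) (k'' := -2) (c'' := 0))
  · exact (((bo.num 4).mul bo.c2N).mul bo.N).mul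
      (bo.sum fun i => (dt i).mul (dt i) (a'' := 2) (k'' := -2) (c'' := 0))
  · exact (((bo.num 8).mul bo.N).mul bo.ph).mul (bo.sum fun i => bo.DdivH i i)
  · exact (((bo.num 16).mul bo.c2N).mul bo.N).mul
      (bo.sum fun i => bo.sum fun j => ((bo.p i).mul (bo.q j)).mul (bo.H i j) (a'' := 2) (k'' := -2) (c'' := 0))
  · exact (((bo.num 8).mul bo.c2N).mul bo.N).mul
      (bo.sum fun i => (bo.q i).sq (a'' := 2) (k'' := -2) (c'' := 0))
  · exact ((((((bo.num 8).mul bo.c2N).mul bo.N).mul (bo.nat n)).mul ((bo.nat n).add (bo.num 2))).mul bo.s.sq).mul bo.ph.sq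

theorem bo.Xi : bo hn 2 (-1) 1 (fun P => (P.b hn).Xi P.V P.H l) := by
  unfold Bg.Xi
  have hG : ∀ i j, bo hn 1 0 0 (fun P => 2 * P.H i j - (P.b hn).S P.V i j) := fun i j =>
    ((bo.num 2).mul (bo.H i j)).sub (bo.S i j)
  have hDG : ∀ i j l, bo hn 1 (-1) 0 (fun P => (P.b hn).D l (2 * P.H i j - (P.b hn).S P.V i j)) := fun i j l => by
    simp only [map_sub, Bg.D_mul, Bg.D2, mul_zero, add_zero]
    exact ((bo.num 2).mul (bo.DH i j l)).sub (bo.DS i j l)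
  have dS : ∀ i, bo hn 1 (-1) 0 (fun P => (P.b hn).div ((P.b hn).S P.V) i) := fun i => bo.div i (fun i j l => bo.DS i j l)
  have dtS : ∀ i, bo hn 1 (-1) 0 (fun P => (P.b hn).dot ((P.b hn).S P.V) i) := fun i => bo.dot i (fun i j => bo.S i j)
  have hT : ∀ i j, bo hn 1 0 0 (fun P => P.H i j - (P.b hn).S P.V i j) := fun i j => (bo.H i j).sub (bo.S i j)
  refine bo.sub (bo.add ?_ ((bo.num 4).mul (a' := 2) (k' := -1) (c' := 1) ?_)) ((bo.num 4).mul (a' := 2) (k' := -1) (c' := 1) ?_)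
  · unfold Bg.X1
    refine bo.add (bo.sub (bo.add (bo.sub ?_ ?_) ?_) ?_) ?_
    · exact bo.U.mul (bo.sum fun i => bo.sum fun j => (hG i j).mul (bo.DS i j l) (a'' := 2) (k'' := -1) (c'' := 0))
    · exact ((bo.num 2).mul bo.U).mul (bo.sum fun i => (dS i).mul (hG i l) (a'' := 2) (k'' := -1) (c'' := 0))
    · exact (((bo.num 4).mul bo.N).mul bo.U).mul (bo.sum fun i => (dtS i).mul (hG i l) (a'' := 2) (k'' := -1) (c'' := 0))
    · exact ((((bo.num 4).mul bo.N).mul bo.U).mul bo.ph).mul (bo.div l hDG)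
    · exact ((bo.num 4).mul bo.N).mul (bo.sum fun j => (bo.DUph j).mul (hG l j) (a'' := 2) (k'' := -1) (c'' := 1))
  · unfold Bg.X2
    exact (((((bo.num 2).neg.mul bo.c2N).mul bo.N).mul bo.U).mul bo.ph).mul
      (((dtS l).add (bo.Dph l)).sub ((bo.N.mul (bo.p l)).mul bo.ph))
  · unfold Bg.X3
    exact bo.U.mul (bo.sum fun i => bo.sum fun j => ((bo.p i).mul (hT j l)).mul (hT i j) (a'' := 2) (k'' := -1) (c'' := 0))

lemma U_pos (P : Par n) : 0 < SF.ev P.x (P.b hn).U := by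
  rw [b, Bub.ev_U]; have := P.hε; positivity

theorem bounds (hn : 6 ≤ n) : ∃ C : ℝ, 0 < C ∧ ∀ P : Par n,
    |SF.ev P.x ((P.b hn).E4 P.V P.H)| ≤ C * (P.M ^ 2 * P.δ ^ (-2 : ℤ) * SF.ev P.x (P.b hn).U) ∧
    ∀ l, |SF.ev P.x ((P.b hn).Xi P.V P.H l)| ≤ C * (P.M ^ 2 * P.δ ^ (-1 : ℤ) * SF.ev P.x (P.b hn).U) := by
  have h1 := bo.E4 (hn := hn)
  have h2 := fun l => bo.Xi (hn := hn) l
  unfold bo at h1 h2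
  simp only [Asymptotics.isBigO_top] at h1 h2
  obtain ⟨c, hc⟩ := h1
  choose c' hc' using h2
  have hU := fun P : Par n => U_pos (hn := hn) P
  refine ⟨|c| + ∑ l, |c' l| + 1, by positivity, fun P => ⟨(hc P).trans ?_, fun l => (hc' l P).trans ?_⟩⟩
  · have hδ := P.hδ
    have := hU P
    rw [Real.norm_eq_abs, abs_of_nonneg (by positivity), pow_one]
    gcongr
    have : 0 ≤ ∑ l, |c' l| := by positivity
    have := le_abs_self c
    linarith
  · have hδ := P.hδ
    have := hU P
    rw [Real.norm_eq_abs, abs_of_nonneg (by positivity), pow_one]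
    gcongr
    have h1 : |c' l| ≤ ∑ l, |c' l| := single_le_sum (f := fun l => |c' l|) (fun _ _ => abs_nonneg _) (mem_univ l)
    have := le_abs_self (c' l)
    have := abs_nonneg c
    linarith
end Par


/-- half ball -/
abbrev hB {n : ℕ} (z : Fin n) (r : ℝ) : Set (Euc n) := ball (0 : Euc n) r ∩ {x : Euc n | 0 ≤ x z}

lemma hB_meas {n : ℕ} (z : Fin n) (r : ℝ) : MeasurableSet (hB z r) :=
  measurableSet_ball.inter (measurableSet_le measurable_const (by fun_prop))

lemma hB_int {n : ℕ} (z : Fin n) (r : ℝ) (f : Euc n → ℝ) (hf : Continuous f) : IntegrableOn f (hB z r) :=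
  ((hf.continuousOn.integrableOn_compact (isCompact_closedBall 0 r)).mono_set ball_subset_closedBall).mono_set
    Set.inter_subset_left

lemma SF.ev_cont {n : ℕ} (f : SF n) : Continuous (fun x => SF.ev x f) := (SF.sm f).continuous

lemma cutoff (n : ℕ) : ∃ K : ℝ, 0 < K ∧ ∀ δ : ℝ, 0 < δ → ∃ η : SF n,
   (∀ x, 0 ≤ SF.ev x η ∧ SF.ev x η ≤ 1) ∧ (∀ x : Euc n, 3 / 4 * δ ≤ ‖x‖ → SF.ev x η = 0) ∧
   (∀ x : Euc n, ‖x‖ < δ / 2 → SF.ev x η = 1 ∧ ∀ i, SF.ev x (SF.De i η) = 0) ∧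
   ∀ i x, |SF.ev x (SF.De i η)| ≤ K * δ⁻¹ := by
  let ψ : ContDiffBump (0 : Euc n) := ⟨1/2, 3/4, by norm_num, by norm_num⟩
  have hc : Continuous (fderiv ℝ ψ) := (ψ.contDiff (n := 1)).continuous_fderiv (by simp)
  have hcs : HasCompactSupport (fderiv ℝ ψ) := ψ.hasCompactSupport.fderiv ℝ
  obtain ⟨K, hK⟩ := hcs.exists_bound_of_continuous hc
  have hK0 : 0 ≤ K := (norm_nonneg _).trans (hK 0)
  refine ⟨K + 1, by positivity, fun δ hδ => ?_⟩
  have hsm : ContDiff ℝ (⊤ : ℕ∞) (fun x : Euc n => ψ (δ⁻¹ • x)) :=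
    ψ.contDiff.comp (contDiff_const_smul δ⁻¹)
  have hnorm : ∀ x : Euc n, dist (δ⁻¹ • x) 0 = δ⁻¹ * ‖x‖ := fun x => by
    rw [dist_zero_right, norm_smul, Real.norm_of_nonneg (by positivity)]
  refine ⟨⟨fun x => ψ (δ⁻¹ • x), hsm⟩, fun x => ⟨ψ.nonneg, ψ.le_one⟩, fun x hx => ?_, fun x hx => ⟨?_, fun i => ?_⟩, fun i x => ?_⟩
  · refine ψ.zero_of_le_dist ?_
    rw [hnorm]
    change 3 / 4 ≤ _
    rw [inv_mul_eq_div, le_div_iff₀ hδ]; exact hx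
  · refine ψ.one_of_mem_closedBall ?_
    rw [mem_closedBall, hnorm]
    change _ ≤ 1 / 2
    rw [inv_mul_eq_div, div_le_iff₀ hδ]; linarith
  · have : (fun x : Euc n => ψ (δ⁻¹ • x)) =ᶠ[nhds x] fun _ => 1 := by
      have : ∀ᶠ y : Euc n in nhds x, ‖y‖ < δ / 2 := (continuous_norm.isOpen_preimage _ isOpen_Iio).mem_nhds hx
      filter_upwards [this] with y hy
      refine ψ.one_of_mem_closedBall ?_
      rw [mem_closedBall, hnorm]
      change _ ≤ 1 / 2
      rw [inv_mul_eq_div, div_le_iff₀ hδ]; linarith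
    change fderiv ℝ (fun x : Euc n => ψ (δ⁻¹ • x)) x _ = 0
    rw [this.fderiv_eq]; simp
  · change |fderiv ℝ (fun x : Euc n => ψ (δ⁻¹ • x)) x _| ≤ _
    rw [fderiv_comp_smul (f := ψ)]
    have h1 : ‖fderiv ℝ ψ (δ⁻¹ • x) (EuclideanSpace.single i 1)‖ ≤ K * 1 := by
      refine (ContinuousLinearMap.le_opNorm _ _).trans ?_
      gcongr
      · exact hK _
      · simp
    rw [_root_.smul_apply, smul_eq_mul, abs_mul, abs_of_pos (inv_pos.mpr hδ), mul_comm]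
    rw [Real.norm_eq_abs] at h1
    gcongr
    linarith

set_option maxHeartbeats 1000000 in
theorem energy (n : ℕ) (hn : 6 ≤ n) (z : Fin n) : ∃ C : ℝ, 0 < C ∧
    ∀ (ε : ℝ) (hε : 0 < ε) (δ : ℝ) (_ : 2 * ε ≤ δ) (M : ℝ) (V : Fin n → SF n) (H : Fin n → Fin n → SF n),
      (∀ i k, H i k = H k i) → (∑ i, H i i = 0) →
      (∀ x : Euc n, 0 ≤ x z → ∀ i, SF.ev x (H i z) = 0) →
      (∀ x : Euc n, x z = 0 → SF.ev x (V z) = 0) →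
      (∀ x : Euc n, x z = 0 → ∀ i, i ≠ z → pd z (V i) x = 0) →
      (∀ x ∈ hB z δ, ∀ i, SF.ev x ((bub n hn ε hε).div (fun i k => H i k - (bub n hn ε hε).S V i k) i -
        n * (bub n hn ε hε).dot (fun i k => H i k - (bub n hn ε hε).S V i k) i) = 0) →
      (∀ x ∈ hB z δ, δ / 2 ≤ ‖x‖ →
        (∀ i k, |SF.ev x (H i k)| ≤ M) ∧ (∀ i k l, |SF.ev x (SF.De l (H i k))| ≤ M * δ ^ (-1 : ℤ)) ∧
        (∀ i k l m, |SF.ev x (SF.De m (SF.De l (H i k)))| ≤ M * δ ^ (-2 : ℤ)) ∧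
        (∀ i, |SF.ev x (V i)| ≤ M * δ) ∧ (∀ i l, |SF.ev x (SF.De l (V i))| ≤ M) ∧
        (∀ i l m, |SF.ev x (SF.De m (SF.De l (V i)))| ≤ M * δ ^ (-1 : ℤ))) →
      (∫ x in hB z (δ / 2), (1 / 4) * SF.ev x ((bub n hn ε hε).U * (∑ i, ∑ k, ∑ l, ((bub n hn ε hε).Qt
          (fun i k => H i k - (bub n hn ε hε).S V i k) i k l) ^ 2)))
        - C * (M ^ 2 * δ ^ (-2 : ℤ) * (ε / δ ^ 2) ^ (n - 2) * δ ^ n)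
      ≤ ∫ x in hB z δ, (1 / 4) * SF.ev x ((bub n hn ε hε).E4 V H) := by
  obtain ⟨C0, hC0, hB0⟩ := Par.bounds hn
  obtain ⟨K, hK, hcut⟩ := cutoff n
  set v := (volume (ball (0 : Euc n) 1)).toReal with hv
  set C1 := (C0 + n * C0 * K) * 4 ^ (n - 2) with hC1
  have hC1p : 0 < C1 := by positivity
  refine ⟨C1 * v + 1, by positivity, ?_⟩
  intro ε hε δ hεδ M V H hH hH0 hHz hV hV2 hdiv hbd
  have hδ : 0 < δ := by linarith
  obtain ⟨η, hη01, hη0, hη1, hηK⟩ := hcut δ hδ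
  set b := bub n hn ε hε with hb
  set Q := b.U * (∑ i, ∑ k, ∑ l, (b.Qt (fun i k => H i k - b.S V i k) i k l) ^ 2) with hQ
  set W := 8 * b.U * b.s ^ 2 * (∑ i, ∑ k, (H i k - b.S V i k) * (H i k - b.S V i k)) with hW
  set F : Fin n → SF n := fun l => η * b.Xi V H l with hF
  have hU : ∀ x, 0 < SF.ev x b.U := fun x => by rw [hb, Bub.ev_U]; positivity
  have hQ0 : ∀ x, 0 ≤ SF.ev x Q := fun x => by
    rw [hQ, map_mul]; simp only [map_sum, map_pow]
    have := hU x; positivity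
  have hW0 : ∀ x, 0 ≤ SF.ev x W := fun x => by
    rw [hW, map_mul, map_mul, map_mul, map_pow]; simp only [map_sum, map_mul, map_ofNat]
    have := hU x
    have : 0 ≤ ∑ i, ∑ k, SF.ev x (H i k - b.S V i k) * SF.ev x (H i k - b.S V i k) :=
      sum_nonneg fun i _ => sum_nonneg fun k _ => mul_self_nonneg _
    positivity
  have htot : ∀ x ∈ hB z δ, SF.ev x (b.E4 V H) = SF.ev x Q + SF.ev x W + ∑ l, SF.ev x (b.D l (b.Xi V H l)) := by
    intro x hx
    have h := congrArg (SF.ev x) (b.total V H hH hH0)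
    have h3 : SF.ev x (2 * b.U * (∑ i, (b.div (fun i k => H i k - b.S V i k) i - n * b.dot (fun i k => H i k - b.S V i k) i) ^ 2)) = 0 := by
      rw [map_mul, map_sum]
      simp only [map_pow, hdiv x hx]
      simp
    rw [map_mul, map_mul, map_add, map_sub, map_add, h3, map_ofNat, map_sum] at h
    linarith
  have hdF : ∀ x l, SF.ev x (b.D l (F l)) = SF.ev x η * SF.ev x (b.D l (b.Xi V H l)) +
      SF.ev x (b.Xi V H l) * SF.ev x (SF.De l η) := by
    intro x l
    rw [hF]; simp only [b.D_mul, map_add, map_mul]; rfl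
  have hflux : ∫ x in hB z δ, ∑ l, SF.ev x (b.D l (F l)) = 0 := by
    have h := divThm z F (3 / 4 * δ) (by positivity) (fun i x hx => by
        change SF.ev x (η * _) = 0
        rw [map_mul, hη0 x hx, zero_mul]) (fun x hx => by
        change SF.ev x (η * _) = 0
        rw [map_mul]
        by_cases hxd : 3 / 4 * δ ≤ ‖x‖
        · rw [hη0 x hxd, zero_mul]
        · rw [Bub.flux_bdry hn ε hε z V H hH hHz hV hV2 x hx, mul_zero]
          refine hdiv x ⟨?_, hx.ge⟩ z
          rw [mem_ball_zero_iff]; push Not at hxd; linarith)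
    rw [← h]
    symm
    refine setIntegral_eq_of_subset_of_forall_sdiff_eq_zero ?_ Set.inter_subset_right ?_
    · exact measurableSet_le measurable_const (by fun_prop)
    · intro x hx
      have hxδ : δ ≤ ‖x‖ := by
        by_contra hcon
        push Not at hcon
        exact hx.2 ⟨by rwa [mem_ball_zero_iff], hx.1⟩
      refine sum_eq_zero fun i _ => ?_
      have : (F i : Euc n → ℝ) =ᶠ[nhds x] fun _ => 0 := by
        have : ∀ᶠ y : Euc n in nhds x, 3 / 4 * δ < ‖y‖ :=
          (continuous_norm.isOpen_preimage _ isOpen_Ioi).mem_nhds (by simp only [Set.mem_preimage, Set.mem_Ioi]; linarith)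
        filter_upwards [this] with y hy
        change SF.ev y (η * _) = 0
        rw [map_mul, hη0 y hy.le, zero_mul]
      unfold pd
      rw [this.fderiv_eq]; simp
  set e0 := C1 * (M ^ 2 * δ ^ (-2 : ℤ) * (ε / δ ^ 2) ^ (n - 2)) with he0
  have he0p : 0 ≤ e0 := by positivity
  have hpt : ∀ x ∈ hB z δ, (ball (0 : Euc n) (δ / 2)).indicator (fun x => (1 / 4) * SF.ev x Q) x +
      (1 / 4) * (∑ l, SF.ev x (b.D l (F l))) - e0 ≤ (1 / 4) * SF.ev x (b.E4 V H) := by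
    intro x hx
    have h1 := htot x hx
    have h2 : ∑ l, SF.ev x (b.D l (F l)) = SF.ev x η * ∑ l, SF.ev x (b.D l (b.Xi V H l)) +
      ∑ l, SF.ev x (b.Xi V H l) * SF.ev x (SF.De l η) := by
      simp only [hdF, sum_add_distrib, mul_sum]
    rw [h2]
    by_cases hxs : ‖x‖ < δ / 2
    · rw [Set.indicator_of_mem (by rwa [mem_ball_zero_iff])]
      obtain ⟨g1, g2⟩ := hη1 x hxs
      simp only [g1, g2, mul_zero, sum_const_zero, add_zero, one_mul]
      rw [h1]
      have := hW0 x
      linarith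
    · rw [Set.indicator_of_notMem (by rwa [mem_ball_zero_iff])]
      push Not at hxs
      obtain ⟨k1, k2, k3, k4, k5, k6⟩ := hbd x hx hxs
      obtain ⟨m1, m2⟩ := hB0 ⟨ε, hε, δ, hδ, hεδ, M, x, hxs, V, H, k1, k2, k3, k4, k5, k6⟩
      change |SF.ev x (b.E4 V H)| ≤ C0 * (M ^ 2 * δ ^ (-2 : ℤ) * SF.ev x b.U) at m1
      change ∀ l, |SF.ev x (b.Xi V H l)| ≤ C0 * (M ^ 2 * δ ^ (-1 : ℤ) * SF.ev x b.U) at m2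
      have hUb : SF.ev x b.U ≤ 4 ^ (n - 2) * (ε / δ ^ 2) ^ (n - 2) := by
        rw [hb, Bub.ev_U, ← mul_pow]
        gcongr
        rw [mul_div_assoc', div_le_div_iff₀ (by positivity) (by positivity)]
        nlinarith [sq_nonneg ε, mul_pos hε hε, mul_self_le_mul_self (by positivity) hxs]
      have n1 : |∑ l, SF.ev x (b.Xi V H l) * SF.ev x (SF.De l η)| ≤ n * C0 * K * (M ^ 2 * δ ^ (-2 : ℤ) * SF.ev x b.U) := by
        refine (Finset.abs_sum_le_sum_abs _ _).trans ?_
        have : ∀ l ∈ Finset.univ, |SF.ev x (b.Xi V H l) * SF.ev x (SF.De l η)| ≤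
           C0 * K * (M ^ 2 * δ ^ (-2 : ℤ) * SF.ev x b.U) := by
          intro l _
          rw [abs_mul]
          have hUx := hU x
          calc _ ≤ (C0 * (M ^ 2 * δ ^ (-1 : ℤ) * SF.ev x b.U)) * (K * δ⁻¹) := by
                gcongr
                · exact m2 l
                · exact hηK l x
            _ = _ := by
              rw [show (-2 : ℤ) = -1 + -1 by norm_num, zpow_add₀ hδ.ne', zpow_neg_one]; ring
        refine (Finset.sum_le_card_nsmul _ _ _ this).trans ?_
        simp; linarith
      have hfin : (C0 + n * C0 * K) * (M ^ 2 * δ ^ (-2 : ℤ) * SF.ev x b.U) ≤ e0 := by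
        rw [he0, hC1]
        calc _ ≤ (C0 + n * C0 * K) * (M ^ 2 * δ ^ (-2 : ℤ) * (4 ^ (n - 2) * (ε / δ ^ 2) ^ (n - 2))) := by gcongr
          _ = _ := by ring
      have hdX : ∑ l, SF.ev x (b.D l (b.Xi V H l)) = SF.ev x (b.E4 V H) - SF.ev x Q - SF.ev x W := by linarith
      rw [hdX]
      obtain ⟨o1, o2⟩ := hη01 x
      have q1 := hQ0 x
      have q2 := hW0 x
      have p1 : 0 ≤ SF.ev x η * (SF.ev x Q + SF.ev x W) := by positivity
      have p2 : -|SF.ev x (b.E4 V H)| ≤ (1 - SF.ev x η) * SF.ev x (b.E4 V H) := by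
        have a1 := neg_abs_le (SF.ev x (b.E4 V H))
        have a2 := abs_nonneg (SF.ev x (b.E4 V H))
        nlinarith
      have p3 := neg_abs_le (∑ l, SF.ev x (b.Xi V H l) * SF.ev x (SF.De l η))
      have p4 := le_abs_self (∑ l, SF.ev x (b.Xi V H l) * SF.ev x (SF.De l η))
      have p5 := abs_nonneg (SF.ev x (b.E4 V H))
      have p6 := abs_nonneg (∑ l, SF.ev x (b.Xi V H l) * SF.ev x (SF.De l η))
      have p7 : SF.ev x η * (SF.ev x (b.E4 V H) - SF.ev x Q - SF.ev x W) = SF.ev x (b.E4 V H) -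
        (1 - SF.ev x η) * SF.ev x (b.E4 V H) - SF.ev x η * (SF.ev x Q + SF.ev x W) := by ring
      rw [p7]
      rw [add_mul] at hfin
      linarith
  have hI1 : IntegrableOn ((ball (0 : Euc n) (δ / 2)).indicator (fun x => (1 / 4) * SF.ev x Q)) (hB z δ) :=
    (hB_int z δ _ (continuous_const.mul (SF.ev_cont Q))).indicator measurableSet_ball
  have hI2 : IntegrableOn (fun x => (1 / 4) * (∑ l, SF.ev x (b.D l (F l)))) (hB z δ) :=
    hB_int z δ _ (continuous_const.mul (continuous_finsetSum _ fun l _ => SF.ev_cont _))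
  have hI3 : IntegrableOn (fun _ => e0) (hB z δ) := hB_int z δ _ continuous_const
  have hmono := setIntegral_mono_on ((hI1.add hI2).sub hI3)
    (hB_int z δ _ (continuous_const.mul (SF.ev_cont (b.E4 V H)))) (hB_meas z δ) hpt
  refine le_trans ?_ hmono
  have hflux4 : ∫ x in hB z δ, (1 / 4) * (∑ l, SF.ev x (b.D l (F l))) = 0 := by
    rw [integral_const_mul, hflux, mul_zero]
  rw [integral_sub' (hI1.add hI2) hI3, integral_add' hI1 hI2, hflux4, add_zero,
    setIntegral_indicator measurableSet_ball]
  have hset : hB z δ ∩ ball (0 : Euc n) (δ / 2) = hB z (δ / 2) := by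
    ext x; simp only [Set.mem_inter_iff, mem_ball_zero_iff, Set.mem_ofPred_eq]
    constructor
    · rintro ⟨⟨_, h⟩, h'⟩; exact ⟨h', h⟩
    · rintro ⟨h', h⟩; exact ⟨⟨by linarith, h⟩, h'⟩
  rw [hset, setIntegral_const, smul_eq_mul]
  have hvol : volume.real (hB z δ) ≤ v * δ ^ n := by
    have h1 : volume.real (hB z δ) ≤ volume.real (ball (0 : Euc n) δ) :=
      measureReal_mono Set.inter_subset_left measure_ball_lt_top.ne
    refine h1.trans ?_
    rw [Measure.real, Measure.addHaar_ball_of_pos _ _ hδ, ENNReal.toReal_mul, ENNReal.toReal_ofReal (by positivity),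
      finrank_euclideanSpace_fin, mul_comm]
  have hle : volume.real (hB z δ) * e0 ≤ (C1 * v + 1) * (M ^ 2 * δ ^ (-2 : ℤ) * (ε / δ ^ 2) ^ (n - 2) * δ ^ n) := by
    calc _ ≤ (v * δ ^ n) * e0 := by gcongr
      _ = (C1 * v) * (M ^ 2 * δ ^ (-2 : ℤ) * (ε / δ ^ 2) ^ (n - 2) * δ ^ n) := by rw [he0]; ring
      _ ≤ _ := by gcongr; linarith
  linarith


namespace PA
open MvPolynomial

variable {ι : Type} [Fintype ι] [DecidableEq ι]

local notation "∂" => MvPolynomial.pderiv (R := ℝ)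

lemma pcomm (i j : ι) (f : MvPolynomial ι ℝ) : ∂ i (∂ j f) = ∂ j (∂ i f) := by
  ext m
  simp only [coeff_pderiv, Finsupp.add_apply]
  rw [add_right_comm]
  by_cases h : i = j
  · subst h; rfl
  · simp [Finsupp.single_apply, h, Ne.symm h]; ring

/-- radial square -/
def rr : MvPolynomial ι ℝ := ∑ i, X i * X i

lemma pX (i j : ι) : ∂ i (X j : MvPolynomial ι ℝ) = if j = i then 1 else 0 := by
  rw [pderiv_X, Pi.single_apply]

lemma prr (i : ι) : ∂ i (rr : MvPolynomial ι ℝ) = 2 * X i := by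
  simp only [rr, map_sum, pderiv_mul, pX, ite_mul, mul_ite, one_mul, mul_one, zero_mul, mul_zero,
    sum_add_distrib, sum_ite_eq', sum_ite_eq, mem_univ, if_true]
  ring

lemma rr_ne [Nonempty ι] : (rr : MvPolynomial ι ℝ) ≠ 0 := by
  intro h
  have := congrArg (MvPolynomial.eval (fun _ => (1:ℝ))) h
  simp [rr] at this

lemma eul {q : ℕ} {f : MvPolynomial ι ℝ} (h : f.IsHomogeneous q) :
    ∑ i, X i * ∂ i f = (q : MvPolynomial ι ℝ) * f := by
  rw [h.sum_X_mul_pderiv, nsmul_eq_mul]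

/-- Laplacian eigen lemma -/
lemma lap_zero [Nonempty ι] : ∀ (j : ℕ) (c : ℝ) (s : MvPolynomial ι ℝ), 0 < c → s.IsHomogeneous j →
    rr * ∑ i, ∂ i (∂ i s) = - (C c * s) → s = 0 := by
  intro j
  induction j using Nat.strong_induction_on with
  | _ j ih =>
  intro c s hc hs h
  have hCc : (C c : MvPolynomial ι ℝ) * C c⁻¹ = 1 := by
    rw [← C_mul, mul_inv_cancel₀ hc.ne', C_1]
  by_cases hj : j < 2
  · have hz : ∑ i, ∂ i (∂ i s) = 0 := by
      refine sum_eq_zero fun i _ => ?_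
      have h1 : (∂ i s).IsHomogeneous 0 := by
        have := hs.pderiv (i := i)
        rwa [show j - 1 = 0 by omega] at this
      rw [← totalDegree_zero_iff_isHomogeneous, totalDegree_eq_zero_iff_eq_C] at h1
      rw [h1, pderiv_C]
    rw [hz, mul_zero] at h
    have : C c⁻¹ * (C c * s) = 0 := by rw [neg_eq_iff_eq_neg.mp h.symm]; simp
    rw [← mul_assoc, mul_comm (C c⁻¹), hCc, one_mul] at this
    exact this
  · obtain ⟨q, rfl⟩ : ∃ q, j = q + 2 := ⟨j - 2, by omega⟩
    set s' : MvPolynomial ι ℝ := - (C c⁻¹ * ∑ i, ∂ i (∂ i s)) with hs'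
    have hss : s = rr * s' := by
      rw [hs']
      linear_combination (-s) * hCc + (C c⁻¹) * h
    have hh : s'.IsHomogeneous q := by
      refine (IsHomogeneous.C_mul (IsHomogeneous.sum _ _ _ fun i _ => ?_) _).neg
      exact (hs.pderiv (i := i)).pderiv (i := i)
    have hl : ∑ i, ∂ i (∂ i s) = C (2 * (Fintype.card ι : ℝ) + 4 * (q:ℝ)) * s' + rr * ∑ i, ∂ i (∂ i s') := by
      have e := eul hh
      have : ∀ i, ∂ i (∂ i s) = 2 * s' + 4 * (X i * ∂ i s') + rr * ∂ i (∂ i s') := by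
        intro i
        have h2 : ∂ i (2 : MvPolynomial ι ℝ) = 0 := (∂ i).map_natCast 2
        rw [hss]
        simp only [pderiv_mul, map_add, prr, pX, h2, if_true]
        ring
      simp only [this, sum_add_distrib, ← mul_sum, e, Finset.sum_const, Finset.card_univ, nsmul_eq_mul]
      simp only [C_add, C_mul, map_ofNat, map_natCast]
      ring
    have hne := rr_ne (ι := ι)
    have h3 : rr * ∑ i, ∂ i (∂ i s') = - (C (c + (2 * (Fintype.card ι : ℝ) + 4 * (q : ℝ))) * s') := by
      have : C c * s' = - ∑ i, ∂ i (∂ i s) := by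
        rw [hs']; linear_combination (-∑ i, ∂ i (∂ i s)) * hCc
      rw [C_add]
      linear_combination - hl + this
    have := ih q (by omega) _ s' (by positivity) hh h3
    rw [hss, this, mul_zero]

/-- curvature -/
def Dc (H : ι → ι → MvPolynomial ι ℝ) (i j k l : ι) : MvPolynomial ι ℝ :=
  ∂ i (∂ k (H j l)) - ∂ j (∂ k (H i l)) - ∂ i (∂ l (H j k)) + ∂ j (∂ l (H i k))

/-- the algebraic conditions -/
structure Flat (D : ι → ι → ι → ι → MvPolynomial ι ℝ) : Prop where
  a : ∀ i j k l, i ≠ j → i ≠ k → i ≠ l → j ≠ k → j ≠ l → k ≠ l → D i j k l = 0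
  b : ∀ i j k l, i ≠ j → i ≠ k → i ≠ l → j ≠ k → j ≠ l → k ≠ l → D i j i k = D l j l k
  c : ∀ i j k l, i ≠ j → i ≠ k → i ≠ l → j ≠ k → j ≠ l → k ≠ l →
    D i j i j + D k l k l = D i k i k + D j l j l

/-- Kulkarni–Nomizu form -/
def KN (A : ι → ι → MvPolynomial ι ℝ) (i j k l : ι) : MvPolynomial ι ℝ :=
  (if j = l then A i k else 0) + (if i = k then A j l else 0)
    - (if j = k then A i l else 0) - (if i = l then A j k else 0)

lemma sumK (i j : ι) (hij : i ≠ j) (g : ι → MvPolynomial ι ℝ) :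
    ∑ k ∈ (Finset.univ.erase i).erase j, g k = ∑ k, g k - g i - g j := by
  rw [eq_sub_iff_add_eq, Finset.sum_erase_add _ _ (by simp [hij.symm]), eq_sub_iff_add_eq,
    Finset.sum_erase_add _ _ (by simp)]

lemma cardK (i j : ι) (hij : i ≠ j) :
    (((Finset.univ.erase i).erase j).card : MvPolynomial ι ℝ) = (Fintype.card ι : MvPolynomial ι ℝ) - 2 := by
  have := sumK i j hij (fun _ => (1 : MvPolynomial ι ℝ))
  simp only [Finset.sum_const, nsmul_eq_mul, mul_one, Finset.card_univ] at this
  rw [this]; ring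

lemma exA (D : ι → ι → ι → ι → MvPolynomial ι ℝ) (hm : 5 ≤ Fintype.card ι) (hF : Flat D) (q : ℕ)
    (hq : ∀ i j k l, (D i j k l).IsHomogeneous q)
    (h1 : ∀ i j k l, D i j k l = - D j i k l) (h2 : ∀ i j k l, D i j k l = - D i j l k)
    (h3 : ∀ i j k l, D i j k l = D k l i j) :
    ∃ A : ι → ι → MvPolynomial ι ℝ, (∀ i j, A i j = A j i) ∧ (∀ i j, (A i j).IsHomogeneous q) ∧
      ∀ i j k l, D i j k l = KN A i j k l := by
  set m : MvPolynomial ι ℝ := (Fintype.card ι : MvPolynomial ι ℝ) with hmd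
  have e1 : (C (1 / ((Fintype.card ι : ℝ) - 2)) : MvPolynomial ι ℝ) * (m - 2) = 1 := by
    have h0 : ((Fintype.card ι : ℝ) - 2) ≠ 0 := by
      have : (5:ℝ) ≤ Fintype.card ι := by exact_mod_cast hm
      intro h; linarith
    have : (m - 2) = C ((Fintype.card ι : ℝ) - 2) := by rw [hmd]; simp only [C_sub, C_mul, map_natCast, map_ofNat, C_1]
    rw [this, ← C_mul, one_div, inv_mul_cancel₀ h0, C_1]
  have e2 : (C (1 / (2 * ((Fintype.card ι : ℝ) - 1))) : MvPolynomial ι ℝ) * (2 * (m - 1)) = 1 := by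
    have h0 : (2 * ((Fintype.card ι : ℝ) - 1)) ≠ 0 := by
      have : (5:ℝ) ≤ Fintype.card ι := by exact_mod_cast hm
      intro h; linarith
    have : 2 * (m - 1) = C (2 * ((Fintype.card ι : ℝ) - 1)) := by rw [hmd]; simp only [C_sub, C_mul, map_natCast, map_ofNat, C_1]
    rw [this, ← C_mul, one_div, inv_mul_cancel₀ h0, C_1]
  set c1 : MvPolynomial ι ℝ := (C (1 / ((Fintype.card ι : ℝ) - 2)) : MvPolynomial ι ℝ)
  set c2 : MvPolynomial ι ℝ := (C (1 / (2 * ((Fintype.card ι : ℝ) - 1))) : MvPolynomial ι ℝ)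
  set Ric : ι → ι → MvPolynomial ι ℝ := fun j l => ∑ i, D i j i l with hRic
  set t : MvPolynomial ι ℝ := c2 * ∑ j, Ric j j with ht
  have z1 : ∀ i k l, D i i k l = 0 := fun i k l => by
    have := h1 i i k l
    have h2 : 2 * D i i k l = 0 := by linear_combination this
    exact (mul_eq_zero.mp h2).resolve_left two_ne_zero
  have z2 : ∀ i k l, D i k l l = 0 := fun i k l => by rw [h3, z1]
  have hRs : ∀ j l, Ric j l = Ric l j := fun j l => sum_congr rfl fun i _ => h3 _ _ _ _
  refine ⟨fun j l => c1 * (Ric j l - if j = l then t else 0), ?_, ?_, ?_⟩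
  · intro i j
    simp only [hRs i j, eq_comm (a := i)]
  · intro i j
    have hr : ∀ i j, (Ric i j).IsHomogeneous q := fun i j => IsHomogeneous.sum _ _ _ fun k _ => hq _ _ _ _
    have htq : t.IsHomogeneous q := (IsHomogeneous.sum _ _ _ fun k _ => hr _ _).C_mul _
    refine ((hr i j).sub ?_).C_mul _
    split_ifs
    · exact htq
    · exact isHomogeneous_zero _ _ _
  set A : ι → ι → MvPolynomial ι ℝ := fun j l => c1 * (Ric j l - if j = l then t else 0) with hA
  -- off-diagonal
  have off : ∀ i j k, i ≠ j → i ≠ k → j ≠ k → D i j i k = A j k := by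
    intro i j k hij hik hjk
    have := sumK j k hjk (fun i' => D i' j i' k)
    rw [z1, z2, sum_congr rfl (g := fun _ => D i j i k) (fun l hl => by
      simp only [Finset.mem_erase, mem_univ, and_true] at hl
      by_cases hil : i = l
      · rw [hil]
      · exact (hF.b i j k l hij hik hil hjk (Ne.symm hl.2) (Ne.symm hl.1)).symm),
      Finset.sum_const, nsmul_eq_mul, cardK j k hjk] at this
    simp only [hA, hjk, if_false]
    linear_combination c1 * this - (D i j i k) * e1
  have dia : ∀ i j, i ≠ j → D i j i j = A i i + A j j := by
    intro i j hij
    set K := (Finset.univ.erase i).erase j with hK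
    have hs : ∀ a b, D a b a b = D b a b a := fun a b => by rw [h1, h2, neg_neg]
    have E : ∑ k ∈ K, ∑ l ∈ K, (D i j i j + D k l k l - D i k i k - D j l j l)
        = ∑ k ∈ K, (D i j i j - D i k i k - D j k j k) := by
      refine sum_congr rfl fun k hk => ?_
      rw [Finset.sum_eq_single_of_mem k hk]
      · rw [z1]; ring
      · intro l hl hlk
        simp only [hK, Finset.mem_erase, mem_univ, and_true] at hk hl
        have := hF.c i j k l hij (Ne.symm hk.2) (Ne.symm hl.2) (Ne.symm hk.1) (Ne.symm hl.1) (Ne.symm hlk)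
        linear_combination this
    have r : ∀ a, ∑ k, D a k a k = Ric a a := fun a => sum_congr rfl fun k _ => hs _ _
    have r' : ∀ a, ∑ k, D k a k a = Ric a a := fun a => rfl
    simp only [sum_sub_distrib, sum_add_distrib, Finset.sum_const, nsmul_eq_mul] at E
    rw [hK, cardK i j hij] at E
    simp only [sumK i j hij, ← mul_sum, sum_sub_distrib, r, r', z1] at E
    have E2 : (m - 1) * (m - 2) * D i j i j + ∑ k, Ric k k = (m - 1) * (Ric i i + Ric j j) := by
      rw [hs j i] at E
      linear_combination E
    simp only [hA, if_true]
    have hmne : (m - 1) ≠ 0 := by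
      intro h; rw [h] at e2; simp at e2
    apply mul_left_cancel₀ hmne
    linear_combination c1 * E2 - (m-1) * (D i j i j) * e1 + c1 * (∑ j, Ric j j) * e2
  have As : ∀ i j, A i j = A j i := fun i j => by simp only [hA, hRs i j, eq_comm (a := i)]
  intro i j k l
  unfold KN
  by_cases hij : i = j
  · subst hij; rw [z1]; split_ifs <;> ring
  by_cases hkl : k = l
  · subst hkl; rw [z2]; split_ifs <;> ring
  by_cases hik : i = k
  · subst hik
    by_cases hjl : j = l
    · subst hjl
      rw [dia i j hij]; simp [hij, Ne.symm hij]
    · rw [off i j l hij hkl hjl]; simp [hij, Ne.symm hij, hkl, hjl]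
  by_cases hil : i = l
  · subst hil
    by_cases hjk : j = k
    · subst hjk
      rw [h2, dia i j hij]; simp [hij, Ne.symm hij]; ring
    · rw [h2, off i j k hij hik hjk]; simp [hij, Ne.symm hij, hik, hjk]
  by_cases hjk : j = k
  · subst hjk
    rw [h1]
    by_cases hjl : j = l
    · exact absurd hjl hkl
    · rw [off j i l (Ne.symm hij) hjl hil]; simp [hij, hil, hjl]
  by_cases hjl : j = l
  · subst hjl
    rw [h1, h2, neg_neg, off j i k (Ne.symm hij) hjk hik]; simp [hij, hik, hjk]
  rw [hF.a i j k l hij hik hil hjk hjl hkl]; simp [hik, hil, hjk, hjl]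

end PA


namespace PA
open MvPolynomial

variable {ι : Type} [Fintype ι] [DecidableEq ι]

local notation "∂" => MvPolynomial.pderiv (R := ℝ)

lemma exists_out (hm : 5 ≤ Fintype.card ι) (s : Finset ι) (hs : s.card ≤ 4) : ∃ i, i ∉ s := by
  by_contra h
  push Not at h
  have : s = Finset.univ := Finset.eq_univ_iff_forall.mpr h
  rw [this, Finset.card_univ] at hs
  omega

lemma codazzi (H A : ι → ι → MvPolynomial ι ℝ) (hm : 5 ≤ Fintype.card ι)
    (As : ∀ i j, A i j = A j i) (hD : ∀ i j k l, Dc H i j k l = KN A i j k l) (p j k : ι) :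
    ∂ p (A j k) = ∂ j (A p k) := by
  have bia : ∀ p i j k l, ∂ p (Dc H i j k l) + ∂ i (Dc H j p k l) + ∂ j (Dc H p i k l) = 0 := by
    intro p i j k l
    simp only [Dc, map_add, map_sub]
    rw [pcomm p i (∂ k (H j l)), pcomm p j (∂ k (H i l)), pcomm p i (∂ l (H j k)), pcomm p j (∂ l (H i k)),
      pcomm i j (∂ k (H p l)), pcomm i j (∂ l (H p k))]
    ring
  have c1 : ∀ p j k, k ≠ j → k ≠ p → p ≠ j → ∂ p (A j k) = ∂ j (A p k) := by
    intro p j k hkj hkp hpj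
    obtain ⟨i, hi⟩ := exists_out hm {p, j, k} (le_trans Finset.card_le_three (by norm_num))
    simp only [Finset.mem_insert, Finset.mem_singleton, not_or] at hi
    obtain ⟨h1, h2, h3⟩ := hi
    have := bia p i j k i
    simp only [hD, KN] at this
    simp [h1, h2, h3, Ne.symm h1, Ne.symm h2, Ne.symm h3, hkj, hkp, hpj, Ne.symm hkj, Ne.symm hkp, Ne.symm hpj] at this
    linear_combination -this
  have c2 : ∀ p j i, j ≠ p → i ≠ p → i ≠ j →
      (∂ j (A p j) - ∂ p (A j j)) + (∂ i (A p i) - ∂ p (A i i)) = 0 := by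
    intro p j i hjp hip hij
    have := bia p i j j i
    simp only [hD, KN] at this
    simp [hjp, hip, hij, Ne.symm hjp, Ne.symm hip, Ne.symm hij] at this
    linear_combination this
  have c3 : ∀ p j, j ≠ p → ∂ p (A j j) = ∂ j (A p j) := by
    intro p j hjp
    obtain ⟨i, hi⟩ := exists_out hm {p, j} (le_trans Finset.card_le_two (by norm_num))
    obtain ⟨i', hi'⟩ := exists_out hm {p, j, i} (le_trans Finset.card_le_three (by norm_num))
    simp only [Finset.mem_insert, Finset.mem_singleton, not_or] at hi hi'
    have a1 := c2 p j i hjp hi.1 hi.2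
    have a2 := c2 p j i' hjp hi'.1 hi'.2.1
    have a3 := c2 p i i' hi.1 hi'.1 hi'.2.2
    have : 2 * (∂ p (A j j) - ∂ j (A p j)) = 0 := by linear_combination a3 - a1 - a2
    exact sub_eq_zero.mp ((mul_eq_zero.mp this).resolve_left two_ne_zero)
  by_cases hpj : p = j
  · rw [hpj]
  by_cases hkj : k = j
  · subst hkj; exact c3 p k (Ne.symm hpj)
  by_cases hkp : k = p
  · subst hkp; rw [c3 j k hpj, As j k]
  exact c1 p j k hkj hkp hpj

lemma mainA (H : ι → ι → MvPolynomial ι ℝ) (hm : 5 ≤ Fintype.card ι) (q : ℕ)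
    (hq : ∀ i j, (H i j).IsHomogeneous (q + 2)) (hs : ∀ i j, H i j = H j i)
    (hx : ∀ i, ∑ k, X k * H k i = 0) (htr : ∑ i, H i i = 0) (hF : Flat (Dc H)) (i j : ι) : H i j = 0 := by
  have : Nonempty ι := ⟨i⟩
  obtain ⟨A, As, Aq, hD⟩ := exA (Dc H) hm hF q
    (fun i j k l => by
      have : ∀ a b c e, (∂ a (∂ b (H c e))).IsHomogeneous q := fun a b c e =>
        ((hq c e).pderiv (i := b)).pderiv (i := a)
      exact (((this _ _ _ _).sub (this _ _ _ _)).sub (this _ _ _ _)).add (this _ _ _ _))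
    (fun i j k l => by simp only [Dc]; ring)
    (fun i j k l => by simp only [Dc]; ring)
    (fun i j k l => by
      simp only [Dc]
      rw [pcomm k i, pcomm l i, pcomm k j, pcomm l j, hs l j, hs k j, hs l i, hs k i]; ring)
  have cod := codazzi H A hm As hD
  set m : MvPolynomial ι ℝ := (Fintype.card ι : MvPolynomial ι ℝ) with hmd
  set κ : MvPolynomial ι ℝ := (q : MvPolynomial ι ℝ) + 2 with hκ
  set t := ∑ i, A i i with ht
  have htq : t.IsHomogeneous q := IsHomogeneous.sum _ _ _ fun i _ => Aq i i
  set Ax : ι → MvPolynomial ι ℝ := fun j => ∑ i, X i * A i j with hAx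
  have Axq : ∀ j, (Ax j).IsHomogeneous (q + 1) := fun j => IsHomogeneous.sum _ _ _ fun i _ => by
    rw [add_comm q 1]; exact (isHomogeneous_X _ _).mul (Aq i j)
  have eH : ∀ i j, ∑ k, X k * ∂ k (H i j) = κ * H i j := fun i j => by
    rw [eul (hq i j)]; push_cast; rfl
  have eH1 : ∀ a i j, ∑ k, X k * ∂ k (∂ a (H i j)) = (κ - 1) * ∂ a (H i j) := fun a i j => by
    have := (hq i j).pderiv (i := a)
    rw [show q + 2 - 1 = q + 1 by omega] at this
    rw [eul this]; push_cast; rw [hκ]; ring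
  have dx1 : ∀ k l, ∑ i, X i * ∂ k (H i l) = - H k l := fun k l => by
    have := congrArg (∂ k) (hx l)
    simp only [map_sum, pderiv_mul, pX, ite_mul, one_mul, zero_mul, sum_add_distrib,
      sum_ite_eq', sum_ite_eq, mem_univ, if_true, map_zero] at this
    linear_combination this
  have dx2 : ∀ j k l, ∑ i, X i * ∂ j (∂ k (H i l)) = - ∂ j (H k l) - ∂ k (H j l) := fun j k l => by
    have := congrArg (∂ j) (dx1 k l)
    simp only [map_sum, pderiv_mul, pX, ite_mul, one_mul, zero_mul, sum_add_distrib,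
      sum_ite_eq', sum_ite_eq, mem_univ, if_true, map_zero, map_neg] at this
    linear_combination this
  have E2 : ∀ j k l, κ * (∂ k (H j l) - ∂ l (H j k)) =
      (if j = l then Ax k else 0) + X k * A j l - (if j = k then Ax l else 0) - X l * A j k := by
    intro j k l
    have h1 : ∑ i, X i * Dc H i j k l = κ * (∂ k (H j l) - ∂ l (H j k)) := by
      simp only [Dc, mul_add, mul_sub, sum_add_distrib, sum_sub_distrib, dx2, eH1]
      rw [hs k l]; ring
    rw [← h1]
    simp only [hD, KN, mul_add, mul_sub, sum_add_distrib, sum_sub_distrib, mul_ite, mul_zero,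
      sum_ite_eq', sum_ite_eq, mem_univ, if_true]
    split_ifs <;> simp [hAx]
  have E1 : ∀ j l, κ * (κ + 1) * H j l = (if j = l then ∑ k, X k * Ax k else 0) + rr * A j l
      - X j * Ax l - X l * Ax j := by
    intro j l
    have h1 : ∑ k, X k * (κ * (∂ k (H j l) - ∂ l (H j k))) = κ * (κ + 1) * H j l := by
      have h2 := dx1 l j
      have h3 := eH j l
      have : ∀ k, X k * (κ * (∂ k (H j l) - ∂ l (H j k))) = κ * (X k * ∂ k (H j l)) - κ * (X k * ∂ l (H k j)) :=
        fun k => by rw [hs j k]; ring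
      simp only [this, sum_sub_distrib, ← mul_sum, h2, h3]
      rw [hs l j]; ring
    rw [← h1]
    simp only [E2, mul_add, mul_sub, sum_add_distrib, sum_sub_distrib, mul_ite, mul_zero,
      sum_ite_eq', sum_ite_eq, mem_univ, if_true]
    have h4 : ∑ k, X k * (X k * A j l) = rr * A j l := by
      rw [rr, sum_mul]; exact sum_congr rfl fun k _ => by ring
    have h5 : ∑ k, X k * (X l * A j k) = X l * Ax j := by
      rw [hAx, mul_sum]; exact sum_congr rfl fun k _ => by rw [As j k]; ring
    rw [h4, h5]
    split_ifs <;> simp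
  set dv : ι → MvPolynomial ι ℝ := fun k => ∑ j, ∂ j (H j k) with hdv
  have E3 : ∀ k, κ * dv k = - ((m - 2) * Ax k + t * X k) := by
    intro k
    have h1 : ∑ j, κ * (∂ k (H j j) - ∂ j (H j k)) = - (κ * dv k) := by
      rw [← mul_sum, sum_sub_distrib, ← map_sum, htr]; simp [hdv]
    have h2 : ∑ j, κ * (∂ k (H j j) - ∂ j (H j k)) = ∑ j, _ := sum_congr rfl fun j _ => E2 j k j
    rw [h1] at h2
    simp only [if_true, sum_add_distrib, sum_sub_distrib, sum_ite_eq', sum_ite_eq,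
      mem_univ, Finset.sum_const, Finset.card_univ, nsmul_eq_mul, ← mul_sum] at h2
    have h3 : ∑ j, X j * A j k = Ax k := rfl
    rw [h3] at h2
    linear_combination -h2
  have dA : ∀ j, ∑ l, ∂ l (A j l) = ∂ j t := fun j => by
    rw [ht, map_sum]; exact sum_congr rfl fun l _ => cod _ _ _
  have dAx : ∀ l j, ∂ l (Ax j) = A l j + ∑ i, X i * ∂ i (A l j) := fun l j => by
    simp only [hAx, map_sum, pderiv_mul, pX, ite_mul, one_mul, zero_mul, sum_add_distrib,
      sum_ite_eq', sum_ite_eq, mem_univ, if_true]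
    congr 1
    exact sum_congr rfl fun i _ => by rw [cod]
  have dAx' : ∀ l j, ∂ l (Ax j) = (κ - 1) * A l j := fun l j => by
    rw [dAx, eul (Aq l j), hκ]; ring
  have dvA : ∑ l, ∂ l (Ax l) = (κ - 1) * t := by
    simp only [dAx', ← mul_sum]; rfl
  have eAx : ∀ j, ∑ l, X l * ∂ l (Ax j) = (κ - 1) * Ax j := fun j => by
    rw [eul (Axq j), hκ]; push_cast; ring
  have dAxx : ∀ j, ∂ j (∑ k, X k * Ax k) = κ * Ax j := fun j => by
    simp only [map_sum, pderiv_mul, pX, ite_mul, one_mul, zero_mul, sum_add_distrib,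
      sum_ite_eq', sum_ite_eq, mem_univ, if_true, dAx']
    have : ∑ k, X k * ((κ - 1) * A j k) = (κ - 1) * Ax j := by
      rw [hAx, mul_sum]; exact sum_congr rfl fun k _ => by rw [As j k]; ring
    rw [this]; ring
  have kc : ∀ a : ι, ∂ a κ = 0 := fun a => by
    rw [hκ]; have := (∂ a).map_natCast (q + 2); push_cast at this; exact this
  have kc1 : ∀ a : ι, ∂ a (κ * (κ + 1)) = 0 := fun a => by
    simp only [pderiv_mul, map_add, kc, pderiv_one]; ring
  have E4' : ∀ j, κ * (κ + 1) * dv j = -(m - 2) * Ax j + rr * ∂ j t - (κ - 1) * t * X j := by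
    intro j
    have h1 : ∑ l, ∂ l (κ * (κ + 1) * H j l) = κ * (κ + 1) * dv j := by
      simp only [pderiv_mul (f := κ * (κ + 1)), kc1, zero_mul, zero_add, ← mul_sum, hdv, hs j]
    rw [← h1]
    have h2 : ∀ l, ∂ l (κ * (κ + 1) * H j l) = (if j = l then ∂ l (∑ k, X k * Ax k) else 0)
        + (2 * X l * A j l + rr * ∂ l (A j l)) - ((if j = l then Ax l else 0) + X j * ∂ l (Ax l))
        - (Ax j + X l * ∂ l (Ax j)) := by
      intro l
      rw [E1]
      simp only [map_add, map_sub, pderiv_mul, prr, pX, if_true]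
      split_ifs <;> simp
    simp only [h2, sum_add_distrib, sum_sub_distrib,
      sum_ite_eq', sum_ite_eq, mem_univ, if_true, ← mul_sum, dAxx, dA, dvA, eAx,
      Finset.sum_const, Finset.card_univ, nsmul_eq_mul]
    have h3 : ∑ l, 2 * X l * A j l = 2 * Ax j := by
      rw [hAx, mul_sum]; exact sum_congr rfl fun k _ => by rw [As j k]; ring
    rw [h3]
    ring
  have E4 : ∀ j, κ * (m - 2) * Ax j + rr * ∂ j t + 2 * t * X j = 0 := fun j => by
    linear_combination (κ + 1) * E3 j - E4' j
  have mc : ∀ a : ι, ∂ a (κ * (m - 2)) = 0 := fun a => by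
    have h2 : ∂ a (2 : MvPolynomial ι ℝ) = 0 := (∂ a).map_natCast 2
    have hm : ∂ a m = 0 := (∂ a).map_natCast _
    simp only [pderiv_mul, map_sub, kc, h2, hm]; ring
  have E5 : rr * ∑ i, ∂ i (∂ i t) = - (C (((q:ℝ) + 2) * ((q:ℝ) + 1) * ((Fintype.card ι : ℝ) - 2) + 4 * (q:ℝ) + 2 * (Fintype.card ι : ℝ)) * t) := by
    have h1 : ∑ j, ∂ j (κ * (m - 2) * Ax j + rr * ∂ j t + 2 * t * X j) = 0 := by simp only [E4, map_zero, sum_const_zero]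
    have h2 : ∀ j, ∂ j (κ * (m - 2) * Ax j + rr * ∂ j t + 2 * t * X j) =
        κ * (m - 2) * ∂ j (Ax j) + (2 * (X j * ∂ j t) + rr * ∂ j (∂ j t)) + (2 * (X j * ∂ j t) + 2 * t) := by
      intro j
      have hh2 : ∂ j (2 : MvPolynomial ι ℝ) = 0 := (∂ j).map_natCast 2
      simp only [map_add, pderiv_mul (f := κ * (m - 2)), mc]
      simp only [pderiv_mul, prr, pX, if_true, hh2]
      ring
    simp only [h2, sum_add_distrib, ← mul_sum, dvA, eul htq, Finset.sum_const, Finset.card_univ, nsmul_eq_mul] at h1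
    simp only [C_add, C_mul, C_sub, map_natCast, map_ofNat, C_1]
    rw [hκ] at h1
    linear_combination h1
  have t0 : t = 0 := by
    refine lap_zero q _ t ?_ htq E5
    have : (5:ℝ) ≤ Fintype.card ι := by exact_mod_cast hm
    have h0 : (0:ℝ) ≤ q := by positivity
    have : 0 ≤ ((q:ℝ) + 2) * ((q:ℝ) + 1) * ((Fintype.card ι : ℝ) - 2) := by
      apply mul_nonneg (by positivity); linarith
    linarith
  have κne : ∀ a : ℕ, κ + (a : MvPolynomial ι ℝ) ≠ 0 := fun a => by
    have : κ + (a : MvPolynomial ι ℝ) = ((q + 2 + a : ℕ) : MvPolynomial ι ℝ) := by push_cast; rfl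
    rw [this]; exact Nat.cast_ne_zero.mpr (by omega)
  have k0 : κ ≠ 0 := by simpa using κne 0
  have k1 : κ + 1 ≠ 0 := by simpa using κne 1
  have m2 : m - 2 ≠ 0 := by
    have : m - 2 = ((Fintype.card ι - 2 : ℕ) : MvPolynomial ι ℝ) := by
      rw [Nat.cast_sub (by omega)]; push_cast; rfl
    rw [this]; exact Nat.cast_ne_zero.mpr (by omega)
  have Ax0 : ∀ j, Ax j = 0 := fun j => by
    have := E4 j
    rw [t0] at this
    simp only [map_zero, mul_zero, zero_mul, add_zero] at this
    exact (mul_eq_zero.mp this).resolve_left (mul_ne_zero k0 m2)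
  have E1' : ∀ j l, κ * (κ + 1) * H j l = rr * A j l := fun j l => by
    rw [E1]; simp [Ax0]
  have E6 : ∀ j k l, (κ - 1) * (X k * A j l - X l * A j k) = 0 := by
    intro j k l
    have h1 := E2 j k l
    simp only [Ax0] at h1
    have h2 := congrArg (∂ k) (E1' j l)
    have h3 := congrArg (∂ l) (E1' j k)
    rw [pderiv_mul (f := κ * (κ + 1)), kc1, pderiv_mul, prr] at h2 h3
    have h4 : ∂ k (A j l) = ∂ l (A j k) := by rw [cod k, cod l, As k l]
    simp only [ite_self] at h1
    linear_combination h2 - h3 - (κ + 1) * h1 + rr * h4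
  have k1' : κ - 1 ≠ 0 := by
    have : κ - 1 = ((q + 1 : ℕ) : MvPolynomial ι ℝ) := by rw [hκ]; push_cast; ring
    rw [this]; exact Nat.cast_ne_zero.mpr (by omega)
  have A0 : ∀ j l, rr * A j l = 0 := fun j l => by
    have h1 : ∑ k, X k * (X k * A j l - X l * A j k) = 0 := sum_eq_zero fun k _ => by
      rw [(mul_eq_zero.mp (E6 j k l)).resolve_left k1', mul_zero]
    simp only [mul_sub, sum_sub_distrib] at h1
    have h4 : ∑ k, X k * (X k * A j l) = rr * A j l := by
      rw [rr, sum_mul]; exact sum_congr rfl fun k _ => by ring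
    have h5 : ∑ k, X k * (X l * A j k) = X l * Ax j := by
      rw [hAx, mul_sum]; exact sum_congr rfl fun k _ => by rw [As j k]; ring
    rw [h4, h5, Ax0, mul_zero, sub_zero] at h1
    exact h1
  have := E1' i j
  rw [A0] at this
  exact (mul_eq_zero.mp this).resolve_left (mul_ne_zero k0 k1)

end PA


namespace PA
open MvPolynomial

local notation "∂" => MvPolynomial.pderiv (R := ℝ)

variable {n : ℕ}

/-- restriction to the hyperplane -/
def rho (z : Fin n) : MvPolynomial (Fin n) ℝ →ₐ[ℝ] MvPolynomial {i : Fin n // i ≠ z} ℝ :=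
  aeval (fun i => if h : i ≠ z then X ⟨i, h⟩ else 0)

lemma rho_X (z : Fin n) (i : {i : Fin n // i ≠ z}) : rho z (X (i : Fin n)) = X i := by
  simp [rho, i.2]

lemma rho_Xz (z : Fin n) : rho z (X z) = 0 := by simp [rho]

lemma rho_pd (z : Fin n) (i : {i : Fin n // i ≠ z}) (p : MvPolynomial (Fin n) ℝ) :
    rho z (∂ (i : Fin n) p) = ∂ i (rho z p) := by
  induction p using MvPolynomial.induction_on with
  | C a => simp [rho]
  | add p q hp hq => simp [hp, hq]
  | mul_X p j hp =>
    rw [pderiv_mul, map_add, map_mul, map_mul, hp, map_mul, pderiv_mul]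
    congr 2
    by_cases hj : j = z
    · subst hj; rw [rho_Xz, pX, if_neg (Ne.symm i.2)]; simp
    · rw [rho_X z ⟨j, hj⟩, pX, pX]
      by_cases h : j = i
      · simp [h]
      · rw [if_neg h, if_neg (fun h' => h (congrArg Subtype.val h')), map_zero]

lemma rho_hc (z : Fin n) (q : ℕ) (p : MvPolynomial (Fin n) ℝ) :
    homogeneousComponent q (rho z p) = rho z (homogeneousComponent q p) := by
  induction p using MvPolynomial.induction_on' with
  | monomial α c =>
    have h1 : (monomial α c : MvPolynomial (Fin n) ℝ).IsHomogeneous α.degree := isHomogeneous_monomial _ rfl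
    have h2 : (rho z (monomial α c)).IsHomogeneous α.degree := by
      have := h1.aeval (fun i => if h : i ≠ z then (X ⟨i, h⟩ : MvPolynomial {i : Fin n // i ≠ z} ℝ) else 0) (n := 1)
        (fun i => by
          split_ifs
          · exact isHomogeneous_X _ _
          · exact isHomogeneous_zero _ _ _)
      rwa [one_mul] at this
    rw [homogeneousComponent_of_mem h1, homogeneousComponent_of_mem h2]
    split_ifs <;> simp
  | add p q hp hq => simp [hp, hq]

variable {ι : Type} [Fintype ι] [DecidableEq ι]

lemma hc_pd (q : ℕ) (i : ι) (p : MvPolynomial ι ℝ) :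
    ∂ i (homogeneousComponent (q + 1) p) = homogeneousComponent q (∂ i p) := by
  ext m
  rw [coeff_pderiv, coeff_homogeneousComponent, coeff_homogeneousComponent, coeff_pderiv]
  have : (m + Finsupp.single i 1).degree = m.degree + 1 := by
    rw [map_add, Finsupp.degree_single]
  rw [this]
  by_cases h : m.degree = q <;> simp [h]

lemma hc_X (q : ℕ) (i : ι) (p : MvPolynomial ι ℝ) :
    homogeneousComponent (q + 1) (X i * p) = X i * homogeneousComponent q p := by
  ext m
  rw [coeff_X_mul', coeff_homogeneousComponent, coeff_homogeneousComponent, coeff_X_mul']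
  by_cases hi : i ∈ m.support
  · have : m.degree = (m - Finsupp.single i 1).degree + 1 := by
      conv_lhs => rw [← tsub_add_cancel_of_le (show Finsupp.single i 1 ≤ m by
        rw [Finsupp.single_le_iff]; have := Finsupp.mem_support_iff.mp hi; omega)]
      rw [map_add, Finsupp.degree_single]
    rw [this]
    by_cases h : (m - Finsupp.single i 1).degree = q <;> simp [h, hi]
  · simp [hi]

lemma Flat.hom {κ : Type} [Fintype κ] [DecidableEq κ] {D : ι → ι → ι → ι → MvPolynomial ι ℝ}
    (h : Flat D) (e : κ → ι) (he : Function.Injective e) (f : MvPolynomial ι ℝ →+ MvPolynomial κ ℝ)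
    (D' : κ → κ → κ → κ → MvPolynomial κ ℝ) (hD : ∀ i j k l, D' i j k l = f (D (e i) (e j) (e k) (e l))) :
    Flat D' := by
  refine ⟨?_, ?_, ?_⟩
  · intro i j k l a1 a2 a3 a4 a5 a6
    rw [hD, h.a _ _ _ _ (he.ne a1) (he.ne a2) (he.ne a3) (he.ne a4) (he.ne a5) (he.ne a6), map_zero]
  · intro i j k l a1 a2 a3 a4 a5 a6
    rw [hD, hD, h.b _ _ _ _ (he.ne a1) (he.ne a2) (he.ne a3) (he.ne a4) (he.ne a5) (he.ne a6)]
  · intro i j k l a1 a2 a3 a4 a5 a6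
    rw [hD, hD, hD, hD, ← map_add, ← map_add, h.c _ _ _ _ (he.ne a1) (he.ne a2) (he.ne a3) (he.ne a4) (he.ne a5) (he.ne a6)]

/-- constraints -/
structure PCon (z : Fin n) (H : Fin n → Fin n → MvPolynomial (Fin n) ℝ) : Prop where
  symm : ∀ i k, H i k = H k i
  tr : ∑ i, H i i = 0
  hz : ∀ i, H i z = 0
  rad : ∀ i, rho z (∑ k, X k * H k i) = 0
  nor : ∀ i k, rho z (∂ z (H i k)) = 0
  lo0 : ∀ i k, homogeneousComponent 0 (H i k) = 0
  lo1 : ∀ i k, homogeneousComponent 1 (H i k) = 0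

lemma rho_zero (hn : 6 ≤ n) (z : Fin n) (H : Fin n → Fin n → MvPolynomial (Fin n) ℝ) (hP : PCon z H)
    (hF : Flat (Dc H)) (i k : Fin n) : rho z (H i k) = 0 := by
  by_cases hi : i = z
  · rw [hi, hP.symm, hP.hz, map_zero]
  by_cases hk : k = z
  · rw [hk, hP.hz, map_zero]
  have hcard : 5 ≤ Fintype.card {i : Fin n // i ≠ z} := by
    rw [Fintype.card_subtype_compl, Fintype.card_fin, Fintype.card_subtype_eq]; omega
  have sumsub : ∀ f : Fin n → MvPolynomial {i : Fin n // i ≠ z} ℝ, f z = 0 →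
      ∑ j : {i : Fin n // i ≠ z}, f j = ∑ j, f j := by
    intro f hf
    rw [← Finset.sum_subtype (Finset.univ.erase z) (by simp), ← Finset.sum_erase_add _ _ (mem_univ z), hf, add_zero]
  have main : ∀ q, ∀ a c : {i : Fin n // i ≠ z}, homogeneousComponent (q + 2) (rho z (H a c)) = 0 := by
    intro q
    refine mainA (fun a c : {i : Fin n // i ≠ z} => homogeneousComponent (q + 2) (rho z (H a c))) hcard q
      (fun a c => homogeneousComponent_isHomogeneous _ _) (fun a c => by rw [hP.symm]) ?_ ?_ ?_
    · intro a
      have := congrArg (homogeneousComponent (q + 3)) (hP.rad a)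
      rw [map_sum, map_zero, map_sum] at this
      rw [← this, ← sumsub _ (by rw [map_mul, rho_Xz, zero_mul, map_zero])]
      exact sum_congr rfl fun j _ => by rw [map_mul, rho_X, hc_X]
    · rw [← map_sum, sumsub (fun j => rho z (H j j)) (by rw [hP.hz, map_zero]), ← map_sum, hP.tr, map_zero, map_zero]
    · refine hF.hom (Subtype.val) Subtype.val_injective
        (((homogeneousComponent q : MvPolynomial {i : Fin n // i ≠ z} ℝ →ₗ[ℝ] _).toAddMonoidHom).comp
          (rho z : MvPolynomial (Fin n) ℝ →+ MvPolynomial {i : Fin n // i ≠ z} ℝ)) _ ?_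
      intro i j k l
      change _ = homogeneousComponent q (rho z (Dc H i j k l))
      simp only [Dc, map_add, map_sub, rho_pd, hc_pd]
  rw [← sum_homogeneousComponent (rho z (H i k))]
  refine sum_eq_zero fun q _ => ?_
  match q with
  | 0 => rw [rho_hc, hP.lo0, map_zero]
  | 1 => rw [rho_hc, hP.lo1, map_zero]
  | q + 2 => exact main q ⟨i, hi⟩ ⟨k, hk⟩

lemma coeff_of_rho (z : Fin n) (p : MvPolynomial (Fin n) ℝ) (hp : rho z p = 0) (m : Fin n →₀ ℕ) (hm : m z = 0) :
    coeff m p = 0 := by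
  set σ : MvPolynomial (Fin n) ℝ →ₐ[ℝ] MvPolynomial (Fin n) ℝ := aeval (fun i => if i = z then 0 else X i) with hσ
  have h1 : σ = (rename Subtype.val).comp (rho z) := by
    refine MvPolynomial.algHom_ext fun i => ?_
    by_cases hi : i = z
    · subst hi; simp [hσ, rho_Xz]
    · simp [hσ, hi, rho]
  have h2 : ∀ p : MvPolynomial (Fin n) ℝ, coeff m (σ p) = coeff m p := by
    intro p
    induction p using MvPolynomial.induction_on' with
    | monomial α c =>
      rw [hσ, aeval_monomial]
      by_cases hα : α z = 0
      · congr 1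
        rw [monomial_eq]
        congr 1
        refine Finsupp.prod_congr fun i hi => ?_
        rw [if_neg]
        rintro rfl
        exact Finsupp.mem_support_iff.mp hi hα
      · have : (α.prod fun i k => (if i = z then (0 : MvPolynomial (Fin n) ℝ) else X i) ^ k) = 0 :=
          Finset.prod_eq_zero (Finsupp.mem_support_iff.mpr hα) (by simp [hα])
        rw [this, mul_zero, coeff_zero, coeff_monomial, if_neg]
        rintro rfl; exact hα hm
    | add p q hp hq => simp [hp, hq]
  rw [← h2, h1, AlgHom.comp_apply, hp, map_zero, coeff_zero]

lemma zero_of_rho (z : Fin n) (p : MvPolynomial (Fin n) ℝ) (hp : ∀ a : ℕ, rho z ((∂ z)^[a] p) = 0) : p = 0 := by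
  have : ∀ (a : ℕ) (p : MvPolynomial (Fin n) ℝ), (∀ a : ℕ, rho z ((∂ z)^[a] p) = 0) → ∀ m : Fin n →₀ ℕ, m z = a →
      coeff m p = 0 := by
    intro a
    induction a with
    | zero => intro p hp m hm; exact coeff_of_rho z p (hp 0) m hm
    | succ a ih =>
      intro p hp m hm
      have h1 := ih (∂ z p) (fun a => by have := hp (a + 1); rwa [Function.iterate_succ_apply] at this)
        (m - Finsupp.single z 1) (by simp [hm])
      rw [coeff_pderiv, tsub_add_cancel_of_le (by rw [Finsupp.single_le_iff]; omega)] at h1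
      refine (mul_eq_zero.mp h1).resolve_right ?_
      positivity
  ext m
  rw [this _ p hp m rfl, coeff_zero]

theorem mainB (hn : 6 ≤ n) (z : Fin n) (H : Fin n → Fin n → MvPolynomial (Fin n) ℝ) (hP : PCon z H)
    (hF : Flat (Dc H)) (i k : Fin n) : H i k = 0 := by
  have pit : ∀ (a : ℕ) (i : Fin n) (p : MvPolynomial (Fin n) ℝ), (∂ z)^[a] (∂ i p) = ∂ i ((∂ z)^[a] p) := by
    intro a
    induction a with
    | zero => intro i p; rfl
    | succ a ih => intro i p; rw [Function.iterate_succ_apply, pcomm, ih, ← Function.iterate_succ_apply]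
  have iadd : ∀ (a : ℕ) (p q : MvPolynomial (Fin n) ℝ), (∂ z)^[a] (p + q) = (∂ z)^[a] p + (∂ z)^[a] q := by
    intro a p q; exact iterate_map_add (∂ z) a p q
  have isub : ∀ (a : ℕ) (p q : MvPolynomial (Fin n) ℝ), (∂ z)^[a] (p - q) = (∂ z)^[a] p - (∂ z)^[a] q := by
    intro a p q; exact iterate_map_sub (∂ z) a p q
  have hcard : 5 ≤ Fintype.card (Fin n) := by rw [Fintype.card_fin]; omega
  have zz : ∀ j k, Dc H z j z k = ∂ z (∂ z (H j k)) := by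
    intro j k
    simp only [Dc, hP.symm z, hP.hz, map_zero]; ring
  have main : ∀ a : ℕ, ∀ i k, rho z ((∂ z)^[a] (H i k)) = 0 ∧ rho z ((∂ z)^[a+1] (H i k)) = 0 := by
    intro a
    induction a with
    | zero => intro i k; exact ⟨rho_zero hn z H hP hF i k, hP.nor i k⟩
    | succ a ih =>
      have hD : ∀ i j k l, i ≠ z → j ≠ z → k ≠ z → l ≠ z → rho z ((∂ z)^[a] (Dc H i j k l)) = 0 := by
        intro i j k l hi hj hk hl
        have e : ∀ i k j l, i ≠ z → k ≠ z → rho z ((∂ z)^[a] (∂ i (∂ k (H j l)))) = 0 := by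
          intro i k j l hi hk
          rw [pit, pit, rho_pd z ⟨i, hi⟩, rho_pd z ⟨k, hk⟩, (ih j l).1, map_zero, map_zero]
        simp only [Dc, iadd, isub, map_add, map_sub, e _ _ _ _ hi hk, e _ _ _ _ hi hl, e _ _ _ _ hj hk, e _ _ _ _ hj hl]
        ring
      have st : ∀ i k, (∂ z)^[a + 1 + 1] (H i k) = (∂ z)^[a] (Dc H z i z k) := by
        intro i k; rw [zz, Function.iterate_succ_apply, Function.iterate_succ_apply]
      have off : ∀ j k, j ≠ z → k ≠ z → j ≠ k → rho z ((∂ z)^[a] (Dc H z j z k)) = 0 := by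
        intro j k hj hk hjk
        obtain ⟨l, hl⟩ := exists_out hcard {z, j, k} (le_trans Finset.card_le_three (by norm_num))
        simp only [Finset.mem_insert, Finset.mem_singleton, not_or] at hl
        rw [hF.b z j k l (Ne.symm hj) (Ne.symm hk) (Ne.symm hl.1) hjk (Ne.symm hl.2.1) (Ne.symm hl.2.2)]
        exact hD _ _ _ _ hl.1 hj hl.1 hk
      have dia : ∀ j k, j ≠ z → k ≠ z → rho z ((∂ z)^[a] (Dc H z j z j)) = rho z ((∂ z)^[a] (Dc H z k z k)) := by
        intro j k hj hk
        by_cases hjk : j = k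
        · rw [hjk]
        obtain ⟨l, hl⟩ := exists_out hcard {z, j, k} (le_trans Finset.card_le_three (by norm_num))
        simp only [Finset.mem_insert, Finset.mem_singleton, not_or] at hl
        have := congrArg (fun p => rho z ((∂ z)^[a] p)) (hF.c z j k l (Ne.symm hj) (Ne.symm hk) (Ne.symm hl.1) hjk (Ne.symm hl.2.1) (Ne.symm hl.2.2))
        simp only [iadd, map_add] at this
        rwa [hD k l k l hk hl.1 hk hl.1, hD j l j l hj hl.1 hj hl.1, add_zero, add_zero] at this
      have tr : ∑ j ∈ Finset.univ.erase z, rho z ((∂ z)^[a] (Dc H z j z j)) = 0 := by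
        have h1 : ∑ j, rho z ((∂ z)^[a] (Dc H z j z j)) = 0 := by
          simp only [zz]
          rw [← map_sum]
          have : ∑ j, (∂ z)^[a] (∂ z (∂ z (H j j))) = 0 := by
            simp only [pit]
            rw [← map_sum, ← map_sum, show ∑ j, (∂ z)^[a] (H j j) = (∂ z)^[a] (∑ j, H j j) from
              (map_sum (AddMonoidHom.mk' (fun p => (∂ z)^[a] p) (iadd a)) (fun j => H j j) Finset.univ).symm, hP.tr, iterate_map_zero, map_zero, map_zero]
          rw [this, map_zero]
        rw [← h1, ← Finset.sum_erase_add _ _ (mem_univ z), zz, hP.hz, map_zero, map_zero, iterate_map_zero, map_zero, add_zero]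
      intro i k
      refine ⟨(ih i k).2, ?_⟩
      rw [st]
      by_cases hi : i = z
      · rw [zz, hi, hP.symm, hP.hz, map_zero, map_zero, iterate_map_zero, map_zero]
      by_cases hk : k = z
      · rw [zz, hk, hP.hz, map_zero, map_zero, iterate_map_zero, map_zero]
      by_cases hik : i = k
      · subst hik
        rw [sum_congr rfl (fun j hj => dia j i (Finset.ne_of_mem_erase hj) hi), Finset.sum_const, smul_eq_zero] at tr
        refine tr.resolve_left ?_
        rw [Finset.card_erase_of_mem (mem_univ z), Finset.card_univ, Fintype.card_fin]; omega
      · exact off i k hi hk hik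
  exact zero_of_rho z _ fun a => (main a i k).1

end PA


namespace Bg
variable {n : ℕ} {A : Type*} [CommRing A] [Algebra ℝ A] (b : Bg n A)

/-- admissible weights -/
structure Wt (φ : Fin n → Fin n → Fin n → Fin n → A) : Prop where
  a1 : ∀ i j k l, φ i j k l = - φ j i k l
  a2 : ∀ i j k l, φ i j k l = - φ i j l k
  t : ∀ j l, ∑ i, φ i j i l = 0
  c : ∀ m i j k l, b.D m (φ i j k l) = 0

lemma half_zero' (a : A) (h : a = - a) : a = 0 := by
  have : a = (1 / 2 : ℝ) • (a + a) := by rw [← two_smul ℝ a, smul_smul]; norm_num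
  rw [this]; nth_rw 1 [h]; simp

lemma anti_sum (g : Fin n → Fin n → A) (h : ∀ i j, g i j = - g j i) : ∑ i, ∑ j, g i j = 0 := by
  apply half_zero'
  conv_lhs => rw [sum_comm]
  rw [← Finset.sum_neg_distrib]
  refine sum_congr rfl fun i _ => ?_
  rw [← Finset.sum_neg_distrib]
  exact sum_congr rfl fun j _ => h j i

variable {φ : Fin n → Fin n → Fin n → Fin n → A} (hφ : b.Wt φ)

/-- curvature component -/
def Pc (φ : Fin n → Fin n → Fin n → Fin n → A) (T : Fin n → Fin n → A) : A :=
  ∑ i, ∑ j, ∑ k, ∑ l, φ i j k l * b.D i (b.D k (T j l))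

def G1 (φ : Fin n → Fin n → Fin n → Fin n → A) (T : Fin n → Fin n → A) (i : Fin n) : A :=
  ∑ j, ∑ k, ∑ l, φ i j k l * b.Qt T j l k
def G2 (φ : Fin n → Fin n → Fin n → Fin n → A) (T : Fin n → Fin n → A) (k : Fin n) : A :=
  ∑ i, ∑ j, ∑ l, φ i j k l * b.Qt T j l i

include hφ in
lemma Pc_S (V : Fin n → A) : b.Pc φ (b.S V) = 0 := by
  unfold Pc
  have e : ∀ i j k l, φ i j k l * b.D i (b.D k (b.S V j l)) =
      φ i j k l * b.D i (b.D j (b.D k (V l))) + φ i j k l * b.D k (b.D l (b.D i (V j)))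
      - (if j = l then φ i j k l * (2 * b.ν * b.D i (b.D k (b.th V))) else 0) := by
    intro i j k l
    rw [D_S, map_sub, map_add, b.comm k j, b.comm i k, b.comm i l]
    split_ifs
    · rw [D_mul, D_mul, D2, b.Dν]; ring
    · rw [map_zero]; ring
  simp only [e, sum_add_distrib, sum_sub_distrib, sum_ite_eq, mem_univ, if_true]
  have h1 : ∑ i, ∑ j, ∑ k, ∑ l, φ i j k l * b.D i (b.D j (b.D k (V l))) = 0 := by
    refine anti_sum _ fun i j => ?_
    simp only [← Finset.sum_neg_distrib]
    refine sum_congr rfl fun k _ => sum_congr rfl fun l _ => ?_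
    rw [hφ.a1, b.comm i j]; ring
  have h2 : ∑ i, ∑ j, ∑ k, ∑ l, φ i j k l * b.D k (b.D l (b.D i (V j))) = 0 := by
    refine sum_eq_zero fun i _ => sum_eq_zero fun j _ => anti_sum _ fun k l => ?_
    rw [hφ.a2, b.comm k l]; ring
  have h3 : ∑ i, ∑ j, ∑ k, φ i j k j * (2 * b.ν * b.D i (b.D k (b.th V))) = 0 := by
    refine sum_eq_zero fun i _ => ?_
    rw [sum_comm]
    refine sum_eq_zero fun k _ => ?_
    rw [← sum_mul]
    have : ∑ j, φ i j k j = ∑ j, φ j i j k := sum_congr rfl fun j _ => by rw [hφ.a1, hφ.a2, neg_neg]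
    rw [this, hφ.t, zero_mul]
  rw [h1, h2, h3]; ring

variable {T : Fin n → Fin n → A} (hT : ∀ i k, T i k = T k i)

include hφ hT in
lemma G1_eq (i : Fin n) : b.G1 φ T i = ∑ j, ∑ k, ∑ l, φ i j k l * (b.D k (T j l) - b.p k * T j l) := by
  unfold G1
  have e : ∀ j k l, φ i j k l * b.Qt T j l k = φ i j k l * b.D k (T j l) + φ i j k l * (b.p j * T l k)
      + φ i j k l * (b.p l * T j k) - (if l = k then φ i j k l * b.dot T j else 0)
      - (if j = k then φ i j k l * b.dot T l else 0) := by
    intro j k l; unfold Qt; split_ifs <;> ring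
  simp only [e, mul_sub, sum_add_distrib, sum_sub_distrib, sum_ite_eq', mem_univ, if_true]
  have z2 : ∀ i j k, φ i j k k = 0 := fun i j k => half_zero' _ (hφ.a2 i j k k)
  have h1 : ∑ j, ∑ k, ∑ l, φ i j k l * (b.p j * T l k) = 0 :=
    sum_eq_zero fun j _ => anti_sum _ fun k l => by rw [hφ.a2, hT k l]; ring
  have h2 : ∑ j, ∑ k, ∑ l, φ i j k l * (b.p l * T j k) = - ∑ j, ∑ k, ∑ l, φ i j k l * (b.p k * T j l) := by
    simp only [← Finset.sum_neg_distrib]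
    refine sum_congr rfl fun j _ => ?_
    rw [sum_comm]
    refine sum_congr rfl fun k _ => sum_congr rfl fun l _ => ?_
    rw [hφ.a2]; ring
  have h3 : ∑ j, ∑ k, ∑ l, (if j = k then φ i j k l * b.dot T l else 0) = 0 := by
    rw [sum_comm]
    have : ∀ k, ∑ j, ∑ l, (if j = k then φ i j k l * b.dot T l else 0) = ∑ l, φ i k k l * b.dot T l := by
      intro k
      rw [sum_comm]
      simp only [sum_ite_eq', mem_univ, if_true]
    simp only [this]
    rw [sum_comm]
    refine sum_eq_zero fun l _ => ?_
    rw [← sum_mul]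
    have : ∑ k, φ i k k l = - ∑ k, φ k i k l := by
      rw [← Finset.sum_neg_distrib]; exact sum_congr rfl fun k _ => hφ.a1 _ _ _ _
    rw [this, hφ.t]; ring
  rw [h1, h2, h3]
  simp only [z2]
  simp
  ring

include hφ hT in
lemma G2_eq (k : Fin n) : b.G2 φ T k = ∑ i, ∑ j, ∑ l, φ i j k l * (b.D i (T j l) - b.p i * T j l) := by
  unfold G2
  have e : ∀ i j l, φ i j k l * b.Qt T j l i = φ i j k l * b.D i (T j l) + φ i j k l * (b.p j * T l i)
      + φ i j k l * (b.p l * T j i) - (if l = i then φ i j k l * b.dot T j else 0)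
      - (if j = i then φ i j k l * b.dot T l else 0) := by
    intro i j l; unfold Qt; split_ifs <;> ring
  simp only [e, mul_sub, sum_add_distrib, sum_sub_distrib, sum_ite_eq', mem_univ, if_true]
  have h1 : ∑ i, ∑ j, ∑ l, φ i j k l * (b.p l * T j i) = 0 :=
    anti_sum _ fun i j => by
      rw [← Finset.sum_neg_distrib]
      exact sum_congr rfl fun l _ => by rw [hφ.a1, hT i j]; ring
  have h2 : ∑ i, ∑ j, ∑ l, φ i j k l * (b.p j * T l i) = - ∑ i, ∑ j, ∑ l, φ i j k l * (b.p i * T j l) := by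
    simp only [← Finset.sum_neg_distrib]
    rw [sum_comm]
    refine sum_congr rfl fun i _ => sum_congr rfl fun j _ => sum_congr rfl fun l _ => ?_
    rw [hφ.a1, hT l j]; ring
  have h3 : ∑ i, ∑ j, φ i j k i * b.dot T j = 0 := by
    rw [sum_comm]
    refine sum_eq_zero fun j _ => ?_
    rw [← sum_mul]
    have : ∑ i, φ i j k i = - ∑ i, φ i j i k := by
      rw [← Finset.sum_neg_distrib]; exact sum_congr rfl fun k _ => hφ.a2 _ _ _ _
    rw [this, hφ.t]; ring
  have h4 : ∑ i, ∑ j, ∑ l, (if j = i then φ i j k l * b.dot T l else 0) = 0 := by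
    refine sum_eq_zero fun i _ => sum_eq_zero fun j _ => sum_eq_zero fun l _ => ?_
    split_ifs with h
    · subst h; rw [half_zero' _ (hφ.a1 j j k l), zero_mul]
    · rfl
  rw [h1, h2, h3, h4]; ring

include hφ hT in
lemma Pc_eq : b.Pc φ T = ∑ i, b.D i (b.G1 φ T i) + ∑ k, b.p k * b.G2 φ T k := by
  simp only [b.G1_eq hφ hT, b.G2_eq hφ hT]
  have e1 : ∑ i, b.D i (∑ j, ∑ k, ∑ l, φ i j k l * (b.D k (T j l) - b.p k * T j l)) =
      ∑ i, ∑ j, ∑ k, ∑ l, (φ i j k l * b.D i (b.D k (T j l)) - φ i j k l * (b.p k * b.D i (T j l))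
        + φ i j k l * (b.p k * b.p i * T j l) - (if k = i then φ i j k l * (b.κ * b.s * T j l) else 0)) := by
    refine sum_congr rfl fun i _ => ?_
    simp only [map_sum]
    refine sum_congr rfl fun j _ => sum_congr rfl fun k _ => sum_congr rfl fun l _ => ?_
    rw [D_mul, hφ.c, map_sub, D_mul, b.Dp]
    split_ifs <;> ring
  have e2 : ∑ k, b.p k * ∑ i, ∑ j, ∑ l, φ i j k l * (b.D i (T j l) - b.p i * T j l) =
      ∑ i, ∑ j, ∑ k, ∑ l, (φ i j k l * (b.p k * b.D i (T j l)) - φ i j k l * (b.p k * b.p i * T j l)) := by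
    simp only [mul_sum]
    rw [sum_comm]
    refine sum_congr rfl fun i _ => ?_
    rw [sum_comm]
    refine sum_congr rfl fun j _ => sum_congr rfl fun k _ => sum_congr rfl fun l _ => ?_
    ring
  have e3 : ∑ i, ∑ j, ∑ k, ∑ l, (if k = i then φ i j k l * (b.κ * b.s * T j l) else 0) = 0 := by
    have : ∀ i j, ∑ k, ∑ l, (if k = i then φ i j k l * (b.κ * b.s * T j l) else 0) =
        ∑ l, φ i j i l * (b.κ * b.s * T j l) := by
      intro i j
      rw [sum_comm]
      simp only [sum_ite_eq', mem_univ, if_true]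
    simp only [this]
    rw [sum_comm]
    refine sum_eq_zero fun j _ => ?_
    rw [sum_comm]
    refine sum_eq_zero fun l _ => ?_
    rw [← sum_mul, hφ.t, zero_mul]
  rw [e1, e2]
  simp only [sum_add_distrib, sum_sub_distrib, e3]
  unfold Pc
  ring

end Bg


/-- polynomials as smooth functions -/
def toSF {n : ℕ} : MvPolynomial (Fin n) ℝ →ₐ[ℝ] SF n := MvPolynomial.aeval SF.X

namespace PB
variable {n d : ℕ}
open SF

lemma De_toSF (i : Fin n) (p : MvPolynomial (Fin n) ℝ) :
    De i (toSF p) = toSF (MvPolynomial.pderiv i p) := by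
  induction p using MvPolynomial.induction_on with
  | C a =>
    rw [MvPolynomial.pderiv_C, map_zero]
    have : (toSF (MvPolynomial.C a) : SF n) = cst a := by
      unfold toSF; rw [MvPolynomial.aeval_C]; rfl
    rw [this, De_cst]
  | add p q hp hq => simp only [map_add, hp, hq]
  | mul_X p j hp =>
    have e : (toSF (MvPolynomial.X j) : SF n) = X j := by unfold toSF; rw [MvPolynomial.aeval_X]
    have e1 : (MvPolynomial.pderiv i) (MvPolynomial.X j : MvPolynomial (Fin n) ℝ) = if j = i then 1 else 0 := PA.pX i j
    rw [map_mul, Derivation.leibniz, Derivation.leibniz, hp, e, De_X, e1, map_add, smul_eq_mul, smul_eq_mul, smul_eq_mul, smul_eq_mul,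
      map_mul, map_mul, e]
    congr 1
    split_ifs <;> simp

lemma ev_toSF (x : Euc n) (p : MvPolynomial (Fin n) ℝ) : ev x (toSF p) = MvPolynomial.eval (fun i => x i) p := by
  have : ((ev x).comp (toSF (n := n)).toRingHom) = (MvPolynomial.eval fun i => x i) := by
    apply MvPolynomial.ringHom_ext
    · intro r
      simp only [RingHom.comp_apply, MvPolynomial.eval_C]
      change ev x (toSF (MvPolynomial.C r)) = r
      unfold toSF; rw [MvPolynomial.aeval_C]; rfl
    · intro i
      simp only [RingHom.comp_apply, MvPolynomial.eval_X]
      change ev x (toSF (MvPolynomial.X i)) = _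
      unfold toSF; rw [MvPolynomial.aeval_X]; rfl
  exact congrArg (fun f => f p) this

variable (n d) in
/-- coefficient index type -/
abbrev Ix := Fin n × Fin n × (MIdx n d)

def mono (α : Fin n → ℕ) : MvPolynomial (Fin n) ℝ := MvPolynomial.monomial (Finsupp.equivFunOnFinite.symm α) 1

lemma mono_eval (α : Fin n → ℕ) (x : Fin n → ℝ) : MvPolynomial.eval x (mono α) = ∏ m, x m ^ α m := by
  unfold mono
  rw [MvPolynomial.eval_monomial, one_mul, Finsupp.prod_fintype]
  · rfl
  · intro i; simp

lemma mono_hom (α : Fin n → ℕ) : (mono α).IsHomogeneous (∑ m, α m) := by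
  unfold mono
  refine MvPolynomial.isHomogeneous_monomial _ ?_
  rw [Finsupp.degree_eq_sum]; rfl

/-- the tensor -/
def HP (h : Ix n d → ℝ) (i k : Fin n) : MvPolynomial (Fin n) ℝ := ∑ α : MIdx n d, h (i, k, α) • mono α.1

lemma HP_add (h g : Ix n d → ℝ) (i k : Fin n) : HP (h + g) i k = HP h i k + HP g i k := by
  simp [HP, add_smul, sum_add_distrib]
lemma HP_smul (c : ℝ) (h : Ix n d → ℝ) (i k : Fin n) : HP (c • h) i k = c • HP h i k := by
  simp [HP, mul_smul, Finset.smul_sum]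
lemma HP_zero (i k : Fin n) : HP (0 : Ix n d → ℝ) i k = 0 := by simp [HP]

lemma HP_coeff (h : Ix n d → ℝ) (i k : Fin n) (α : MIdx n d) :
    MvPolynomial.coeff (Finsupp.equivFunOnFinite.symm α.1) (HP h i k) = h (i, k, α) := by
  unfold HP mono
  rw [MvPolynomial.coeff_sum, Finset.sum_eq_single α]
  · simp
  · intro β _ hb
    rw [MvPolynomial.coeff_smul, MvPolynomial.coeff_monomial, if_neg]; · simp
    intro e
    exact hb (Subtype.ext (Finsupp.equivFunOnFinite.symm.injective e))
  · simp

lemma HP_low (h : Ix n d → ℝ) (i k : Fin n) (q : ℕ) (hq : q < 2) :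
    MvPolynomial.homogeneousComponent q (HP h i k) = 0 := by
  unfold HP
  rw [map_sum]
  refine sum_eq_zero fun α _ => ?_
  rw [map_smul, MvPolynomial.homogeneousComponent_of_mem (mono_hom α.1), if_neg, smul_zero]
  have := (Finset.mem_filter.mp α.2).2.1
  omega

/-- constraint space -/
def Wc (z : Fin n) : Submodule ℝ (Ix n d → ℝ) where
  carrier := {h | (∀ i k, HP h i k = HP h k i) ∧ (∑ i, HP h i i = 0) ∧ (∀ i, HP h i z = 0) ∧
    (∀ i, PA.rho z (∑ k, MvPolynomial.X k * HP h k i) = 0) ∧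
    (∀ i k, PA.rho z (MvPolynomial.pderiv z (HP h i k)) = 0)}
  add_mem' := by
    rintro a b ⟨a1, a2, a3, a4, a5⟩ ⟨b1, b2, b3, b4, b5⟩
    refine ⟨fun i k => ?_, ?_, fun i => ?_, fun i => ?_, fun i k => ?_⟩
    · rw [HP_add, HP_add, a1, b1]
    · simp only [HP_add, sum_add_distrib, a2, b2, add_zero]
    · rw [HP_add, a3, b3, add_zero]
    · simp only [HP_add, mul_add, sum_add_distrib]
      rw [map_add, a4, b4, add_zero]
    · rw [HP_add, map_add, map_add, a5, b5, add_zero]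
  zero_mem' := by
    refine ⟨fun i k => ?_, ?_, fun i => ?_, fun i => ?_, fun i k => ?_⟩ <;> simp [HP_zero]
  smul_mem' := by
    rintro c a ⟨a1, a2, a3, a4, a5⟩
    refine ⟨fun i k => ?_, ?_, fun i => ?_, fun i => ?_, fun i k => ?_⟩
    · rw [HP_smul, HP_smul, a1]
    · simp only [HP_smul, ← Finset.smul_sum, a2, smul_zero]
    · rw [HP_smul, a3, smul_zero]
    · simp only [HP_smul, mul_smul_comm, ← Finset.smul_sum]
      rw [map_smul, a4, smul_zero]
    · rw [HP_smul, Derivation.map_smul, map_smul, a5, smul_zero]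

lemma Wc_PCon (z : Fin n) (h : Ix n d → ℝ) (hh : h ∈ Wc z) : PA.PCon z (HP h) := by
  obtain ⟨a1, a2, a3, a4, a5⟩ := hh
  exact ⟨a1, a2, a3, a4, a5, fun i k => HP_low h i k 0 (by norm_num), fun i k => HP_low h i k 1 (by norm_num)⟩

lemma zero_of_HP (h : Ix n d → ℝ) (hh : ∀ i k, HP h i k = 0) : h = 0 := by
  ext ⟨i, k, α⟩
  have := HP_coeff h i k α
  rw [hh] at this; simpa using this.symm

/-- function-level constraints give membership -/
lemma mem_Wc (z : Fin n) (h : Ix n d → ℝ)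
    (h1 : ∀ i k (x : Euc n), ev x (toSF (HP h i k)) = ev x (toSF (HP h k i)))
    (h2 : ∀ x : Euc n, ∑ i, ev x (toSF (HP h i i)) = 0)
    (h3 : ∀ x : Euc n, 0 ≤ x z → ∀ i, ev x (toSF (HP h i z)) = 0)
    (h4 : ∀ x : Euc n, x z = 0 → ∀ i, ∑ k, ev x (toSF (HP h i k)) * x k = 0)
    (h5 : ∀ x : Euc n, x z = 0 → ∀ i k, ev x (De z (toSF (HP h i k))) = 0) : h ∈ Wc z := by
  have E : ∀ (y : Fin n → ℝ) (p : MvPolynomial (Fin n) ℝ), MvPolynomial.eval y p = ev (WithLp.toLp 2 y) (toSF p) := by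
    intro y p; rw [ev_toSF]
  have a1 : ∀ i k, HP h i k = HP h k i := fun i k => MvPolynomial.funext fun y => by
    rw [E, E, h1]
  have R : ∀ p : MvPolynomial (Fin n) ℝ, (∀ x : Euc n, x z = 0 → ev x (toSF p) = 0) → PA.rho z p = 0 := by
    intro p hp
    refine MvPolynomial.funext fun y => ?_
    rw [map_zero]
    have : (MvPolynomial.aeval y : MvPolynomial {i : Fin n // i ≠ z} ℝ →ₐ[ℝ] ℝ).comp (PA.rho z) =
      MvPolynomial.aeval (fun i => if h : i ≠ z then y ⟨i, h⟩ else 0) := by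
      apply MvPolynomial.algHom_ext
      intro i
      simp only [AlgHom.comp_apply, PA.rho, MvPolynomial.aeval_X]
      split_ifs <;> simp
    have t := congrArg (fun f => f p) this
    simp only [AlgHom.comp_apply, MvPolynomial.aeval_eq_eval] at t
    rw [t]
    have := E (fun i => if h : i ≠ z then y ⟨i, h⟩ else 0) p
    rw [this]
    refine hp _ (by simp)
  refine ⟨a1, ?_, fun i => ?_, fun i => ?_, fun i k => ?_⟩
  · refine MvPolynomial.funext fun y => ?_
    rw [map_sum, map_zero]
    simp only [E, h2]
  · refine MvPolynomial.funext_set (fun _ : Fin n => Set.Ici (0:ℝ)) (fun _ => Set.Ici_infinite 0) ?_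
    intro y hy
    rw [E, h3 _ (hy z (Set.mem_univ z)), map_zero]
  · refine R _ fun x hx => ?_
    rw [ev_toSF, map_sum]
    rw [← h4 x hx i]
    refine sum_congr rfl fun k _ => ?_
    rw [ev_toSF, map_mul, MvPolynomial.eval_X, a1 k i, mul_comm]
  · refine R _ fun x hx => ?_
    rw [← De_toSF]; exact h5 x hx i k

end PB


namespace PB
variable {n d : ℕ}

variable (n) in
/-- quadruples of sign vectors -/
abbrev Ph := (Fin n → SignType) × (Fin n → SignType) × (Fin n → SignType) × (Fin n → SignType)

def sg (a : Fin n → SignType) (i : Fin n) : ℝ := ((a i : SignType) : ℝ)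

open Classical in
/-- weights -/
def wt (f : Ph n) (i j k l : Fin n) : ℝ :=
  if (∑ m, sg f.1 m * sg f.2.2.1 m = 0 ∧ ∑ m, sg f.1 m * sg f.2.2.2 m = 0 ∧
    ∑ m, sg f.2.1 m * sg f.2.2.1 m = 0 ∧ ∑ m, sg f.2.1 m * sg f.2.2.2 m = 0) then
  (sg f.1 i * sg f.2.1 j - sg f.1 j * sg f.2.1 i) * (sg f.2.2.1 k * sg f.2.2.2 l - sg f.2.2.1 l * sg f.2.2.2 k) else 0

lemma wt_tr (f : Ph n) (j l : Fin n) : ∑ i, wt f i j i l = 0 := by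
  unfold wt
  split_ifs with h
  · obtain ⟨h1, h2, h3, h4⟩ := h
    have : ∀ i, (sg f.1 i * sg f.2.1 j - sg f.1 j * sg f.2.1 i) * (sg f.2.2.1 i * sg f.2.2.2 l - sg f.2.2.1 l * sg f.2.2.2 i) =
      (sg f.2.1 j * sg f.2.2.2 l) * (sg f.1 i * sg f.2.2.1 i) - (sg f.2.1 j * sg f.2.2.1 l) * (sg f.1 i * sg f.2.2.2 i)
      - (sg f.1 j * sg f.2.2.2 l) * (sg f.2.1 i * sg f.2.2.1 i) + (sg f.1 j * sg f.2.2.1 l) * (sg f.2.1 i * sg f.2.2.2 i) := by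
      intro i; ring
    simp only [this, sum_add_distrib, sum_sub_distrib, ← mul_sum, h1, h2, h3, h4]
    ring
  · simp

lemma wt_Wt (b : Bg n (SF n)) (hb : b.D = SF.De) (f : Ph n) : b.Wt (fun i j k l => SF.cst (wt f i j k l)) := by
  refine ⟨fun i j k l => ?_, fun i j k l => ?_, fun j l => ?_, fun m i j k l => ?_⟩
  · have : wt f i j k l = - wt f j i k l := by unfold wt; split_ifs <;> ring
    rw [this]; unfold SF.cst; rw [map_neg]
  · have : wt f i j k l = - wt f i j l k := by unfold wt; split_ifs <;> ring
    rw [this]; unfold SF.cst; rw [map_neg]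
  · unfold SF.cst; rw [← map_sum, wt_tr, map_zero]
  · rw [hb, SF.De_cst]

/-- polynomial curvature component -/
def PP (f : Ph n) (H : Fin n → Fin n → MvPolynomial (Fin n) ℝ) : MvPolynomial (Fin n) ℝ :=
  ∑ i, ∑ j, ∑ k, ∑ l, wt f i j k l • MvPolynomial.pderiv i (MvPolynomial.pderiv k (H j l))

/-- basis sum -/
lemma single_sum (c : Fin n → Fin n → Fin n → Fin n → MvPolynomial (Fin n) ℝ) (i j k l : Fin n) :
    ∑ i', ∑ j', ∑ k', ∑ l', ((if i' = i then (1:ℝ) else 0) * (if j' = j then 1 else 0) * (if k' = k then 1 else 0) * (if l' = l then 1 else 0)) • c i' j' k' l' = c i j k l := by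
  rw [Finset.sum_eq_single i, Finset.sum_eq_single j, Finset.sum_eq_single k, Finset.sum_eq_single l]
  all_goals try simp
  all_goals intros; simp_all

lemma PP_eq (f : Ph n) (H : Fin n → Fin n → MvPolynomial (Fin n) ℝ)
    (h : ∑ m, sg f.1 m * sg f.2.2.1 m = 0 ∧ ∑ m, sg f.1 m * sg f.2.2.2 m = 0 ∧
    ∑ m, sg f.2.1 m * sg f.2.2.1 m = 0 ∧ ∑ m, sg f.2.1 m * sg f.2.2.2 m = 0) :
    PP f H = ∑ i, ∑ j, ∑ k, ∑ l, (sg f.1 i * sg f.2.1 j * sg f.2.2.1 k * sg f.2.2.2 l) • PA.Dc H i j k l := by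
  unfold PP wt
  simp only [if_pos h]
  set a := sg f.1
  set b := sg f.2.1
  set c := sg f.2.2.1
  set e := sg f.2.2.2
  set G : Fin n → Fin n → Fin n → Fin n → MvPolynomial (Fin n) ℝ := fun i j k l => MvPolynomial.pderiv i (MvPolynomial.pderiv k (H j l)) with hG
  have e1 : ∀ i j k l, ((a i * b j - a j * b i) * (c k * e l - c l * e k)) • MvPolynomial.pderiv i (MvPolynomial.pderiv k (H j l)) =
    (a i * b j * c k * e l) • G i j k l - (a j * b i * c k * e l) • G i j k l - (a i * b j * c l * e k) • G i j k l
     + (a j * b i * c l * e k) • G i j k l := by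
    intro i j k l; simp only [hG]; module
  have e2 : ∀ i j k l, (a i * b j * c k * e l) • PA.Dc H i j k l =
    (a i * b j * c k * e l) • G i j k l - (a i * b j * c k * e l) • G j i k l - (a i * b j * c k * e l) • G i j l k
     + (a i * b j * c k * e l) • G j i l k := by
    intro i j k l; simp only [hG, PA.Dc]; module
  simp only [e1, e2, sum_add_distrib, sum_sub_distrib]
  have S2 : ∑ i, ∑ j, ∑ k, ∑ l, (a j * b i * c k * e l) • G i j k l = ∑ i, ∑ j, ∑ k, ∑ l, (a i * b j * c k * e l) • G j i k l := sum_comm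
  have S3 : ∑ i, ∑ j, ∑ k, ∑ l, (a i * b j * c l * e k) • G i j k l = ∑ i, ∑ j, ∑ k, ∑ l, (a i * b j * c k * e l) • G i j l k :=
    sum_congr rfl fun i _ => sum_congr rfl fun j _ => sum_comm
  have S4 : ∑ i, ∑ j, ∑ k, ∑ l, (a j * b i * c l * e k) • G i j k l = ∑ i, ∑ j, ∑ k, ∑ l, (a i * b j * c k * e l) • G j i l k := by
    rw [sum_comm]
    exact sum_congr rfl fun i _ => sum_congr rfl fun j _ => sum_comm
  rw [S2, S3, S4]

/-- e_i -/
def se (i : Fin n) : Fin n → SignType := fun m => if m = i then 1 else 0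
/-- e_i + e_l -/
def sp (i l : Fin n) : Fin n → SignType := fun m => if m = i then 1 else if m = l then 1 else 0
/-- e_i - e_l -/
def sn (i l : Fin n) : Fin n → SignType := fun m => if m = i then 1 else if m = l then -1 else 0

lemma sg_se (i m : Fin n) : sg (se i) m = if m = i then 1 else 0 := by
  unfold sg se; split_ifs <;> simp
lemma sg_sp (i l m : Fin n) (h : i ≠ l) : sg (sp i l) m = (if m = i then 1 else 0) + (if m = l then 1 else 0) := by
  unfold sg sp; split_ifs <;> simp_all
lemma sg_sn (i l m : Fin n) (h : i ≠ l) : sg (sn i l) m = (if m = i then 1 else 0) - (if m = l then 1 else 0) := by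
  unfold sg sn; split_ifs <;> simp_all

lemma Dc_pair {H : Fin n → Fin n → MvPolynomial (Fin n) ℝ} (hs : ∀ i k, H i k = H k i) (i j k l : Fin n) :
    PA.Dc H i j k l = PA.Dc H k l i j := by
  unfold PA.Dc
  rw [PA.pcomm k i, PA.pcomm l i, PA.pcomm k j, PA.pcomm l j, hs l j, hs k j, hs l i, hs k i]; ring
lemma Dc_anti (H : Fin n → Fin n → MvPolynomial (Fin n) ℝ) (i j k l : Fin n) :
    PA.Dc H i j k l = - PA.Dc H j i k l := by
  unfold PA.Dc; ring
lemma Dc_anti' (H : Fin n → Fin n → MvPolynomial (Fin n) ℝ) (i j k l : Fin n) :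
    PA.Dc H i j k l = - PA.Dc H i j l k := by
  unfold PA.Dc; ring

theorem flat_of_PP (H : Fin n → Fin n → MvPolynomial (Fin n) ℝ) (hs : ∀ i k, H i k = H k i) (h : ∀ f, PP f H = 0) : PA.Flat (PA.Dc H) := by
  have ha : ∀ i j k l : Fin n, i ≠ j → i ≠ k → i ≠ l → j ≠ k → j ≠ l → k ≠ l → PA.Dc H i j k l = 0 := by
    intro i j k l h1 h2 h3 h4 h5 h6
    have t := h (se i, se j, se k, se l)
    rw [PP_eq] at t
    · simp only [sg_se, single_sum] at t; exact t
    · simp [sg_se, h1, h2, h3, h4, h5, h6, Ne.symm h2, Ne.symm h3, Ne.symm h4, Ne.symm h5]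
  have hb : ∀ i j k l : Fin n, i ≠ j → i ≠ k → i ≠ l → j ≠ k → j ≠ l → k ≠ l → PA.Dc H i j i k = PA.Dc H l j l k := by
    intro i j k l h1 h2 h3 h4 h5 h6
    have t := h (sp i l, se j, sn i l, se k)
    rw [PP_eq] at t
    · simp only [sg_se, sg_sp _ _ _ h3, sg_sn _ _ _ h3] at t
      have e : ∀ a b c d e f : ℝ, ∀ P : MvPolynomial (Fin n) ℝ, ((a + b) * c * (d - e) * f) • P =
        (a * c * d * f) • P - (a * c * e * f) • P + (b * c * d * f) • P - (b * c * e * f) • P := by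
        intros; module
      simp only [e, sum_add_distrib, sum_sub_distrib, single_sum] at t
      have q1 := ha i j l k h1 h3 h2 h5 h4 h6.symm
      have q2 := ha l j i k h5.symm h3.symm h6.symm h1.symm h4 h2
      rw [q1, q2] at t
      linear_combination t
    · simp only [sg_se, sg_sp _ _ _ h3, sg_sn _ _ _ h3]
      simp [add_mul, mul_sub, sum_add_distrib, sum_sub_distrib, h1, h2, h3, h4, h5, h6, Ne.symm h1, Ne.symm h2, Ne.symm h3, Ne.symm h4, Ne.symm h5, Ne.symm h6]
  refine ⟨ha, hb, ?_⟩
  intro i j k l h1 h2 h3 h4 h5 h6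
  have t := h (sp i l, sp j k, sn i l, sn j k)
  rw [PP_eq] at t
  · simp only [sg_se, sg_sp _ _ _ h3, sg_sn _ _ _ h3, sg_sp _ _ _ h4, sg_sn _ _ _ h4] at t
    have e : ∀ a b c d e f g h : ℝ, ∀ P : MvPolynomial (Fin n) ℝ, ((a + b) * (c + d) * (e - f) * (g - h)) • P =
        (a * c * e * g) • P - (a * c * e * h) • P - (a * c * f * g) • P + (a * c * f * h) • P
        + (a * d * e * g) • P - (a * d * e * h) • P - (a * d * f * g) • P + (a * d * f * h) • P
        + (b * c * e * g) • P - (b * c * e * h) • P - (b * c * f * g) • P + (b * c * f * h) • P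
        + (b * d * e * g) • P - (b * d * e * h) • P - (b * d * f * g) • P + (b * d * f * h) • P := by
        intros; module
    simp only [e, sum_add_distrib, sum_sub_distrib, single_sum] at t
    have q1 := ha i j l k h1 h3 h2 h5 h4 h6.symm
    have q2 := ha l j i k h5.symm h3.symm h6.symm h1.symm h4 h2
    have q3 := ha i k l j h2 h3 h1 h6 h4.symm h5.symm
    have q4 := ha l k i j h6.symm h3.symm h5.symm h2.symm h4.symm h1
    have p1 : PA.Dc H i j i k = PA.Dc H l j l k := hb i j k l h1 h2 h3 h4 h5 h6
    have p2 : PA.Dc H i k i j = PA.Dc H l k l j := hb i k j l h2 h1 h3 h4.symm h6 h5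
    have p3 : PA.Dc H i j l j = PA.Dc H i k l k := by
      have := hb j i l k h1.symm h5 h4 h3 h2 h6.symm
      rw [Dc_anti H i j, Dc_anti' H j i, Dc_anti H i k, Dc_anti' H k i, this]
    have p4 : PA.Dc H l j i j = PA.Dc H l k i k := by
      rw [Dc_pair hs l j, Dc_pair hs l k, p3]
    have s1 : PA.Dc H k l k l = PA.Dc H l k l k := by rw [Dc_anti, Dc_anti']; ring
    have s2 : PA.Dc H j l j l = PA.Dc H l j l j := by rw [Dc_anti, Dc_anti']; ring
    rw [q1, q2, q3, q4] at t
    rw [s1, s2]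
    linear_combination t + p1 - p2 + p3 - p4
  · simp only [sg_se, sg_sp _ _ _ h3, sg_sn _ _ _ h3, sg_sp _ _ _ h4, sg_sn _ _ _ h4]
    simp [add_mul, mul_sub, sum_add_distrib, sum_sub_distrib, h1, h2, h3, h4, h5, h6, Ne.symm h1, Ne.symm h2, Ne.symm h3, Ne.symm h4, Ne.symm h5, Ne.symm h6]

/-- definiteness -/
theorem PP_def (hn : 6 ≤ n) (z : Fin n) (h : Ix n d → ℝ) (hh : h ∈ Wc z) (h0 : ∀ f, PP f (HP h) = 0) : h = 0 := by
  have P := Wc_PCon z h hh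
  exact zero_of_HP h (PA.mainB hn z _ P (flat_of_PP _ P.symm h0))

end PB


namespace PB
variable {n d : ℕ}
open SF

lemma De_loc (f : SF n) (x : Euc n) (h : (f : Euc n → ℝ) =ᶠ[nhds x] 0) (i : Fin n) : ev x (De i f) = 0 := by
  rw [ev_De]; unfold pd; rw [h.fderiv_eq]; simp

lemma chi_ex (z : Fin n) : ∃ χ : SF n, ∃ x0 : Euc n, (∀ x, 0 ≤ ev x χ) ∧ (∀ x ∈ ball x0 (1/8), ev x χ = 1) ∧
    ball x0 (1/8) ⊆ hB z 2 ∧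
    (∀ x : Euc n, ¬ (1 < ‖x‖ ∧ ‖x‖ < 2 ∧ 0 < x z) → (χ : Euc n → ℝ) =ᶠ[nhds x] 0) := by
  set x0 : Euc n := EuclideanSpace.single z (3/2) with hx0
  let g : ContDiffBump x0 := ⟨1/8, 1/4, by norm_num, by norm_num⟩
  have nx0 : ‖x0‖ = 3/2 := by rw [hx0, EuclideanSpace.norm_single]; norm_num
  have key : ∀ x : Euc n, dist x x0 ≤ 1/4 → (1 < ‖x‖ ∧ ‖x‖ < 2 ∧ 0 < x z) := by
    intro x hx
    rw [dist_eq_norm] at hx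
    have h1 : ‖x‖ ≤ ‖x - x0‖ + ‖x0‖ := by simpa using norm_add_le (x - x0) x0
    have h2 : ‖x0‖ ≤ ‖x - x0‖ + ‖x‖ := by
      have := norm_sub_le x (x - x0); simp only [sub_sub_cancel] at this; linarith
    have h3 : |(x - x0) z| ≤ ‖x - x0‖ := by simpa using PiLp.norm_apply_le (x - x0) z
    have h4 : (x - x0) z = x z - 3/2 := by simp [hx0]
    rw [h4] at h3
    have := (abs_le.mp (h3.trans hx)).1
    refine ⟨by linarith, by linarith, by linarith⟩
  refine ⟨⟨fun x => g x, g.contDiff⟩, x0, fun x => g.nonneg, fun x hx => ?_, fun x hx => ?_, fun x hx => ?_⟩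
  · exact g.one_of_mem_closedBall (ball_subset_closedBall hx)
  · have := key x (by rw [mem_ball] at hx; linarith)
    refine ⟨by simpa using this.2.1, this.2.2.le⟩
  · have : x ∉ tsupport g := by
      rw [g.tsupport_eq]
      intro h
      exact hx (key x (by simpa [g] using h))
    exact notMem_tsupport_iff_eventuallyEq.mp this

lemma lin_bd {ι : Type*} [Fintype ι] [DecidableEq ι] (L : (ι → ℝ) →ₗ[ℝ] SF n) (R : ℝ) :
    ∃ K : ℝ, 0 < K ∧ ∀ h : ι → ℝ, ∀ x : Euc n, ‖x‖ ≤ R → (ev x (L h)) ^ 2 ≤ K * ∑ i, h i ^ 2 := by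
  have hc : ContinuousOn (fun x : Euc n => ∑ i : ι, (ev x (L (Pi.single i 1))) ^ 2) (closedBall 0 R) := by
    refine Continuous.continuousOn (continuous_finsetSum _ fun i _ => (SF.ev_cont _).pow 2)
  obtain ⟨K, hK⟩ := (isCompact_closedBall (0 : Euc n) R).exists_bound_of_continuousOn hc
  refine ⟨|K| + 1, by positivity, fun h x hx => ?_⟩
  have e : ev x (L h) = ∑ i, h i * ev x (L (Pi.single i 1)) := by
    conv_lhs => rw [LinearMap.pi_apply_eq_sum_univ L h]
    rw [map_sum]
    refine sum_congr rfl fun i _ => ?_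
    have : (fun j => if i = j then (1:ℝ) else 0) = Pi.single i 1 := by
      ext j; rw [Pi.single_apply]; simp [eq_comm]
    rw [this, ev_eq, Subalgebra.coe_smul]; rfl
  rw [e]
  refine (Finset.sum_mul_sq_le_sq_mul_sq _ _ _).trans ?_
  rw [mul_comm]
  refine mul_le_mul_of_nonneg_right ?_ (sum_nonneg fun i _ => sq_nonneg _)
  have := hK x (by simpa using hx)
  have := (le_abs_self _).trans (this.trans (le_abs_self K))
  linarith

/-- linear curvature map -/
def PL (f : Ph n) : (Ix n d → ℝ) →ₗ[ℝ] SF n where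
  toFun h := toSF (PP f (HP h))
  map_add' a b := by
    unfold PP
    simp only [HP_add, map_add, smul_add, sum_add_distrib]
  map_smul' c a := by
    unfold PP
    simp only [HP_smul, Derivation.map_smul, RingHom.id_apply]
    rw [← map_smul]
    simp only [Finset.smul_sum, smul_comm c]

lemma poly_zero (p : MvPolynomial (Fin n) ℝ) (x0 : Euc n) (r : ℝ) (hr : 0 < r) (h : ∀ x ∈ ball x0 r, ev x (toSF p) = 0) : p = 0 := by
  have ho : IsOpen ((fun y : Fin n → ℝ => (WithLp.toLp 2 y : Euc n)) ⁻¹' ball x0 r) :=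
    isOpen_ball.preimage (PiLp.continuous_toLp 2 _)
  obtain ⟨η, hη, hs⟩ := Metric.isOpen_iff.mp ho (fun i => x0 i) (by simpa using hr)
  refine MvPolynomial.funext_set (fun i => ball (x0 i) η) (fun i => ?_) ?_
  · rw [Real.ball_eq_Ioo]; exact Set.Ioo_infinite (by linarith)
  · intro y hy
    rw [map_zero]
    have : y ∈ ball (fun i => x0 i) η := by rw [ball_pi _ hη]; exact hy
    have := h _ (hs this)
    rwa [ev_toSF] at this

/-- norm square -/
def nsq {ι : Type*} [Fintype ι] (h : ι → ℝ) : ℝ := ∑ i, h i ^ 2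

lemma nsq_nonneg {ι : Type*} [Fintype ι] (h : ι → ℝ) : 0 ≤ nsq h := sum_nonneg fun i _ => sq_nonneg _

theorem posdef (hn : 6 ≤ n) (z : Fin n) (χ : SF n) (x0 : Euc n) (h0 : ∀ x, 0 ≤ ev x χ) (h1 : ∀ x ∈ ball x0 (1/8), ev x χ = 1)
    (h2 : ball x0 (1/8) ⊆ hB z 2) : ∃ c0 : ℝ, 0 < c0 ∧ ∀ h : Ix n d → ℝ, h ∈ Wc z →
      c0 * nsq h ≤ ∑ f, ∫ x in hB z 2, ev x (χ * PL f h ^ 2) := by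
  set q : (Ix n d → ℝ) → ℝ := fun h => ∑ f, ∫ x in hB z 2, ev x (χ * PL f h ^ 2) with hq
  have qs : ∀ (c : ℝ) h, q (c • h) = c ^ 2 * q h := by
    intro c h
    simp only [hq, mul_sum]
    refine sum_congr rfl fun f _ => ?_
    rw [← integral_const_mul]
    refine integral_congr_ae (Filter.Eventually.of_forall fun x => ?_)
    simp only [map_mul, map_pow, map_smul]
    have : ev x (c • PL f h) = c * ev x (PL f h) := by rw [ev_eq, Subalgebra.coe_smul]; rfl
    rw [this]; ring
  have qn : ∀ (h : Ix n d → ℝ) f, 0 ≤ ∫ x in hB z 2, ev x (χ * PL f h ^ 2) := by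
    intro h f
    refine integral_nonneg fun x => ?_
    simp only [map_mul, map_pow]; exact mul_nonneg (h0 x) (sq_nonneg _)
  have qc : Continuous q := by
    have e : q = fun h => ∑ f, ∑ a, ∑ b, h a * h b * ∫ x in hB z 2, ev x (χ * (PL f (Pi.single a 1) * PL f (Pi.single b 1))) := by
      funext h
      simp only [hq]
      refine sum_congr rfl fun f _ => ?_
      have : ∀ x, ev x (χ * PL f h ^ 2) = ∑ a, ∑ b, h a * h b * ev x (χ * (PL f (Pi.single a 1) * PL f (Pi.single b 1))) := by
        intro x
        have e : ev x (PL f h) = ∑ i, h i * ev x (PL f (Pi.single i 1)) := by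
          conv_lhs => rw [LinearMap.pi_apply_eq_sum_univ (PL f) h]
          rw [map_sum]
          refine sum_congr rfl fun i _ => ?_
          have : (fun j => if i = j then (1:ℝ) else 0) = Pi.single i 1 := by
            ext j; rw [Pi.single_apply]; simp [eq_comm]
          rw [this, ev_eq, Subalgebra.coe_smul]; rfl
        simp only [map_mul, map_pow]
        rw [e, sq, Finset.sum_mul_sum, mul_sum]
        refine sum_congr rfl fun a _ => ?_
        rw [mul_sum]
        refine sum_congr rfl fun b _ => ?_
        ring
      simp only [this]
      rw [integral_finsetSum]
      · refine sum_congr rfl fun a _ => ?_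
        rw [integral_finsetSum]
        · refine sum_congr rfl fun b _ => ?_
          rw [integral_const_mul]
        · intro b _
          exact hB_int z 2 _ (continuous_const.mul (SF.ev_cont _))
      · intro a _
        exact hB_int z 2 _ (continuous_finsetSum _ fun b _ => continuous_const.mul (SF.ev_cont _))
    rw [e]
    refine continuous_finsetSum _ fun f _ => continuous_finsetSum _ fun a _ => continuous_finsetSum _ fun b _ => ?_
    fun_prop
  have qp : ∀ h ∈ Wc z, h ≠ 0 → 0 < q h := by
    intro h hh hne
    refine lt_of_le_of_ne (sum_nonneg fun f _ => qn h f) fun hz => hne ?_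
    have hz' := (Finset.sum_eq_zero_iff_of_nonneg fun f _ => qn h f).mp hz.symm
    refine PP_def hn z h hh fun f => ?_
    have hf := hz' f (mem_univ f)
    have hi : IntegrableOn (fun x => ev x (χ * PL f h ^ 2)) (hB z 2) := hB_int z 2 _ (SF.ev_cont _)
    have hae := (integral_eq_zero_iff_of_nonneg_ae (Filter.Eventually.of_forall fun x => by
      simp only [map_mul, map_pow]; exact mul_nonneg (h0 x) (sq_nonneg _)) hi).mp hf
    have hae2 := ae_mono (Measure.restrict_mono h2 le_rfl) hae
    have := Measure.eqOn_open_of_ae_eq hae2 isOpen_ball (SF.ev_cont _).continuousOn continuousOn_const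
    refine poly_zero _ x0 (1/8) (by norm_num) fun x hx => ?_
    have t := this hx
    simp only [map_mul, map_pow, h1 x hx, one_mul] at t
    exact (pow_eq_zero_iff two_ne_zero).mp t
  set Sx : Set (Ix n d → ℝ) := sphere 0 1 ∩ (Wc z : Submodule ℝ (Ix n d → ℝ)) with hSx
  have hcomp : IsCompact Sx := (isCompact_sphere 0 1).inter_right (Submodule.closed_of_finiteDimensional _)
  have hNb : ∀ h : Ix n d → ℝ, nsq h ≤ (Fintype.card (Ix n d)) * ‖h‖ ^ 2 := by
    intro h
    unfold nsq
    calc ∑ i, h i ^ 2 ≤ ∑ i : Ix n d, ‖h‖ ^ 2 := sum_le_sum fun i _ => by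
          have := norm_le_pi_norm h i
          rw [← sq_abs]; exact pow_le_pow_left₀ (abs_nonneg _) this 2
      _ = _ := by simp
  have : ∃ m : ℝ, 0 < m ∧ ∀ h ∈ Sx, m ≤ q h := by
    rcases Sx.eq_empty_or_nonempty with he | hne
    · exact ⟨1, one_pos, fun h hh => by rw [he] at hh; exact hh.elim⟩
    · obtain ⟨a, ha, hm⟩ := hcomp.exists_isMinOn hne qc.continuousOn
      refine ⟨q a, qp a ha.2 ?_, fun h hh => hm hh⟩
      intro e0; rw [e0] at ha; have := ha.1; simp at this
  obtain ⟨m, hm, hmq⟩ := this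
  refine ⟨m / (Fintype.card (Ix n d) + 1), by positivity, fun h hh => ?_⟩
  have key : m * ‖h‖ ^ 2 ≤ q h := by
    by_cases hz : h = 0
    · rw [hz]; simp only [norm_zero]
      have := sum_nonneg fun f (_ : f ∈ Finset.univ) => qn (0 : Ix n d → ℝ) f
      have e : m * (0:ℝ) ^ 2 = 0 := by ring
      rw [e]; exact this
    · have hp : 0 < ‖h‖ := norm_pos_iff.mpr hz
      have hs : ‖h‖⁻¹ • h ∈ Sx := by
        refine ⟨?_, Submodule.smul_mem _ _ hh⟩
        simp [norm_smul, hp.ne']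
      have := hmq _ hs
      rw [qs] at this
      have e : q h = ‖h‖ ^ 2 * (‖h‖⁻¹ ^ 2 * q h) := by field_simp
      rw [e, mul_comm]
      exact mul_le_mul_of_nonneg_left this (by positivity)
  refine le_trans ?_ key
  rw [div_mul_eq_mul_div, div_le_iff₀ (by positivity)]
  have := hNb h
  nlinarith [mul_nonneg hm.le (sq_nonneg ‖h‖), mul_le_mul_of_nonneg_left this hm.le]

end PB


namespace PB
variable {n d : ℕ}
open SF

/-- half annulus -/
abbrev An (z : Fin n) (r : ℝ) : Set (Euc n) := hB z (2 * r) ∩ {x | r ≤ ‖x‖}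

lemma An_meas (z : Fin n) (r : ℝ) : MeasurableSet (An z r) :=
  (hB_meas z _).inter (isClosed_le continuous_const continuous_norm).measurableSet

lemma An_int (z : Fin n) (r : ℝ) (f : Euc n → ℝ) (hf : Continuous f) : IntegrableOn f (An z r) :=
  (hB_int z (2 * r) f hf).mono_set Set.inter_subset_left

/-- sum of squares of Q -/
def QQ (b : Bg n (SF n)) (T : Fin n → Fin n → SF n) : SF n := ∑ i, ∑ k, ∑ l, (b.Qt T i k l) ^ 2

lemma tri_nonneg (Q : Fin n → Fin n → Fin n → ℝ) : 0 ≤ ∑ i, ∑ k, ∑ l, Q i k l ^ 2 :=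
  sum_nonneg fun i _ => sum_nonneg fun k _ => sum_nonneg fun l _ => sq_nonneg _

lemma QQ_nonneg (b : Bg n (SF n)) (T : Fin n → Fin n → SF n) (x : Euc n) : 0 ≤ ev x (QQ b T) := by
  simp only [QQ, map_sum, map_pow]; exact tri_nonneg _

lemma tri_cs (φ Q : Fin n → Fin n → Fin n → ℝ) : (∑ i, ∑ j, ∑ k, φ i j k * Q i j k) ^ 2 ≤
    (∑ i, ∑ j, ∑ k, φ i j k ^ 2) * ∑ i, ∑ j, ∑ k, Q i j k ^ 2 := by
  have := Finset.sum_mul_sq_le_sq_mul_sq (Finset.univ : Finset (Fin n × Fin n × Fin n)) (fun p => φ p.1 p.2.1 p.2.2) (fun p => Q p.1 p.2.1 p.2.2)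
  simpa only [Fintype.sum_prod_type] using this

/-- weight size -/
def wM (f : Ph n) : ℝ := ∑ i, ∑ j, ∑ k, ∑ l, wt f i j k l ^ 2

lemma G1_bd (b : Bg n (SF n)) (T : Fin n → Fin n → SF n) (f : Ph n) (i : Fin n) (x : Euc n) :
    (ev x (b.G1 (fun i j k l => cst (wt f i j k l)) T i)) ^ 2 ≤ wM f * ev x (QQ b T) := by
  unfold Bg.G1 QQ wM
  simp only [map_sum, map_mul, ev_cst, map_pow]
  have e : ∑ i, ∑ j, ∑ k, ev x (b.Qt T i j k) ^ 2 = ∑ j, ∑ k, ∑ l, ev x (b.Qt T j l k) ^ 2 :=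
    sum_congr rfl fun i _ => sum_comm
  rw [e]
  refine (tri_cs (fun j k l => wt f i j k l) fun j k l => ev x (b.Qt T j l k)).trans ?_
  refine mul_le_mul_of_nonneg_right ?_ ?_
  · exact single_le_sum (f := fun i => ∑ j, ∑ k, ∑ l, wt f i j k l ^ 2) (fun i _ => by positivity) (mem_univ i)
  · exact tri_nonneg _

lemma G2_bd (b : Bg n (SF n)) (T : Fin n → Fin n → SF n) (f : Ph n) (k : Fin n) (x : Euc n) :
    (ev x (b.G2 (fun i j k l => cst (wt f i j k l)) T k)) ^ 2 ≤ wM f * ev x (QQ b T) := by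
  unfold Bg.G2 QQ wM
  simp only [map_sum, map_mul, ev_cst, map_pow]
  have e : ∑ i, ∑ j, ∑ k, ev x (b.Qt T i j k) ^ 2 = ∑ i, ∑ j, ∑ l, ev x (b.Qt T j l i) ^ 2 := by
    conv_rhs => rw [sum_comm]
    exact sum_congr rfl fun i _ => sum_comm
  rw [e]
  refine (tri_cs (fun i j l => wt f i j k l) fun i j l => ev x (b.Qt T j l i)).trans ?_
  refine mul_le_mul_of_nonneg_right ?_ ?_
  · refine sum_le_sum fun i _ => sum_le_sum fun j _ => ?_
    exact single_le_sum (f := fun k => ∑ l, wt f i j k l ^ 2) (fun i _ => by positivity) (mem_univ k)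
  · exact tri_nonneg _

lemma wM_nonneg (f : Ph n) : 0 ≤ wM f := by unfold wM; positivity

lemma Pc_T (hn : 6 ≤ n) (ε : ℝ) (hε : 0 < ε) (f : Ph n) (h : Ix n d → ℝ) (V : Fin n → SF n) :
    (bub n hn ε hε).Pc (fun i j k l => cst (wt f i j k l)) (fun i k => toSF (HP h i k) - (bub n hn ε hε).S V i k) = PL f h := by
  have h1 := (bub n hn ε hε).Pc_S (wt_Wt (bub n hn ε hε) rfl f) V
  have h2 : (bub n hn ε hε).Pc (fun i j k l => cst (wt f i j k l)) (fun i k => toSF (HP h i k)) = PL f h := by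
    change _ = toSF (PP f (HP h))
    unfold Bg.Pc PP
    simp only [map_sum, map_smul]
    refine sum_congr rfl fun i _ => sum_congr rfl fun j _ => sum_congr rfl fun k _ => sum_congr rfl fun l _ => ?_
    change cst _ * De i (De k _) = _
    rw [De_toSF, De_toSF, Algebra.smul_def]; rfl
  rw [← h2, ← sub_zero (Bg.Pc _ _ fun i k => toSF (HP h i k)), ← h1]
  unfold Bg.Pc
  simp only [← sum_sub_distrib, map_sub, mul_sub]

set_option maxHeartbeats 1000000 in
theorem loc_f (hn : 6 ≤ n) (z : Fin n) (χ : SF n) (h0 : ∀ x, 0 ≤ ev x χ)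
    (hχ : ∀ x : Euc n, ¬ (1 < ‖x‖ ∧ ‖x‖ < 2 ∧ 0 < x z) → (χ : Euc n → ℝ) =ᶠ[nhds x] 0) (f : Ph n) :
    ∃ K M : ℝ, 0 ≤ K ∧ 0 ≤ M ∧ ∀ θ : ℝ, 0 < θ → ∀ ε (hε : 0 < ε) (h : Ix n d → ℝ) (V : Fin n → SF n), h ∈ Wc z →
      ∫ x in hB z 2, ev x (χ * PL f h ^ 2) ≤ θ * K * nsq h + M / θ *
        ∫ x in An z 1, ev x (QQ (bub n hn ε hε) (fun i k => toSF (HP h i k) - (bub n hn ε hε).S V i k)) := by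
  obtain ⟨K0, hK0, B0⟩ := lin_bd ((LinearMap.mulLeft ℝ χ).comp (PL (d := d) f)) 2
  have hD : ∀ i : Fin n, ∃ K : ℝ, 0 < K ∧ ∀ h : Ix n d → ℝ, ∀ x : Euc n, ‖x‖ ≤ 2 → (ev x (De i (χ * PL f h))) ^ 2 ≤ K * ∑ j, h j ^ 2 :=
    fun i => lin_bd ((De i : SF n →ₗ[ℝ] SF n).comp ((LinearMap.mulLeft ℝ χ).comp (PL (d := d) f))) 2
  choose K1 hK1 B1 using hD
  set v : ℝ := volume.real (An z 1) with hv
  have hv0 : 0 ≤ v := measureReal_nonneg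
  refine ⟨(∑ i, (K0 + K1 i)) * v, 2 * n * wM f, mul_nonneg (sum_nonneg fun i _ => (add_pos hK0 (hK1 i)).le) hv0,
    by have := wM_nonneg f; positivity, ?_⟩
  intro θ hθ ε hε h V hh
  set b := bub n hn ε hε with hb
  set T : Fin n → Fin n → SF n := fun i k => toSF (HP h i k) - b.S V i k with hT
  set φ : Fin n → Fin n → Fin n → Fin n → SF n := fun i j k l => cst (wt f i j k l) with hφ
  have hTs : ∀ i k, T i k = T k i := fun i k => by
    simp only [hT]; rw [(Wc_PCon z h hh).symm, b.S_symm]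
  have e1 : PL f h = ∑ i, b.D i (b.G1 φ T i) + ∑ k, b.p k * b.G2 φ T k := by
    rw [← b.Pc_eq (wt_Wt b rfl f) hTs]; exact (Pc_T hn ε hε f h V).symm
  set P : SF n := PL f h with hP
  have zloc : ∀ x : Euc n, ¬ (1 < ‖x‖ ∧ ‖x‖ < 2 ∧ 0 < x z) → ((χ * P : SF n) : Euc n → ℝ) =ᶠ[nhds x] 0 := by
    intro x hx
    filter_upwards [hχ x hx] with y hy
    change (χ : Euc n → ℝ) y * _ = 0
    rw [hy]; simp
  have z0 : ∀ x : Euc n, ¬ (1 < ‖x‖ ∧ ‖x‖ < 2 ∧ 0 < x z) → ev x (χ * P) = 0 := fun x hx => (zloc x hx).eq_of_nhds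
  have z1 : ∀ x : Euc n, ¬ (1 < ‖x‖ ∧ ‖x‖ < 2 ∧ 0 < x z) → ∀ i, ev x (De i (χ * P)) = 0 := fun x hx i => De_loc _ _ (zloc x hx) i
  have dv := divThm z (fun i => χ * P * b.G1 φ T i) 2 (by norm_num) (fun i x hx => by
      change ev x (χ * P * _) = 0
      rw [map_mul, z0 x (by intro h; linarith [h.2.1]), zero_mul]) (fun x hx => by
      change ev x (χ * P * _) = 0
      rw [map_mul, z0 x (by intro h; linarith [h.2.2]), zero_mul])
  have pw : ∀ x : Euc n, ∑ i, pd i ((χ * P * b.G1 φ T i : SF n) : Euc n → ℝ) x =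
      ev x (χ * P ^ 2) - (∑ i, (ev x (χ * P) * ev x (b.p i) * ev x (b.G2 φ T i) - ev x (De i (χ * P)) * ev x (b.G1 φ T i))) := by
    intro x
    have : ∀ i, pd i ((χ * P * b.G1 φ T i : SF n) : Euc n → ℝ) x = ev x (χ * P) * ev x (b.D i (b.G1 φ T i)) + ev x (b.G1 φ T i) * ev x (De i (χ * P)) := by
      intro i
      rw [← ev_De, Derivation.leibniz, map_add, smul_eq_mul, smul_eq_mul, map_mul, map_mul (ev x) (b.G1 φ T i)]; rfl
    simp only [this, sum_add_distrib, sum_sub_distrib, ← mul_sum]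
    have e2 : ev x P = ∑ i, ev x (b.D i (b.G1 φ T i)) + ∑ k, ev x (b.p k) * ev x (b.G2 φ T k) := by
      rw [e1, map_add, map_sum, map_sum]; simp only [map_mul]
    have e3 : ev x (χ * P ^ 2) = ev x (χ * P) * ev x P := by simp only [map_mul, map_pow]; ring
    have ep : ∑ i, ev x (χ * P) * ev x (b.p i) * ev x (b.G2 φ T i) = ev x (χ * P) * ∑ i, ev x (b.p i) * ev x (b.G2 φ T i) := by
      simp only [mul_assoc, ← mul_sum]
    have : ∑ i, ev x (b.G1 φ T i) * ev x (De i (χ * P)) = ∑ i, ev x (De i (χ * P)) * ev x (b.G1 φ T i) :=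
      sum_congr rfl fun i _ => mul_comm _ _
    rw [this, e3, ep]; linear_combination (-(ev x (χ * P))) * e2
  simp only [pw] at dv
  set g : Euc n → ℝ := fun x => ev x (χ * P ^ 2) with hg
  set R : Euc n → ℝ := fun x => ∑ i, (ev x (χ * P) * ev x (b.p i) * ev x (b.G2 φ T i) - ev x (De i (χ * P)) * ev x (b.G1 φ T i)) with hR
  have gc : Continuous g := SF.ev_cont _
  have Rc : Continuous R := continuous_finsetSum _ fun i _ =>
    (((SF.ev_cont _).mul (SF.ev_cont _)).mul (SF.ev_cont _)).sub ((SF.ev_cont _).mul (SF.ev_cont _))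
  have outside : ∀ x : Euc n, x ∉ An z 1 → 0 ≤ x z → ¬ (1 < ‖x‖ ∧ ‖x‖ < 2 ∧ 0 < x z) := by
    intro x hx hz hc
    exact hx ⟨⟨by simpa using hc.2.1, hz⟩, hc.1.le⟩
  have g0 : ∀ x : Euc n, ¬ (1 < ‖x‖ ∧ ‖x‖ < 2 ∧ 0 < x z) → g x = 0 := by
    intro x hx
    have : g x = ev x (χ * P) * ev x P := by simp only [hg, map_mul, map_pow]; ring
    rw [this, z0 x hx, zero_mul]
  have R0 : ∀ x : Euc n, ¬ (1 < ‖x‖ ∧ ‖x‖ < 2 ∧ 0 < x z) → R x = 0 := by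
    intro x hx
    simp only [hR]
    refine sum_eq_zero fun i _ => ?_
    rw [z0 x hx, z1 x hx i]; ring
  have hAs : An z 1 ⊆ {x : Euc n | 0 ≤ x z} := fun x hx => hx.1.2
  have i1 : ∫ x in An z 1, (g x - R x) = 0 := by
    rw [← dv]
    symm
    refine setIntegral_eq_of_subset_of_forall_sdiff_eq_zero (measurableSet_le measurable_const (by fun_prop)) hAs ?_
    intro x hx
    have := outside x hx.2 hx.1
    change g x - R x = 0
    rw [g0 x this, R0 x this, sub_zero]
  have i2 : ∫ x in hB z 2, g x = ∫ x in An z 1, g x := by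
    refine setIntegral_eq_of_subset_of_forall_sdiff_eq_zero (hB_meas z 2) ?_ ?_
    · intro x hx; have := hx.1; rwa [mul_one] at this
    · intro x hx; exact g0 x (outside x hx.2 hx.1.2)
  rw [i2]
  rw [integral_sub (An_int z 1 g gc) (An_int z 1 R Rc), sub_eq_zero] at i1
  rw [i1]
  have bd : ∀ x ∈ An z 1, R x ≤ θ * (∑ i, (K0 + K1 i)) * nsq h + (2 * n * wM f / θ) * ev x (QQ b T) := by
    intro x hx
    have hx2 : ‖x‖ ≤ 2 := by have := hx.1.1; rw [mul_one, mem_ball_zero_iff] at this; exact this.le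
    have hx1 : 1 ≤ ‖x‖ := hx.2
    simp only [hR]
    have eM : ∀ q : ℝ, (2 * n * wM f / θ) * q = ∑ i : Fin n, (2 * wM f / θ) * q := by intro q; simp; ring
    have eK : θ * (∑ i, (K0 + K1 i)) * nsq h = ∑ i, θ * (K0 + K1 i) * nsq h := by rw [mul_sum, sum_mul]
    rw [eM, eK, ← sum_add_distrib]
    refine sum_le_sum fun i _ => ?_
    have c0 : (ev x (χ * P)) ^ 2 ≤ K0 * nsq h := B0 h x hx2
    have c1 : (ev x (De i (χ * P))) ^ 2 ≤ K1 i * nsq h := B1 i h x hx2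
    have c2 := G1_bd b T f i x
    have c3 := G2_bd b T f i x
    have c4 : (ev x (b.p i)) ^ 2 ≤ 4 := by
      rw [hb, Bub.ev_p, div_pow, div_le_iff₀ (by positivity)]
      have : |x i| ≤ ‖x‖ := by simpa using PiLp.norm_apply_le x i
      have h1 : x i ^ 2 ≤ ‖x‖ ^ 2 := by rw [← sq_abs]; exact pow_le_pow_left₀ (abs_nonneg _) this 2
      have h2 : 1 ≤ ‖x‖ ^ 2 := by nlinarith
      nlinarith [sq_nonneg ε, mul_nonneg (sq_nonneg ε) (sq_nonneg ‖x‖), sq_nonneg (ε ^ 2)]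
    have y : ∀ a c : ℝ, a * c ≤ θ * a ^ 2 + c ^ 2 / (4 * θ) := by
      intro a c
      have : θ * a ^ 2 + c ^ 2 / (4 * θ) - a * c = (2 * θ * a - c) ^ 2 / (4 * θ) := by field_simp; ring
      have h2 : 0 ≤ (2 * θ * a - c) ^ 2 / (4 * θ) := by positivity
      linarith
    have y1 := y (ev x (χ * P)) (ev x (b.p i) * ev x (b.G2 φ T i))
    have y2 := y (ev x (De i (χ * P))) (- ev x (b.G1 φ T i))
    have w0 : 0 ≤ wM f * ev x (QQ b T) := (sq_nonneg _).trans c2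
    have c5 : (ev x (b.p i) * ev x (b.G2 φ T i)) ^ 2 / (4 * θ) ≤ (wM f * ev x (QQ b T)) / θ := by
      rw [div_le_div_iff₀ (by positivity) hθ, mul_pow]
      have := mul_le_mul c4 c3 (sq_nonneg _) (by norm_num)
      nlinarith
    have c6 : (- ev x (b.G1 φ T i)) ^ 2 / (4 * θ) ≤ (wM f * ev x (QQ b T)) / θ := by
      rw [neg_sq, div_le_div_iff₀ (by positivity) hθ]
      nlinarith
    have c7 := mul_le_mul_of_nonneg_left c0 hθ.le
    have c8 := mul_le_mul_of_nonneg_left c1 hθ.le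
    have e9 : 2 * wM f / θ * ev x (QQ b T) = wM f * ev x (QQ b T) / θ + wM f * ev x (QQ b T) / θ := by ring
    rw [e9]
    linarith
  have j1 : IntegrableOn (fun _ : Euc n => θ * (∑ i, (K0 + K1 i)) * nsq h) (An z 1) := An_int z 1 _ continuous_const
  have j2 : IntegrableOn (fun x : Euc n => (2 * n * wM f / θ) * ev x (QQ b T)) (An z 1) :=
    An_int z 1 _ (continuous_const.mul (SF.ev_cont (QQ b T)))
  have j3 : IntegrableOn (fun x : Euc n => θ * (∑ i, (K0 + K1 i)) * nsq h + (2 * n * wM f / θ) * ev x (QQ b T)) (An z 1) := j1.add j2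
  refine (setIntegral_mono_on (An_int z 1 R Rc) j3 (An_meas z 1) bd).trans (le_of_eq ?_)
  have j4 : ∫ x in An z 1, (2 * n * wM f / θ) * ev x (QQ b T) = (2 * n * wM f / θ) * ∫ x in An z 1, ev x (QQ b T) := integral_const_mul _ _
  have j5 : ∫ x in An z 1, (θ * (∑ i, (K0 + K1 i)) * nsq h) = v * (θ * (∑ i, (K0 + K1 i)) * nsq h) := by
    rw [setIntegral_const, smul_eq_mul]
  rw [integral_add j1 j2, j4, j5]
  ring

theorem loc1 (hn : 6 ≤ n) (z : Fin n) (d : ℕ) : ∃ C : ℝ, 0 < C ∧ ∀ ε (hε : 0 < ε) (h : Ix n d → ℝ) (V : Fin n → SF n), h ∈ Wc z →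
      nsq h ≤ C * ∫ x in An z 1, ev x (QQ (bub n hn ε hε) (fun i k => toSF (HP h i k) - (bub n hn ε hε).S V i k)) := by
  obtain ⟨χ, x0, a1, a2, a3, a4⟩ := chi_ex z
  obtain ⟨c0, hc0, hc⟩ := posdef (d := d) hn z χ x0 a1 a2 a3
  choose K M hK hM hL using loc_f (d := d) hn z χ a1 a4
  have hK' : 0 ≤ ∑ f, K f := sum_nonneg fun f _ => hK f
  have hM' : 0 ≤ ∑ f, M f := sum_nonneg fun f _ => hM f
  set θ := c0 / (2 * (∑ f, K f + 1)) with hθ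
  have hθ0 : 0 < θ := by positivity
  refine ⟨2 / c0 * ((∑ f, M f) / θ + 1), by positivity, fun ε hε h V hh => ?_⟩
  have h1 := hc h hh
  have h2 := h1.trans (sum_le_sum fun f _ => hL f θ hθ0 ε hε h V hh)
  set I := ∫ x in An z 1, ev x (QQ (bub n hn ε hε) (fun i k => toSF (HP h i k) - (bub n hn ε hε).S V i k)) with hI
  have hI0 : 0 ≤ I := integral_nonneg fun x => QQ_nonneg _ _ x
  rw [sum_add_distrib, ← sum_mul, ← sum_mul, ← mul_sum, ← Finset.sum_div] at h2
  have h3 : θ * (∑ f, K f) ≤ c0 / 2 := by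
    rw [hθ, div_mul_eq_mul_div, div_le_div_iff₀ (by positivity) (by norm_num)]
    nlinarith
  have h4 := mul_le_mul_of_nonneg_right h3 (nsq_nonneg h)
  have h5 : c0 / 2 * nsq h ≤ ((∑ f, M f) / θ + 1) * I := by nlinarith
  calc nsq h = 2 / c0 * (c0 / 2 * nsq h) := by field_simp
    _ ≤ 2 / c0 * (((∑ f, M f) / θ + 1) * I) := mul_le_mul_of_nonneg_left h5 (by positivity)
    _ = _ := by ring
end PB


namespace PB
variable {n d : ℕ}
open SF
open scoped Pointwise

/-- dilation -/
def sc (r : ℝ) : SF n →+* SF n where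
  toFun f := ⟨fun x => (f : Euc n → ℝ) (r • x), (sm f).comp (g := (f : Euc n → ℝ)) (f := fun x : Euc n => r • x) (by fun_prop)⟩
  map_one' := rfl
  map_zero' := rfl
  map_mul' _ _ := rfl
  map_add' _ _ := rfl

lemma ev_sc (r : ℝ) (x : Euc n) (f : SF n) : ev x (sc r f) = ev (r • x) f := rfl
lemma sc_cst (r c : ℝ) : sc r (cst c : SF n) = cst c := rfl

lemma ext_ev {f g : SF n} (h : ∀ x, ev x f = ev x g) : f = g := Subtype.ext (funext h)

lemma De_sc (r : ℝ) (f : SF n) (i : Fin n) : De i (sc r f) = cst r * sc r (De i f) := by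
  refine ext_ev fun x => ?_
  rw [map_mul, ev_cst, ev_sc, ev_De, ev_De]
  unfold pd
  change fderiv ℝ (fun x => (f : Euc n → ℝ) (r • x)) x _ = _
  have h1 : HasFDerivAt (fun x : Euc n => r • x) (r • ContinuousLinearMap.id ℝ (Euc n)) x :=
    (hasFDerivAt_id x).const_smul r
  have h2 := ((da f (r • x)).hasFDerivAt).comp x h1
  have h3 := h2.fderiv
  change fderiv ℝ (fun x => (f : Euc n → ℝ) (r • x)) x = _ at h3
  rw [h3]; simp

/-- function-level constraints -/
structure FC (z : Fin n) (h : Ix n d → ℝ) : Prop where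
  h1 : ∀ i k (x : Euc n), ev x (toSF (HP h i k)) = ev x (toSF (HP h k i))
  h2 : ∀ x : Euc n, ∑ i, ev x (toSF (HP h i i)) = 0
  h3 : ∀ x : Euc n, 0 ≤ x z → ∀ i, ev x (toSF (HP h i z)) = 0
  h4 : ∀ x : Euc n, x z = 0 → ∀ i, ∑ k, ev x (toSF (HP h i k)) * x k = 0
  h5 : ∀ x : Euc n, x z = 0 → ∀ i k, ev x (De z (toSF (HP h i k))) = 0

/-- scaled coefficients -/
def hs (r : ℝ) (h : Ix n d → ℝ) : Ix n d → ℝ := fun p => h p * r ^ (∑ m, p.2.2.1 m)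

lemma mono_sc (r : ℝ) (α : Fin n → ℕ) (x : Euc n) : ev (r • x) (toSF (mono α)) = r ^ (∑ m, α m) * ev x (toSF (mono α)) := by
  rw [ev_toSF, ev_toSF, mono_eval, mono_eval, ← Finset.prod_pow_eq_pow_sum, ← Finset.prod_mul_distrib]
  refine Finset.prod_congr rfl fun m _ => ?_
  rw [PiLp.smul_apply, smul_eq_mul, mul_pow]

lemma ev_smul (c : ℝ) (x : Euc n) (f : SF n) : ev x (c • f) = c * ev x f := by
  rw [ev_eq, Subalgebra.coe_smul]; rfl

lemma HP_sc (r : ℝ) (h : Ix n d → ℝ) (i k : Fin n) : toSF (HP (hs r h) i k) = sc r (toSF (HP h i k)) := by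
  refine ext_ev fun x => ?_
  rw [ev_sc]
  simp only [HP, map_sum, map_smul]
  refine sum_congr rfl fun α _ => ?_
  rw [ev_smul, ev_smul, mono_sc, hs]; ring

lemma FC.scale {z : Fin n} {h : Ix n d → ℝ} (H : FC z h) (r : ℝ) (hr : 0 < r) : FC z (hs r h) := by
  have e : ∀ (x : Euc n), (r • x) z = r * x z := fun x => by rw [PiLp.smul_apply, smul_eq_mul]
  refine ⟨fun i k x => ?_, fun x => ?_, fun x hx i => ?_, fun x hx i => ?_, fun x hx i k => ?_⟩
  · rw [HP_sc, HP_sc, ev_sc, ev_sc]; exact H.h1 i k _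
  · simp only [HP_sc, ev_sc]; exact H.h2 _
  · rw [HP_sc, ev_sc]; exact H.h3 _ (by rw [e]; positivity) i
  · have := H.h4 (r • x) (by rw [e, hx, mul_zero]) i
    simp only [HP_sc, ev_sc]
    simp only [PiLp.smul_apply, smul_eq_mul] at this
    have e2 : ∑ k, ev (r • x) (toSF (HP h i k)) * (r * x k) = r * ∑ k, ev (r • x) (toSF (HP h i k)) * x k := by
      rw [mul_sum]; exact sum_congr rfl fun k _ => by ring
    rw [e2] at this
    exact (mul_eq_zero.mp this).resolve_left hr.ne'
  · rw [HP_sc, De_sc, map_mul, ev_sc, H.h5 (r • x) (by rw [e, hx, mul_zero]), mul_zero]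

lemma FC.mem {z : Fin n} {h : Ix n d → ℝ} (H : FC z h) : h ∈ Wc z := mem_Wc z h H.h1 H.h2 H.h3 H.h4 H.h5

lemma S_sc (hn : 6 ≤ n) (ε ε' : ℝ) (hε : 0 < ε) (hε' : 0 < ε') (r : ℝ) (hr : 0 < r) (V : Fin n → SF n) (i k : Fin n) :
    (bub n hn ε' hε').S (fun i => cst r⁻¹ * sc r (V i)) i k = sc r ((bub n hn ε hε).S V i k) := by
  have eD : ∀ i j, (bub n hn ε' hε').D i (cst r⁻¹ * sc r (V j)) = sc r ((bub n hn ε hε).D i (V j)) := by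
    intro i j
    change De i _ = sc r (De i (V j))
    rw [Derivation.leibniz, De_cst, De_sc, smul_zero, add_zero, smul_eq_mul, ← mul_assoc]
    have : (cst r⁻¹ * cst r : SF n) = 1 := by
      unfold cst; rw [← map_mul, inv_mul_cancel₀ hr.ne', map_one]
    rw [this, one_mul]
  have et : (bub n hn ε' hε').th (fun i => cst r⁻¹ * sc r (V i)) = sc r ((bub n hn ε hε).th V) := by
    unfold Bg.th; rw [map_sum]; exact sum_congr rfl fun i _ => eD i i
  unfold Bg.S
  rw [eD, eD, et, map_sub, map_add]
  congr 1
  split_ifs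
  · rw [map_mul, map_mul, map_ofNat (sc r) 2]; rfl
  · rw [map_zero]

lemma p_sc (hn : 6 ≤ n) (ε : ℝ) (hε : 0 < ε) (r : ℝ) (hr : 0 < r) (i : Fin n) :
    (bub n hn (ε / r) (div_pos hε hr)).p i = cst r * sc r ((bub n hn ε hε).p i) := by
  refine ext_ev fun x => ?_
  rw [map_mul, ev_cst, ev_sc, Bub.ev_p, Bub.ev_p, PiLp.smul_apply, smul_eq_mul, norm_smul, Real.norm_eq_abs, abs_of_pos hr]
  have : (ε / r) ^ 2 + ‖x‖ ^ 2 ≠ 0 := by positivity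
  have : ε ^ 2 + (r * ‖x‖) ^ 2 ≠ 0 := by positivity
  field_simp

lemma QQ_sc (hn : 6 ≤ n) (ε : ℝ) (hε : 0 < ε) (r : ℝ) (hr : 0 < r) (T : Fin n → Fin n → SF n) (x : Euc n) :
    ev x (QQ (bub n hn (ε / r) (div_pos hε hr)) (fun i k => sc r (T i k))) = r ^ 2 * ev (r • x) (QQ (bub n hn ε hε) T) := by
  have eq : ∀ i k l, (bub n hn (ε / r) (div_pos hε hr)).Qt (fun i k => sc r (T i k)) i k l = cst r * sc r ((bub n hn ε hε).Qt T i k l) := by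
    intro i k l
    have ed : ∀ i, (bub n hn (ε / r) (div_pos hε hr)).dot (fun i k => sc r (T i k)) i = cst r * sc r ((bub n hn ε hε).dot T i) := by
      intro i
      unfold Bg.dot
      rw [map_sum, mul_sum]
      exact sum_congr rfl fun k _ => by rw [p_sc hn ε hε r hr, map_mul, mul_assoc]
    have eD : (bub n hn (ε / r) (div_pos hε hr)).D l (sc r (T i k)) = cst r * sc r ((bub n hn ε hε).D l (T i k)) := De_sc r _ _
    unfold Bg.Qt
    rw [ed, ed, eD, p_sc hn ε hε r hr, p_sc hn ε hε r hr]
    have ite : ∀ (p : Prop) [Decidable p] (a : SF n), (if p then cst r * sc r a else 0) = cst r * sc r (if p then a else 0) := by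
      intro p _ a; split_ifs <;> simp
    rw [ite, ite]
    simp only [map_add, map_sub, map_mul]
    ring
  unfold QQ
  simp only [eq, map_sum, map_pow, map_mul, ev_cst, ev_sc, mul_pow, ← mul_sum]

lemma An_smul (z : Fin n) (r : ℝ) (hr : 0 < r) : r • An z 1 = An z r := by
  ext x
  rw [Set.mem_smul_set_iff_inv_smul_mem₀ hr.ne']
  simp only [Set.mem_inter_iff, mem_ball_zero_iff, Set.mem_setOf_eq, norm_smul, norm_inv, Real.norm_eq_abs, abs_of_pos hr,
    PiLp.smul_apply, smul_eq_mul, mul_one]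
  rw [inv_mul_lt_iff₀ hr, le_inv_mul_iff₀ hr, le_inv_mul_iff₀ hr, mul_one, mul_zero, mul_comm r 2]

/-- exponent -/
def ex (α : Fin n → ℕ) : ℝ := 2 * (∑ m, (α m : ℝ)) + 2 - (n : ℝ)

/-- boundary quantity -/
def Sb (ε r : ℝ) (h : Ix n d → ℝ) : ℝ := ∑ p : Ix n d, h p ^ 2 * (r ^ ex p.2.2.1 * ε ^ ((n : ℝ) - 2))

lemma rpow_ex (r : ℝ) (hr : 0 < r) (α : Fin n → ℕ) : r ^ ex α = (r ^ (∑ m, α m)) ^ 2 * (r ^ 2 / r ^ n) := by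
  unfold ex
  rw [Real.rpow_sub hr, Real.rpow_add hr, Real.rpow_natCast, ← Nat.cast_sum, mul_comm (2:ℝ), Real.rpow_mul hr.le, Real.rpow_natCast]
  norm_cast
  ring

lemma rpow_n2 (hn : 6 ≤ n) (r : ℝ) : r ^ ((n : ℝ) - 2) = r ^ (n - 2) := by
  rw [← Real.rpow_natCast, Nat.cast_sub (by omega)]; norm_num

lemma Sb_eq (hn : 6 ≤ n) (ε r : ℝ) (hr : 0 < r) (h : Ix n d → ℝ) : Sb ε r h = nsq (hs r h) * (r ^ 2 / r ^ n * ε ^ (n - 2)) := by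
  unfold Sb nsq hs
  rw [sum_mul]
  refine sum_congr rfl fun p _ => ?_
  rw [rpow_ex r hr, rpow_n2 hn]; ring

theorem loc2 (hn : 6 ≤ n) (z : Fin n) (d : ℕ) : ∃ C : ℝ, 0 < C ∧ ∀ ε (hε : 0 < ε) (h : Ix n d → ℝ) (V : Fin n → SF n), FC z h →
    ∀ r, ε ≤ r → Sb ε r h ≤ C * ∫ x in An z r, ev x ((bub n hn ε hε).U * QQ (bub n hn ε hε) (fun i k => toSF (HP h i k) - (bub n hn ε hε).S V i k)) := by
  obtain ⟨C, hC, hL⟩ := loc1 hn z d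
  refine ⟨C * 5 ^ (n - 2), by positivity, fun ε hε h V hh r her => ?_⟩
  have hr : 0 < r := hε.trans_le her
  have h1 := hL (ε / r) (div_pos hε hr) (hs r h) (fun i => cst r⁻¹ * sc r (V i)) (hh.scale r hr).mem
  set b := bub n hn ε hε with hb
  set T : Fin n → Fin n → SF n := fun i k => toSF (HP h i k) - b.S V i k with hT
  have e1 : (fun i k => toSF (HP (hs r h) i k) - (bub n hn (ε / r) (div_pos hε hr)).S (fun i => cst r⁻¹ * sc r (V i)) i k) = fun i k => sc r (T i k) := by
    funext i k
    rw [HP_sc, S_sc hn ε _ hε _ r hr, ← map_sub]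
  rw [e1] at h1
  simp only [QQ_sc hn ε hε r hr] at h1
  rw [integral_const_mul, Measure.setIntegral_comp_smul_of_pos volume (fun x => ev x (QQ (bub n hn ε hε) T)) (An z 1) hr, An_smul z r hr, finrank_euclideanSpace_fin, smul_eq_mul] at h1
  set I := ∫ x in An z r, ev x (QQ (bub n hn ε hε) T) with hI
  have h2 : (ε / (5 * r ^ 2)) ^ (n - 2) * I ≤ ∫ x in An z r, ev x (b.U * QQ b T) := by
    rw [hI, ← integral_const_mul]
    refine setIntegral_mono_on (An_int z r _ (continuous_const.mul (SF.ev_cont _))) (An_int z r _ (SF.ev_cont _)) (An_meas z r) fun x hx => ?_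
    rw [map_mul]
    refine mul_le_mul_of_nonneg_right ?_ (QQ_nonneg _ _ _)
    rw [hb, Bub.ev_U]
    refine pow_le_pow_left₀ (by positivity) (div_le_div_of_nonneg_left hε.le (by positivity) ?_) _
    have := hx.1.1; rw [mem_ball_zero_iff] at this
    nlinarith [norm_nonneg x]
  rw [Sb_eq hn ε r hr]
  have e2 : r ^ n = r ^ (n - 2) * r ^ 2 := by rw [← pow_add]; congr 1; omega
  have e3 : (r ^ 2 / r ^ n * ε ^ (n - 2)) * (C * (r ^ 2 * ((r ^ n)⁻¹ * I))) = C * 5 ^ (n - 2) * ((ε / (5 * r ^ 2)) ^ (n - 2) * I) := by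
    rw [e2, div_pow, mul_pow, ← pow_mul, mul_comm 2 (n-2), pow_mul]
    field_simp
  calc nsq (hs r h) * (r ^ 2 / r ^ n * ε ^ (n - 2)) = (r ^ 2 / r ^ n * ε ^ (n - 2)) * nsq (hs r h) := mul_comm _ _
    _ ≤ (r ^ 2 / r ^ n * ε ^ (n - 2)) * (C * (r ^ 2 * ((r ^ n)⁻¹ * I))) := mul_le_mul_of_nonneg_left h1 (by positivity)
    _ = _ := e3
    _ ≤ _ := mul_le_mul_of_nonneg_left h2 (by positivity)

end PB


namespace PB
variable {n d : ℕ}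
open SF

/-- weight -/
def kf (ε : ℝ) (α : Fin n → ℕ) (x : Euc n) : ℝ := (ε + ‖x‖) ^ (2 * (∑ m, (α m : ℝ)) + 2 - 2 * (n : ℝ))

lemma kf_nonneg (ε : ℝ) (hε : 0 < ε) (α : Fin n → ℕ) (x : Euc n) : 0 ≤ kf ε α x := Real.rpow_nonneg (by positivity) _

lemma kf_eq (ε : ℝ) (hε : 0 < ε) (α : Fin n → ℕ) (x : Euc n) : kf ε α x = (ε + ‖x‖) ^ (2 * (∑ m, α m) + 2) / (ε + ‖x‖) ^ (2 * n) := by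
  unfold kf
  have h : 0 < ε + ‖x‖ := by positivity
  rw [Real.rpow_sub h, ← Real.rpow_natCast, ← Real.rpow_natCast]
  push_cast; rfl

lemma kf_cont (ε : ℝ) (hε : 0 < ε) (α : Fin n → ℕ) : Continuous (kf (n := n) ε α) := by
  refine Continuous.rpow_const (by fun_prop) fun x => Or.inl ?_
  positivity

/-- weighted sum -/
def Ws (ε : ℝ) (h : Ix n d → ℝ) (s : Set (Euc n)) : ℝ :=
  ∑ p : Ix n d, h p ^ 2 * (ε ^ ((n : ℝ) - 2) * ∫ x in s, kf ε p.2.2.1 x)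

lemma MIdx_le (α : MIdx n d) : ∑ m, α.1 m ≤ d := (Finset.mem_filter.mp α.2).2.2

lemma kf_int (n d : ℕ) : ∃ K : ℝ, 0 < K ∧ ∀ ε (_ : 0 < ε) (α : MIdx n d) (ρ : ℝ) (_ : 0 < ρ) (s : Set (Euc n)), MeasurableSet s →
    (∀ x ∈ s, ρ / 4 ≤ ε + ‖x‖ ∧ ε + ‖x‖ ≤ 4 * ρ) → ∫ x in s, kf ε α.1 x ≤ K * ρ ^ ex α.1 := by
  set v := volume.real (ball (0 : Euc n) 1) with hv
  refine ⟨4 ^ (2 * d + 2) * 4 ^ (2 * n) * (4 ^ n * v) + 1, by positivity, fun ε hε α ρ hρ s hs hx => ?_⟩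
  set c := 4 ^ (2 * d + 2) * 4 ^ (2 * n) * (ρ ^ (2 * (∑ m, α.1 m) + 2) / ρ ^ (2 * n)) with hc
  have hc0 : 0 ≤ c := by positivity
  have hsub : s ⊆ ball 0 (4 * ρ) := fun x h => by
    rw [mem_ball_zero_iff]; linarith [(hx x h).2]
  have hib : ∀ f : Euc n → ℝ, Continuous f → IntegrableOn f (ball 0 (4 * ρ)) := fun f hf =>
    (hf.continuousOn.integrableOn_compact (isCompact_closedBall (0 : Euc n) (4 * ρ))).mono_set ball_subset_closedBall
  have h1 : ∫ x in s, kf ε α.1 x ≤ ∫ x in s, c := by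
    refine setIntegral_mono_on ((hib _ (kf_cont ε hε _)).mono_set hsub) ((hib _ continuous_const).mono_set hsub) hs fun x h => ?_
    obtain ⟨ha, hb⟩ := hx x h
    rw [kf_eq ε hε, hc]
    have hp : 0 < ε + ‖x‖ := by positivity
    have e1 : (ε + ‖x‖) ^ (2 * (∑ m, α.1 m) + 2) ≤ 4 ^ (2 * d + 2) * ρ ^ (2 * (∑ m, α.1 m) + 2) := by
      refine (pow_le_pow_left₀ hp.le hb _).trans ?_
      rw [mul_pow]
      refine mul_le_mul_of_nonneg_right (pow_le_pow_right₀ (by norm_num) ?_) (by positivity)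
      have := MIdx_le α; omega
    have e2 : ρ ^ (2 * n) / 4 ^ (2 * n) ≤ (ε + ‖x‖) ^ (2 * n) := by
      rw [← div_pow]; exact pow_le_pow_left₀ (by positivity) ha _
    refine (div_le_div₀ (by positivity) e1 (by positivity) e2).trans (le_of_eq ?_)
    field_simp
  have h2 : ∫ x in s, c ≤ ∫ x in ball (0 : Euc n) (4 * ρ), c :=
    setIntegral_mono_set (hib _ continuous_const) (Filter.Eventually.of_forall fun _ => hc0) (Filter.Eventually.of_forall hsub)
  have hvol : volume.real (ball (0 : Euc n) (4 * ρ)) = (4 * ρ) ^ n * v := by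
    rw [measureReal_def, Measure.addHaar_ball_of_pos volume _ (by positivity), finrank_euclideanSpace_fin, ENNReal.toReal_mul, ENNReal.toReal_ofReal (by positivity)]
    rfl
  refine (h1.trans h2).trans ?_
  rw [setIntegral_const, hvol, smul_eq_mul, hc, rpow_ex ρ hρ]
  have e3 : ρ ^ (2 * n) = ρ ^ n * ρ ^ n := by rw [two_mul, pow_add]
  have e4 : ρ ^ (2 * (∑ m, α.1 m) + 2) = (ρ ^ (∑ m, α.1 m)) ^ 2 * ρ ^ 2 := by rw [pow_add, mul_comm 2, pow_mul]
  have hq : 0 ≤ (ρ ^ (∑ m, α.1 m)) ^ 2 * (ρ ^ 2 / ρ ^ n) := by positivity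
  rw [e3, e4, mul_pow]
  have e5 : (4:ℝ) ^ n * ρ ^ n * v * (4 ^ (2 * d + 2) * 4 ^ (2 * n) * ((ρ ^ ∑ m, α.1 m) ^ 2 * ρ ^ 2 / (ρ ^ n * ρ ^ n))) =
    4 ^ (2 * d + 2) * 4 ^ (2 * n) * (4 ^ n * v) * ((ρ ^ (∑ m, α.1 m)) ^ 2 * (ρ ^ 2 / ρ ^ n)) := by
    field_simp
  rw [e5]
  linarith

lemma Ws_le (n d : ℕ) : ∃ K : ℝ, 0 < K ∧ ∀ ε (_ : 0 < ε) (h : Ix n d → ℝ) (ρ : ℝ) (_ : 0 < ρ) (s : Set (Euc n)), MeasurableSet s →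
    (∀ x ∈ s, ρ / 4 ≤ ε + ‖x‖ ∧ ε + ‖x‖ ≤ 4 * ρ) → Ws ε h s ≤ K * Sb ε ρ h := by
  obtain ⟨K, hK, hk⟩ := kf_int n d
  refine ⟨K, hK, fun ε hε h ρ hρ s hs hx => ?_⟩
  unfold Ws Sb
  rw [mul_sum]
  refine sum_le_sum fun p _ => ?_
  have := hk ε hε p.2.2 ρ hρ s hs hx
  calc h p ^ 2 * (ε ^ ((n : ℝ) - 2) * ∫ x in s, kf ε p.2.2.1 x) ≤ h p ^ 2 * (ε ^ ((n : ℝ) - 2) * (K * ρ ^ ex p.2.2.1)) := by gcongr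
    _ = _ := by ring

lemma Sb_nonneg (ε r : ℝ) (hε : 0 < ε) (hr : 0 < r) (h : Ix n d → ℝ) : 0 ≤ Sb ε r h :=
  sum_nonneg fun p _ => by positivity

lemma Sb_half (ε r : ℝ) (hε : 0 < ε) (hr : 0 < r) (h : Ix n d → ℝ) : Sb ε (r / 2) h ≤ 2 ^ n * Sb ε r h := by
  unfold Sb
  rw [mul_sum]
  refine sum_le_sum fun p _ => ?_
  have h1 : (r / 2) ^ ex p.2.2.1 ≤ 2 ^ n * r ^ ex p.2.2.1 := by
    rw [rpow_ex _ (by positivity), rpow_ex _ hr]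
    have e1 : ((r / 2) ^ (∑ m, p.2.2.1 m)) ^ 2 ≤ (r ^ (∑ m, p.2.2.1 m)) ^ 2 :=
      pow_le_pow_left₀ (by positivity) (pow_le_pow_left₀ (by positivity) (by linarith) _) 2
    have e2 : (r / 2) ^ 2 / (r / 2) ^ n ≤ 2 ^ n * (r ^ 2 / r ^ n) := by
      have : (r / 2) ^ 2 / (r / 2) ^ n = 1 / 4 * (2 ^ n * (r ^ 2 / r ^ n)) := by
        rw [div_pow, div_pow]; field_simp; norm_num
      rw [this]
      have : 0 ≤ 2 ^ n * (r ^ 2 / r ^ n) := by positivity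
      linarith
    calc _ ≤ (r ^ (∑ m, p.2.2.1 m)) ^ 2 * (2 ^ n * (r ^ 2 / r ^ n)) := mul_le_mul e1 e2 (by positivity) (by positivity)
      _ = _ := by ring
  calc _ ≤ h p ^ 2 * (2 ^ n * r ^ ex p.2.2.1 * ε ^ ((n : ℝ) - 2)) := by gcongr
    _ = _ := by ring

lemma hB_split (z : Fin n) (R : ℝ) (hR : 0 < R) : hB z R = hB z (R / 2) ∪ An z (R / 2) := by
  ext x
  simp only [Set.mem_union, Set.mem_inter_iff, mem_ball_zero_iff, Set.mem_setOf_eq]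
  rw [show 2 * (R / 2) = R by ring]
  constructor
  · rintro ⟨h1, h2⟩
    rcases lt_or_ge ‖x‖ (R / 2) with h | h
    · exact Or.inl ⟨h, h2⟩
    · exact Or.inr ⟨⟨h1, h2⟩, h⟩
  · rintro (⟨h1, h2⟩ | ⟨⟨h1, h2⟩, h⟩)
    · exact ⟨by linarith, h2⟩
    · exact ⟨h1, h2⟩

lemma hB_disj (z : Fin n) (r : ℝ) : Disjoint (hB z r) (An z r) := by
  rw [Set.disjoint_left]
  rintro x ⟨h1, -⟩ ⟨-, h2⟩
  rw [mem_ball_zero_iff] at h1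
  exact absurd h2 (not_le.mpr h1)

lemma hB_int_split (z : Fin n) (R : ℝ) (hR : 0 < R) (f : Euc n → ℝ) (hf : Continuous f) :
    ∫ x in hB z R, f x = (∫ x in hB z (R / 2), f x) + ∫ x in An z (R / 2), f x := by
  rw [hB_split z R hR]
  exact setIntegral_union (hB_disj z _) (An_meas z _) (hB_int z _ f hf) (An_int z _ f hf)

lemma Ws_split (z : Fin n) (R : ℝ) (hR : 0 < R) (ε : ℝ) (hε : 0 < ε) (h : Ix n d → ℝ) :
    Ws ε h (hB z R) = Ws ε h (hB z (R / 2)) + Ws ε h (An z (R / 2)) := by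
  unfold Ws
  rw [← sum_add_distrib]
  refine sum_congr rfl fun p _ => ?_
  rw [hB_int_split z R hR _ (kf_cont ε hε _)]; ring

theorem dyadic (hn : 6 ≤ n) (z : Fin n) (d : ℕ) : ∃ C : ℝ, 0 < C ∧ ∀ ε (hε : 0 < ε) (h : Ix n d → ℝ) (V : Fin n → SF n), FC z h →
    ∀ R, 2 * ε ≤ R → Ws ε h (hB z R) ≤ C * ∫ x in hB z R, ev x ((bub n hn ε hε).U * QQ (bub n hn ε hε) (fun i k => toSF (HP h i k) - (bub n hn ε hε).S V i k)) := by
  obtain ⟨K, hK, hk⟩ := Ws_le n d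
  obtain ⟨C, hC, hl⟩ := loc2 hn z d
  refine ⟨K * C, by positivity, fun ε hε h V hF => ?_⟩
  have hl2 := hl ε hε h V hF
  set F : SF n := (bub n hn ε hε).U * QQ (bub n hn ε hε) (fun i k => toSF (HP h i k) - (bub n hn ε hε).S V i k) with hFd
  have hF0 : ∀ x, 0 ≤ ev x F := fun x => by
    rw [hFd, map_mul, Bub.ev_U]; have := QQ_nonneg (bub n hn ε hε) (fun i k => toSF (HP h i k) - (bub n hn ε hε).S V i k) x; positivity
  have hFs : ∀ R, 0 < R → ∫ x in hB z R, ev x F = (∫ x in hB z (R / 2), ev x F) + ∫ x in An z (R / 2), ev x F :=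
    fun R hR => hB_int_split z R hR _ (SF.ev_cont F)
  have base : ∀ R, 2 * ε ≤ R → R < 4 * ε → Ws ε h (hB z R) ≤ K * C * ∫ x in hB z R, ev x F := by
    intro R h1 h2
    have hR : 0 < R := by linarith
    have a := hk ε hε h (R / 2) (by positivity) (hB z R) (hB_meas z R) fun x hx => by
      have := hx.1; rw [mem_ball_zero_iff] at this
      have := norm_nonneg x
      constructor <;> linarith
    have b := hl2 (R / 2) (by linarith)
    have c : 0 ≤ ∫ x in hB z (R / 2), ev x F := integral_nonneg hF0
    rw [hFs R hR]
    calc _ ≤ _ := a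
      _ ≤ K * (C * ∫ x in An z (R / 2), ev x F) := by gcongr
      _ ≤ _ := by rw [mul_assoc]; gcongr; linarith
  have ind : ∀ J : ℕ, ∀ R, 2 * ε ≤ R → R < 2 ^ (J + 2) * ε → Ws ε h (hB z R) ≤ K * C * ∫ x in hB z R, ev x F := by
    intro J
    induction J with
    | zero => intro R h1 h2; exact base R h1 (by norm_num at h2; exact h2)
    | succ J ih =>
      intro R h1 h2
      rcases lt_or_ge R (4 * ε) with h3 | h3
      · exact base R h1 h3
      · have hR : 0 < R := by linarith
        have a := ih (R / 2) (by linarith) (by rw [show J + 1 + 2 = (J + 2) + 1 by ring, pow_succ] at h2; linarith)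
        have b := hl2 (R / 2) (by linarith)
        have c := hk ε hε h (R / 2) (by positivity) (An z (R / 2)) (An_meas z _) fun x hx => by
          have h4 := hx.1.1; rw [mem_ball_zero_iff] at h4
          have h5 : R / 2 ≤ ‖x‖ := hx.2
          constructor <;> linarith
        rw [hFs R hR, Ws_split z R hR ε hε, mul_add]
        have : K * Sb ε (R / 2) h ≤ K * (C * ∫ x in An z (R / 2), ev x F) := by gcongr
        linarith
  intro R h1
  obtain ⟨J, hJ⟩ := pow_unbounded_of_one_lt (R / ε) (by norm_num : (1:ℝ) < 2)
  refine ind J R h1 ?_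
  rw [div_lt_iff₀ hε] at hJ
  refine hJ.trans_le ?_
  gcongr
  · norm_num
  · omega

end PB


namespace PB
variable {n d : ℕ}
open SF

/-- linear map to H -/
def L0 (i k : Fin n) : (Ix n d → ℝ) →ₗ[ℝ] SF n where
  toFun h := toSF (HP h i k)
  map_add' a b := by rw [HP_add, map_add]
  map_smul' c a := by rw [HP_smul, map_smul, RingHom.id_apply]

lemma nsq_def' (h : Ix n d → ℝ) : nsq h = ∑ p, h p ^ 2 := rfl

lemma abs_le_of_sq {a K N : ℝ} {K' : ℝ} (hK : 0 < K) (hN : 0 ≤ N) (hKK : K ≤ K') (h : a ^ 2 ≤ K * N) : |a| ≤ √K' * √N := by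
  rw [← Real.sqrt_mul (hK.le.trans hKK)]
  refine Real.abs_le_sqrt (h.trans ?_)
  gcongr

lemma H_bd0 (n d : ℕ) : ∃ K : ℝ, 0 < K ∧ ∀ (h : Ix n d → ℝ) (x : Euc n), ‖x‖ ≤ 1 →
    (∀ i k, |ev x (toSF (HP h i k))| ≤ √K * √(nsq h)) ∧
    (∀ i k l, |ev x (De l (toSF (HP h i k)))| ≤ √K * √(nsq h)) ∧
    (∀ i k l m, |ev x (De m (De l (toSF (HP h i k))))| ≤ √K * √(nsq h)) := by
  choose K0 hK0 hb0 using fun (i : Fin n × Fin n) => lin_bd (n := n) (L0 (d := d) i.1 i.2) 1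
  choose K1 hK1 hb1 using fun (i : Fin n × Fin n × Fin n) => lin_bd (n := n) ((De i.2.2).toLinearMap ∘ₗ L0 (d := d) i.1 i.2.1) 1
  choose K2 hK2 hb2 using fun (i : Fin n × Fin n × Fin n × Fin n) =>
    lin_bd (n := n) ((De i.2.2.2).toLinearMap ∘ₗ (De i.2.2.1).toLinearMap ∘ₗ L0 (d := d) i.1 i.2.1) 1
  have s0 : 0 ≤ ∑ i, K0 i := sum_nonneg fun i _ => (hK0 i).le
  have s1 : 0 ≤ ∑ i, K1 i := sum_nonneg fun i _ => (hK1 i).le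
  have s2 : 0 ≤ ∑ i, K2 i := sum_nonneg fun i _ => (hK2 i).le
  refine ⟨∑ i, K0 i + ∑ i, K1 i + ∑ i, K2 i + 1, by positivity, fun h x hx => ⟨fun i k => ?_, fun i k l => ?_, fun i k l m => ?_⟩⟩
  · refine abs_le_of_sq (hK0 (i, k)) (nsq_nonneg h) ?_ (hb0 (i, k) h x hx)
    have := single_le_sum (f := K0) (fun i _ => (hK0 i).le) (mem_univ (i, k))
    linarith
  · refine abs_le_of_sq (hK1 (i, k, l)) (nsq_nonneg h) ?_ (hb1 (i, k, l) h x hx)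
    have := single_le_sum (f := K1) (fun i _ => (hK1 i).le) (mem_univ (i, k, l))
    linarith
  · refine abs_le_of_sq (hK2 (i, k, l, m)) (nsq_nonneg h) ?_ (hb2 (i, k, l, m) h x hx)
    have := single_le_sum (f := K2) (fun i _ => (hK2 i).le) (mem_univ (i, k, l, m))
    linarith

lemma H_bd (n d : ℕ) : ∃ K : ℝ, 0 < K ∧ ∀ (h : Ix n d → ℝ) (δ : ℝ) (_ : 0 < δ) (x : Euc n), ‖x‖ ≤ δ →
    (∀ i k, |ev x (toSF (HP h i k))| ≤ √K * √(nsq (hs δ h))) ∧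
    (∀ i k l, |ev x (De l (toSF (HP h i k)))| ≤ √K * √(nsq (hs δ h)) * δ ^ (-1 : ℤ)) ∧
    (∀ i k l m, |ev x (De m (De l (toSF (HP h i k))))| ≤ √K * √(nsq (hs δ h)) * δ ^ (-2 : ℤ)) := by
  obtain ⟨K, hK, hb⟩ := H_bd0 n d
  refine ⟨K, hK, fun h δ hδ x hx => ?_⟩
  have ey : δ • (δ⁻¹ • x) = x := by rw [smul_smul, mul_inv_cancel₀ hδ.ne', one_smul]
  have hy : ‖δ⁻¹ • x‖ ≤ 1 := by
    rw [norm_smul, norm_inv, Real.norm_eq_abs, abs_of_pos hδ, inv_mul_le_iff₀ hδ, mul_one]; exact hx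
  obtain ⟨b0, b1, b2⟩ := hb (hs δ h) (δ⁻¹ • x) hy
  refine ⟨fun i k => ?_, fun i k l => ?_, fun i k l m => ?_⟩
  · have := b0 i k
    rwa [HP_sc, ev_sc, ey] at this
  · have := b1 i k l
    rw [HP_sc, De_sc, map_mul, ev_cst, ev_sc, ey, abs_mul, abs_of_pos hδ] at this
    rw [zpow_neg_one, ← div_eq_mul_inv, le_div_iff₀ hδ]; linarith
  · have := b2 i k l m
    rw [HP_sc, De_sc, Derivation.leibniz, De_cst, De_sc, smul_zero, add_zero, smul_eq_mul, map_mul, map_mul, ev_cst, ev_sc, ey, abs_mul, abs_mul, abs_of_pos hδ] at this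
    rw [zpow_neg, ← div_eq_mul_inv, le_div_iff₀ (by positivity)]
    have e : δ ^ (2 : ℤ) = δ * δ := by rw [← pow_two]; rfl
    rw [e]; linarith

lemma sum_abs_le (g : Ix n d → ℝ) : ∑ p, |g p| ≤ √(Fintype.card (Ix n d)) * √(nsq g) := by
  rw [← Real.sqrt_mul (by positivity)]
  refine Real.le_sqrt_of_sq_le ?_
  have := sq_sum_le_card_mul_sum_sq (s := (Finset.univ : Finset (Ix n d))) (f := fun p => |g p|)
  simp only [sq_abs, Finset.card_univ] at this
  exact this

lemma V_bd (ε δ : ℝ) (hε : 0 < ε) (hεδ : 2 * ε ≤ δ) (B : ℝ) (hB : 0 < B) (h : Ix n d → ℝ) (x : Euc n) (hx : ‖x‖ ≤ δ) (t : ℕ) (ht : t ≤ 2) (a : ℝ)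
    (ha : a ≤ B * ∑ p : Ix n d, |h p| * (ε + ‖x‖) ^ ((∑ m, (p.2.2.1 m : ℝ)) + 1 - (t : ℝ))) :
    a ≤ B * 2 ^ (d + 1) * √(Fintype.card (Ix n d)) * √(nsq (hs δ h)) * δ ^ ((1 : ℤ) - t) := by
  have hδ : 0 < δ := by linarith
  refine ha.trans ?_
  have h1 : ∑ p : Ix n d, |h p| * (ε + ‖x‖) ^ ((∑ m, (p.2.2.1 m : ℝ)) + 1 - (t : ℝ)) ≤ ∑ p, |hs δ h p| * (2 ^ (d + 1) * δ ^ ((1 : ℤ) - t)) := by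
    refine sum_le_sum fun p _ => ?_
    have h2 : 2 ≤ ∑ m, p.2.2.1 m := (Finset.mem_filter.mp p.2.2.2).2.1
    have hd := MIdx_le p.2.2
    set N := ∑ m, p.2.2.1 m with hN
    have e1 : (∑ m, (p.2.2.1 m : ℝ)) + 1 - (t : ℝ) = ((N + 1 - t : ℕ) : ℝ) := by
      rw [Nat.cast_sub (by omega), hN]; push_cast; ring
    rw [e1, Real.rpow_natCast]
    have h3 : (ε + ‖x‖) ^ (N + 1 - t) ≤ 2 ^ (d + 1) * δ ^ (N + 1 - t) := by
      calc (ε + ‖x‖) ^ (N + 1 - t) ≤ (2 * δ) ^ (N + 1 - t) := pow_le_pow_left₀ (by positivity) (by linarith) _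
        _ = 2 ^ (N + 1 - t) * δ ^ (N + 1 - t) := mul_pow _ _ _
        _ ≤ _ := by
          refine mul_le_mul_of_nonneg_right (pow_le_pow_right₀ (by norm_num) (by omega)) (by positivity)
    have e2 : δ ^ (N + 1 - t) = δ ^ N * δ ^ ((1 : ℤ) - t) := by
      rw [← zpow_natCast, ← zpow_natCast δ N, ← zpow_add₀ hδ.ne']
      congr 1; omega
    unfold hs
    rw [← hN, abs_mul, abs_of_pos (show 0 < δ ^ N by positivity)]
    calc _ ≤ |h p| * (2 ^ (d + 1) * δ ^ (N + 1 - t)) := by gcongr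
      _ = _ := by rw [e2]; ring
  rw [← sum_mul] at h1
  have h4 := sum_abs_le (hs δ h)
  calc _ ≤ B * ((∑ p, |hs δ h p|) * (2 ^ (d + 1) * δ ^ ((1 : ℤ) - t))) := by gcongr
    _ ≤ B * ((√(Fintype.card (Ix n d)) * √(nsq (hs δ h))) * (2 ^ (d + 1) * δ ^ ((1 : ℤ) - t))) := by gcongr
    _ = _ := by ring

theorem core (hn : 6 ≤ n) (z : Fin n) (d : ℕ) : ∃ lam : ℝ, 0 < lam ∧ ∀ B : ℝ, 0 < B → ∃ C : ℝ, 0 < C ∧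
    ∀ ε (hε : 0 < ε) (h : Ix n d → ℝ) (V : Fin n → SF n), FC z h →
      (∀ x : Euc n, x z = 0 → ev x (V z) = 0) →
      (∀ x : Euc n, x z = 0 → ∀ i, i ≠ z → pd z (V i) x = 0) →
      (∀ (L : List (Fin n)), L.length ≤ 2 → ∀ (i : Fin n) (x : Euc n), 0 ≤ x z →
          |pdIter L (V i) x| ≤ B * ∑ p : Ix n d, |h p| * (ε + ‖x‖) ^ ((∑ m, (p.2.2.1 m : ℝ)) + 1 - (L.length : ℝ))) →
      ∀ δ, 2 * ε ≤ δ →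
      (∀ x ∈ hB z δ, ∀ i, ev x ((bub n hn ε hε).div (fun i k => toSF (HP h i k) - (bub n hn ε hε).S V i k) i -
        n * (bub n hn ε hε).dot (fun i k => toSF (HP h i k) - (bub n hn ε hε).S V i k) i) = 0) →
      2 * lam * Ws ε h (hB z δ) - C * Sb ε δ h ≤ ∫ x in hB z δ, (1 / 4) * ev x ((bub n hn ε hε).E4 V (fun i k => toSF (HP h i k))) := by
  obtain ⟨Cd, hCd, hdy⟩ := dyadic hn z d
  obtain ⟨K, hK, hKb⟩ := Ws_le n d
  obtain ⟨C0, hC0, hen⟩ := energy n hn z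
  obtain ⟨KH, hKH, hHb⟩ := H_bd n d
  refine ⟨1 / (8 * Cd), by positivity, fun B hBp => ?_⟩
  set c := √KH + B * 2 ^ (d + 1) * √(Fintype.card (Ix n d)) with hc
  refine ⟨C0 * c ^ 2 + K * 2 ^ n / (4 * Cd) , by positivity, fun ε hε h V hF hV hV2 hVb δ hεδ hdiv => ?_⟩
  have hδ : 0 < δ := by linarith
  set b := bub n hn ε hε with hb
  set N := nsq (hs δ h) with hN
  have hN0 : 0 ≤ N := nsq_nonneg _
  have m1 : √KH * √N ≤ c * √N := by rw [hc, add_mul]; have : 0 ≤ B * 2 ^ (d + 1) * √(Fintype.card (Ix n d)) * √N := by positivity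
                                    linarith
  have m2 : B * 2 ^ (d + 1) * √(Fintype.card (Ix n d)) * √N ≤ c * √N := by
    rw [hc, add_mul]; have : 0 ≤ √KH * √N := by positivity
    linarith
  have en := hen ε hε δ hεδ (c * √N) V (fun i k => toSF (HP h i k)) (fun i k => ext_ev fun x => hF.h1 i k x)
    (ext_ev fun x => by rw [map_sum, map_zero]; exact hF.h2 x) hF.h3 hV hV2 hdiv (by
      intro x hx _
      have hxn : ‖x‖ ≤ δ := (mem_ball_zero_iff.mp hx.1).le
      have hxz : 0 ≤ x z := hx.2
      obtain ⟨b0, b1, b2⟩ := hHb h δ hδ x hxn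
      refine ⟨fun i k => (b0 i k).trans m1, fun i k l => (b1 i k l).trans ?_, fun i k l m => (b2 i k l m).trans ?_, fun i => ?_, fun i l => ?_, fun i l m => ?_⟩
      · gcongr
      · gcongr
      · have := V_bd ε δ hε hεδ B hBp h x hxn 0 (by norm_num) _ (hVb [] (by simp) i x hxz)
        refine this.trans ?_
        rw [show (1 : ℤ) - ((0 : ℕ) : ℤ) = 1 by norm_num, zpow_one]
        gcongr
      · have := V_bd ε δ hε hεδ B hBp h x hxn 1 (by norm_num) _ (hVb [l] (by simp) i x hxz)
        refine this.trans ?_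
        rw [show (1 : ℤ) - ((1 : ℕ) : ℤ) = 0 by norm_num, zpow_zero, mul_one]
        exact m2
      · have := V_bd ε δ hε hεδ B hBp h x hxn 2 (by norm_num) _ (hVb [m, l] (by simp) i x hxz)
        refine this.trans ?_
        rw [show (1 : ℤ) - ((2 : ℕ) : ℤ) = -1 by norm_num]
        gcongr)
  refine le_trans ?_ en
  have eerr : (c * √N) ^ 2 * δ ^ (-2 : ℤ) * (ε / δ ^ 2) ^ (n - 2) * δ ^ n = c ^ 2 * Sb ε δ h := by
    rw [Sb_eq hn ε δ hδ, ← hN, mul_pow, Real.sq_sqrt hN0, zpow_neg, div_pow]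
    have e2 : δ ^ n = δ ^ (n - 2) * δ ^ 2 := by rw [← pow_add]; congr 1; omega
    have e3 : (δ ^ 2) ^ (n - 2) = δ ^ (n - 2) * δ ^ (n - 2) := by rw [← pow_mul, two_mul, pow_add]
    have e4 : δ ^ (2 : ℤ) = δ ^ 2 := rfl
    rw [e2, e3, e4]
    field_simp
  rw [eerr, integral_const_mul]
  set F : SF n := b.U * QQ b (fun i k => toSF (HP h i k) - b.S V i k) with hFd
  change _ ≤ 1 / 4 * (∫ x in hB z (δ / 2), ev x F) - _
  set G := ∫ x in hB z (δ / 2), ev x F with hG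
  have hG0 : 0 ≤ G := integral_nonneg fun x => by
    change 0 ≤ ev x F
    rw [hFd, map_mul, hb, Bub.ev_U]; have := QQ_nonneg (bub n hn ε hε) (fun i k => toSF (HP h i k) - (bub n hn ε hε).S V i k) x; positivity
  have hS0 := Sb_nonneg ε δ hε hδ h
  have hSh := Sb_half ε δ hε hδ h
  have hW : Ws ε h (hB z δ) ≤ Cd * G + K * 2 ^ n * Sb ε δ h := by
    have hKS : K * Sb ε (δ / 2) h ≤ K * 2 ^ n * Sb ε δ h := by rw [mul_assoc]; gcongr
    rcases lt_or_ge δ (4 * ε) with h3 | h3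
    · have a := hKb ε hε h (δ / 2) (by positivity) (hB z δ) (hB_meas z δ) fun x hx => by
        have := hx.1; rw [mem_ball_zero_iff] at this
        have := norm_nonneg x
        constructor <;> linarith
      have : 0 ≤ Cd * G := by positivity
      linarith
    · have a := hdy ε hε h V hF (δ / 2) (by linarith)
      have c := hKb ε hε h (δ / 2) (by positivity) (An z (δ / 2)) (An_meas z _) fun x hx => by
          have h4 := hx.1.1; rw [mem_ball_zero_iff] at h4
          have h5 : δ / 2 ≤ ‖x‖ := hx.2
          constructor <;> linarith
      rw [Ws_split z δ hδ ε hε]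
      linarith
  have h9 : 1 / (4 * Cd) * Ws ε h (hB z δ) ≤ 1 / (4 * Cd) * (Cd * G + K * 2 ^ n * Sb ε δ h) := by gcongr
  have e9 : 1 / (4 * Cd) * (Cd * G + K * 2 ^ n * Sb ε δ h) = 1 / 4 * G + K * 2 ^ n / (4 * Cd) * Sb ε δ h := by field_simp
  have e10 : 2 * (1 / (8 * Cd)) = 1 / (4 * Cd) := by field_simp; norm_num
  rw [e10]
  linarith

end PB


lemma PB.sum_Ix {n d : ℕ} (f : Fin n → Fin n → (Fin n → ℕ) → ℝ) :
    ∑ α ∈ MIdx n d, ∑ i, ∑ k, f i k α = ∑ p : PB.Ix n d, f p.1 p.2.1 p.2.2.1 := by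
  rw [← Finset.sum_coe_sort]
  simp only [Fintype.sum_prod_type]
  rw [Finset.sum_comm]
  exact Finset.sum_congr rfl fun i _ => Finset.sum_comm

/-- the integrated estimate (Proposition `integrated.version`): there are constants
`λ > 0` (depending only on `n`) and `C > 0` (depending only on `n` and `B`) such that for all
`δ ≥ 2ε` the integral of the Brendle expression is bounded below as stated. -/
theorem statement10 (n : ℕ) (hn : 6 ≤ n) (l₀ : Fin n) (hl₀ : (l₀ : ℕ) = n - 1)
    (d : ℕ) (hd : d = (n - 2) / 2) :
    ∃ lam : ℝ, 0 < lam ∧ ∀ B : ℝ, 0 < B → ∃ C : ℝ, 0 < C ∧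
      ∀ (ε : ℝ), 0 < ε →
      ∀ (h : Fin n → Fin n → (Fin n → ℕ) → ℝ) (H : Fin n → Fin n → Euc n → ℝ),
        (∀ i k x, H i k x = ∑ α ∈ MIdx n d, h i k α * ∏ m, x m ^ α m) →
        (∀ i k x, H i k x = H k i x) →
        (∀ x, ∑ i, H i i x = 0) →
        (∀ x : Euc n, 0 ≤ x l₀ → ∀ i, H i l₀ x = 0) →
        (∀ x : Euc n, x l₀ = 0 → ∀ i, ∑ k, H i k x * x k = 0) →
        (∀ x : Euc n, x l₀ = 0 → ∀ i k, pd l₀ (H i k) x = 0) →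
      ∀ V : Fin n → Euc n → ℝ, (∀ i, ContDiff ℝ (⊤ : ℕ∞) (V i)) →
        (∀ x : Euc n, x l₀ = 0 → V l₀ x = 0) →
        (∀ x : Euc n, x l₀ = 0 → ∀ i, i ≠ l₀ → pd l₀ (V i) x = 0) →
        (∀ (L : List (Fin n)), L.length ≤ 2 → ∀ (i : Fin n) (x : Euc n), 0 ≤ x l₀ →
          |pdIter L (V i) x| ≤ B * ∑ α ∈ MIdx n d, ∑ i', ∑ k, |h i' k α|
            * (ε + ‖x‖) ^ ((∑ m, (α m : ℝ)) + 1 - (L.length : ℝ))) →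
      ∀ δ : ℝ, 2 * ε ≤ δ →
        (∀ x ∈ Metric.ball (0 : Euc n) δ, 0 ≤ x l₀ → ∀ i,
          ∑ k, pd k (fun y => uE n ε y ^ (2 * (n : ℝ) / ((n : ℝ) - 2)) * Tten H V i k y) x
            = 0) →
        (∫ x in Metric.ball (0 : Euc n) δ ∩ {x : Euc n | 0 ≤ x l₀},
            ((1 / 4) * uE n ε x ^ 2 * (∑ i, ∑ k, ∑ l, pd l (H i k) x * pd l (H i k) x)
              - (1 / 2) * uE n ε x ^ 2 * (∑ i, ∑ k, ∑ l, pd k (H i k) x * pd l (H i l) x)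
              - 2 * uE n ε x * (∑ i, ∑ k, ∑ l, pd k (uE n ε) x * H i k x * pd l (H i l) x)
              - (2 * ((n : ℝ) - 1) / ((n : ℝ) - 2))
                * (∑ i, ∑ k, ∑ l, pd k (uE n ε) x * pd l (uE n ε) x * H i k x * H i l x)
              - 2 * uE n ε x * wop ε V x * (∑ i, ∑ k, pd i (pd k (H i k)) x)
              + (8 * ((n : ℝ) - 1) / ((n : ℝ) - 2))
                * (∑ i, ∑ k, pd i (uE n ε) x * pd k (wop ε V) x * H i k x)
              - (4 * ((n : ℝ) - 1) / ((n : ℝ) - 2)) * (∑ i, (pd i (wop ε V) x) ^ 2)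
              + (4 * ((n : ℝ) - 1) / ((n : ℝ) - 2)) * (n : ℝ) * ((n : ℝ) + 2)
                * uE n ε x ^ (4 / ((n : ℝ) - 2)) * (wop ε V x) ^ 2))
          ≥ 2 * lam * (∑ α ∈ MIdx n d, ∑ i, ∑ k,
              (h i k α) ^ 2 * ε ^ ((n : ℝ) - 2)
                * ∫ x in Metric.ball (0 : Euc n) δ ∩ {x : Euc n | 0 ≤ x l₀},
                    (ε + ‖x‖) ^ (2 * (∑ m, (α m : ℝ)) + 2 - 2 * (n : ℝ)))
            - C * (∑ α ∈ MIdx n d, ∑ i, ∑ k,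
              (h i k α) ^ 2 * δ ^ (2 * (∑ m, (α m : ℝ)) + 2 - (n : ℝ))
                * ε ^ ((n : ℝ) - 2)) := by
  obtain ⟨lam, hlam, hcore⟩ := PB.core hn l₀ d
  refine ⟨lam, hlam, fun B hBp => ?_⟩
  obtain ⟨C, hC, hc⟩ := hcore B hBp
  refine ⟨C, hC, fun ε hε h H hH hsym htr hz hrad hbd V hVs hV hV2 hVb δ hδ hdiv => ?_⟩
  set g : PB.Ix n d → ℝ := fun p => h p.1 p.2.1 p.2.2.1 with hg
  have eH : ∀ i k, H i k = ((toSF (PB.HP g i k) : SF n) : Euc n → ℝ) := by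
    intro i k
    funext x
    rw [hH]
    change _ = SF.ev x (toSF (PB.HP g i k))
    rw [PB.ev_toSF, PB.HP, map_sum, ← Finset.sum_coe_sort]
    refine sum_congr rfl fun α _ => ?_
    rw [MvPolynomial.smul_eval, PB.mono_eval]
  set W : Fin n → SF n := fun i => ⟨V i, hVs i⟩ with hW
  have eV : V = fun i => (W i : Euc n → ℝ) := rfl
  obtain rfl : H = fun i k => ((toSF (PB.HP g i k) : SF n) : Euc n → ℝ) := by
    funext i k; exact eH i k
  have hF : PB.FC l₀ g := ⟨hsym, htr, hz, hrad, hbd⟩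
  have key := hc ε hε g W hF hV hV2 (fun L hL i x hx => by
      have := hVb L hL i x hx
      rw [PB.sum_Ix (fun i' k α => |h i' k α| * (ε + ‖x‖) ^ ((∑ m, (α m : ℝ)) + 1 - (L.length : ℝ)))] at this
      exact this) δ hδ (fun x hx i => Bub.div_hyp hn ε hε W _ i x (hdiv x hx.1 hx.2 i))
  rw [PB.sum_Ix (fun i k α => (h i k α) ^ 2 * ε ^ ((n : ℝ) - 2)
                * ∫ x in Metric.ball (0 : Euc n) δ ∩ {x : Euc n | 0 ≤ x l₀},
                    (ε + ‖x‖) ^ (2 * (∑ m, (α m : ℝ)) + 2 - 2 * (n : ℝ))),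
    PB.sum_Ix (fun i k α => (h i k α) ^ 2 * δ ^ (2 * (∑ m, (α m : ℝ)) + 2 - (n : ℝ)) * ε ^ ((n : ℝ) - 2))]
  have e1 : ∑ p : PB.Ix n d, (h p.1 p.2.1 p.2.2.1) ^ 2 * ε ^ ((n : ℝ) - 2)
                * ∫ x in Metric.ball (0 : Euc n) δ ∩ {x : Euc n | 0 ≤ x l₀},
                    (ε + ‖x‖) ^ (2 * (∑ m, (p.2.2.1 m : ℝ)) + 2 - 2 * (n : ℝ)) = PB.Ws ε g (hB l₀ δ) :=
    sum_congr rfl fun p _ => mul_assoc _ _ _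
  have e2 : ∑ p : PB.Ix n d, (h p.1 p.2.1 p.2.2.1) ^ 2 * δ ^ (2 * (∑ m, (p.2.2.1 m : ℝ)) + 2 - (n : ℝ)) * ε ^ ((n : ℝ) - 2) = PB.Sb ε δ g :=
    sum_congr rfl fun p _ => mul_assoc _ _ _
  rw [e1, e2, ge_iff_le]
  refine key.trans (le_of_eq ?_)
  refine integral_congr_ae (Filter.Eventually.of_forall fun x => ?_)
  exact (Bub.integrand_eq hn ε hε W (fun i k => toSF (PB.HP g i k)) x).symm
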